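/- arXiv:2104.08083 — 10 statements merged into one kernel-verified Lean document; each statement's English description precedes it below -/
import Mathlib

section
/- Let n, k, s be positive integers with n ≥ (s+1)k. Suppose that for every choice of cross-dependent families G_1, …, G_{s+1} of k-element subsets of [n] one has min_{i∈[s+1]} |G_i| ≤ C(n,k) − C(n−s,k). Then for every choice of cross-dependent families F_1, …, F_{s+1} of k-element subsets of [n+1] one has min_{i∈[s+1]} |F_i| ≤ C(n+1,k) − C(n+1−s,k). -/
open Finset

open scoped FinsetFamily

/-- The families `F i`, `i ∈ I`, admit no choice of pairwise disjoint members. -/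
def CrossDependent {ι α : Type*} (I : Finset ι) (F : ι → Finset (Finset α)) : Prop :=
  ¬ ∃ g : ι → Finset α, (∀ i ∈ I, g i ∈ F i) ∧
    ∀ i ∈ I, ∀ j ∈ I, i ≠ j → Disjoint (g i) (g j)

section Compression

variable {ι α : Type*} [DecidableEq α] {x v : α}

theorem UV.compress_singleton_of_mem {A : Finset α} (hx : x ∉ A) (hv : v ∈ A) :
    UV.compress {x} {v} A = insert x (A.erase v) := by
  have hxv : x ≠ v := by rintro rfl; exact hx hv
  rw [UV.compress_of_disjoint_of_le (by simpa using hx) (by simpa using hv)]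
  ext y
  simp only [sup_eq_union, mem_sdiff, mem_union, mem_singleton, mem_insert, mem_erase]
  grind

theorem UV.compress_singleton_of_notMem {A : Finset α} (h : x ∈ A ∨ v ∉ A) :
    UV.compress {x} {v} A = A := by
  unfold UV.compress
  rw [if_neg]
  simp only [disjoint_singleton_left, singleton_subset_iff]
  tauto

theorem map_swap_of_mem_of_notMem {A : Finset α} (hx : x ∉ A) (hv : v ∈ A) :
    A.map (Equiv.swap x v).toEmbedding = insert x (A.erase v) := by
  ext y
  simp only [mem_map_equiv, Equiv.symm_swap, mem_insert, mem_erase]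
  grind

theorem map_swap_of_notMem {A : Finset α} (hx : x ∉ A) (hv : v ∉ A) :
    A.map (Equiv.swap x v).toEmbedding = A := by
  ext y
  simp only [mem_map_equiv, Equiv.symm_swap]
  grind

/-- A member of the compressed family either is an old member, with its compression, or is
obtained from an old member by exchanging `v` for `x`. -/
theorem UV.mem_compression_singleton_cases {𝒜 : Finset (Finset α)} {A : Finset α}
    (hA : A ∈ 𝓒 {x} {v} 𝒜) :
    (A ∈ 𝒜 ∧ (x ∉ A → A.map (Equiv.swap x v).toEmbedding ∈ 𝒜)) ∨
      (A ∉ 𝒜 ∧ x ∈ A ∧ A.map (Equiv.swap x v).toEmbedding ∈ 𝒜) := by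
  rw [UV.mem_compression] at hA
  obtain ⟨h, hc⟩ | ⟨h, B, hB, rfl⟩ := hA
  · refine Or.inl ⟨h, fun hx => ?_⟩
    by_cases hv : v ∈ A
    · rwa [map_swap_of_mem_of_notMem hx hv, ← UV.compress_singleton_of_mem hx hv]
    · rwa [map_swap_of_notMem hx hv]
  · by_cases hc : x ∈ B ∨ v ∉ B
    · rw [UV.compress_singleton_of_notMem hc] at h
      exact absurd hB h
    · push Not at hc
      refine Or.inr ⟨h, ?_, ?_⟩
      · rw [UV.compress_singleton_of_mem hc.1 hc.2]
        exact mem_insert_self _ _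
      · rw [UV.compress_singleton_of_mem hc.1 hc.2, ← map_swap_of_mem_of_notMem hc.1 hc.2,
          map_map]
        convert hB
        ext y
        simp

theorem CrossDependent.compression {I : Finset ι} {F : ι → Finset (Finset α)}
    (h : CrossDependent I F) (x v : α) : CrossDependent I fun i => 𝓒 {x} {v} (F i) := by
  rintro ⟨g, hg, hd⟩
  by_cases hall : ∀ i ∈ I, g i ∈ F i
  · exact h ⟨g, hall, hd⟩
  push Not at hall
  obtain ⟨i, hi, hgi⟩ := hall
  have hxi : x ∈ g i := by
    obtain h' | h' := UV.mem_compression_singleton_cases (hg i hi)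
    · exact absurd h'.1 hgi
    · exact h'.2.1
  refine h ⟨fun j => (g j).map (Equiv.swap x v).toEmbedding, fun j hj => ?_,
    fun j hj l hl hjl => (disjoint_map _).2 (hd j hj l hl hjl)⟩
  obtain h' | h' := UV.mem_compression_singleton_cases (hg j hj)
  · refine h'.2 fun hxj => ?_
    have hij : i ≠ j := by rintro rfl; exact hgi h'.1
    exact disjoint_left.1 (hd i hi j hj hij) hxi hxj
  · exact h'.2.2

theorem UV.filter_mem_compression_subset (x v : α) (𝒜 : Finset (Finset α)) :
    {A ∈ 𝓒 {x} {v} 𝒜 | v ∈ A} ⊆ {A ∈ 𝒜 | v ∈ A} := by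
  intro A hA
  rw [mem_filter] at hA ⊢
  exact ⟨UV.mem_of_mem_compression hA.1 (by simpa using hA.2) (by simp), hA.2⟩

theorem UV.filter_mem_compression_ssubset {𝒜 : Finset (Finset α)}
    (h : ¬ UV.IsCompressed {x} {v} 𝒜) :
    {A ∈ 𝓒 {x} {v} 𝒜 | v ∈ A} ⊂ {A ∈ 𝒜 | v ∈ A} := by
  refine (ssubset_iff_of_subset (UV.filter_mem_compression_subset x v 𝒜)).2 ?_
  have hns : ¬ 𝒜 ⊆ 𝓒 {x} {v} 𝒜 := fun hs =>
    h (eq_of_subset_of_card_le hs (UV.card_compression _ _ _).le).symm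
  obtain ⟨A, hA, hA'⟩ := not_subset.1 hns
  refine ⟨A, mem_filter.2 ⟨hA, ?_⟩, fun hc => hA' (mem_filter.1 hc).1⟩
  by_contra hv
  apply hA'
  rw [← UV.compress_singleton_of_notMem (x := x) (Or.inr hv)]
  exact UV.compress_mem_compression hA

theorem UV.compression_subset_powersetCard {𝒜 : Finset (Finset α)} {V : Finset α} {k : ℕ}
    (h𝒜 : 𝒜 ⊆ V.powersetCard k) (hx : x ∈ V) : 𝓒 {x} {v} 𝒜 ⊆ V.powersetCard k := by
  intro A hA
  rw [UV.mem_compression] at hA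
  obtain ⟨h, -⟩ | ⟨-, B, hB, rfl⟩ := hA
  · exact h𝒜 h
  · have hB' := mem_powersetCard.1 (h𝒜 hB)
    refine mem_powersetCard.2 ⟨?_, by rw [UV.card_compress (by simp), hB'.2]⟩
    unfold UV.compress
    split_ifs
    · exact sdiff_subset.trans (union_subset hB'.1 (by simpa using hx))
    · exact hB'.1

/-- Cross-dependent families can be compressed simultaneously away from `v`. -/
theorem CrossDependent.exists_isCompressed {I : Finset ι} {V W : Finset α} {k : ℕ}
    (hVW : V ⊆ W) (v : α) (F : ι → Finset (Finset α))
    (hF : ∀ i ∈ I, F i ⊆ W.powersetCard k) (h : CrossDependent I F) :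
    ∃ G : ι → Finset (Finset α), (∀ i ∈ I, G i ⊆ W.powersetCard k) ∧ CrossDependent I G ∧
      (∀ i ∈ I, #(G i) = #(F i)) ∧ ∀ i ∈ I, ∀ x ∈ V, UV.IsCompressed {x} {v} (G i) := by
  induction hw : ∑ i ∈ I, #{A ∈ F i | v ∈ A} using Nat.strong_induction_on generalizing F with
  | _ w ih =>
    by_cases hc : ∀ i ∈ I, ∀ x ∈ V, UV.IsCompressed {x} {v} (F i)
    · exact ⟨F, hF, h, fun _ _ => rfl, hc⟩
    push Not at hc
    obtain ⟨i, hi, x, hx, hix⟩ := hc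
    have hlt : ∑ j ∈ I, #{A ∈ 𝓒 {x} {v} (F j) | v ∈ A} < w := by
      rw [← hw]
      exact sum_lt_sum
        (fun j _ => card_le_card (UV.filter_mem_compression_subset x v (F j)))
        ⟨i, hi, card_lt_card (UV.filter_mem_compression_ssubset hix)⟩
    obtain ⟨G, hG, hGc, hcard, hGs⟩ := ih _ hlt (fun j => 𝓒 {x} {v} (F j))
      (fun j hj => UV.compression_subset_powersetCard (hF j hj) (hVW hx))
      (h.compression x v) rfl
    exact ⟨G, hG, hGc, fun j hj => (hcard j hj).trans (UV.card_compression _ _ _), hGs⟩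

end Compression

section Shadow

variable {α : Type*} [DecidableEq α]

/-- The Lovász form of the Kruskal–Katona theorem, for families of subsets of a finite set. -/
theorem choose_pred_le_card_shadow {V : Finset α} {𝒜 : Finset (Finset α)} {r t : ℕ}
    (h𝒜 : 𝒜 ⊆ V.powersetCard r) (hr : 0 < r) (hrt : r ≤ t) (htV : t ≤ #V)
    (hcard : t.choose r ≤ #𝒜) : t.choose (r - 1) ≤ #(∂ 𝒜) := by
  let f : Fin #V ↪ α := V.equivFin.symm.toEmbedding.trans (Function.Embedding.subtype _)
  have hf : univ.map f = V := by
    ext y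
    simp only [mem_map, mem_univ, true_and, f, Function.Embedding.trans_apply,
      Equiv.coe_toEmbedding, Function.Embedding.subtype_apply]
    exact ⟨fun ⟨a, ha⟩ => ha ▸ (V.equivFin.symm a).2, fun hy => ⟨V.equivFin ⟨y, hy⟩, by simp⟩⟩
  let ℬ : Finset (Finset (Fin #V)) := {B | B.map f ∈ 𝒜}
  have hℬ𝒜 : ℬ.map (mapEmbedding f).toEmbedding = 𝒜 := by
    ext A
    simp only [mem_map, ℬ, mem_filter, mem_univ, true_and, RelEmbedding.coe_toEmbedding,
      mapEmbedding_apply]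
    refine ⟨fun ⟨B, hB, hBA⟩ => hBA ▸ hB, fun hA => ?_⟩
    have hAV := (mem_powersetCard.1 (h𝒜 hA)).1
    rw [← hf, subset_map_iff] at hAV
    obtain ⟨B, -, rfl⟩ := hAV
    exact ⟨B, hA, rfl⟩
  have hsized : (ℬ : Set (Finset (Fin #V))).Sized r := by
    intro B hB
    have hB' : B.map f ∈ 𝒜 := by simpa [ℬ] using hB
    rw [← card_map f, (mem_powersetCard.1 (h𝒜 hB')).2]
  have hkk := kruskal_katona_lovasz_form (i := 1) hr hrt htV hsized
    (by rwa [← card_map (mapEmbedding f).toEmbedding, hℬ𝒜])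
  refine hkk.trans ?_
  rw [Function.iterate_one, ← card_map (mapEmbedding f).toEmbedding]
  refine card_le_card fun A hA => ?_
  simp only [mem_map, RelEmbedding.coe_toEmbedding, mapEmbedding_apply] at hA
  obtain ⟨B, hB, rfl⟩ := hA
  obtain ⟨a, ha, hB⟩ := mem_shadow_iff_insert_mem.1 hB
  refine mem_shadow_iff_insert_mem.2 ⟨f a, by simpa using ha, ?_⟩
  rw [← map_insert]
  simpa [ℬ] using hB

/-- If a family compressed away from `v` misses fewer than `C(t + 1, k)` sets, then it misses fewer
than `C(t, k)` sets avoiding `v`. -/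
theorem card_sdiff_lt_choose_of_isCompressed {V : Finset α} {v : α} (hv : v ∉ V)
    {𝒜 : Finset (Finset α)} {k t : ℕ} (hk : 0 < k) (hkt : k ≤ t) (htV : t ≤ #V)
    (hc : ∀ x ∈ V, UV.IsCompressed {x} {v} 𝒜)
    (hlt : #((insert v V).powersetCard k \ 𝒜) < (t + 1).choose k) :
    #(V.powersetCard k \ 𝒜) < t.choose k := by
  by_contra! hle
  have hshadow := choose_pred_le_card_shadow sdiff_subset hk hkt htV hle
  set D := V.powersetCard k \ 𝒜 with hD
  have hmem : ∀ B ∈ ∂ D, B ⊆ V ∧ insert v B ∈ (insert v V).powersetCard k \ 𝒜 := by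
    intro B hB
    obtain ⟨x, hxB, hxD⟩ := mem_shadow_iff_insert_mem.1 hB
    rw [hD, mem_sdiff, mem_powersetCard, insert_subset_iff] at hxD
    obtain ⟨⟨⟨hxV, hBV⟩, hcard⟩, hx𝒜⟩ := hxD
    have hvB : v ∉ B := fun h => hv (hBV h)
    have hxv : x ≠ v := by rintro rfl; exact hv hxV
    refine ⟨hBV, mem_sdiff.2 ⟨mem_powersetCard.2 ⟨insert_subset_insert v hBV, ?_⟩, fun hvA => ?_⟩⟩
    · rw [card_insert_of_notMem hvB, ← hcard, card_insert_of_notMem hxB]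
    · have h := UV.compress_mem_compression (u := {x}) (v := {v}) hvA
      rw [(hc x hxV).eq, UV.compress_singleton_of_mem (by simp [hxv, hxB])
        (mem_insert_self v B), erase_insert hvB] at h
      exact hx𝒜 h
  have hinj : Set.InjOn (insert v) (∂ D : Set (Finset α)) := fun B hB C hC hBC => by
    have hvB : v ∉ B := fun h => hv ((hmem B hB).1 h)
    have hvC : v ∉ C := fun h => hv ((hmem C hC).1 h)
    rw [← erase_insert hvB, ← erase_insert hvC]
    exact congrArg (fun A => A.erase v) hBC
  have hdisj : Disjoint D ((∂ D).image (insert v)) := by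
    refine disjoint_left.2 fun A hA hA' => ?_
    obtain ⟨B, -, rfl⟩ := mem_image.1 hA'
    exact hv ((mem_powersetCard.1 (mem_sdiff.1 hA).1).1 (mem_insert_self v B))
  have hsub : D ∪ (∂ D).image (insert v) ⊆ (insert v V).powersetCard k \ 𝒜 := by
    refine union_subset (sdiff_subset_sdiff (powersetCard_mono (subset_insert v V)) subset_rfl) ?_
    exact image_subset_iff.2 fun B hB => (hmem B hB).2
  have hcard := card_le_card hsub
  rw [card_union_of_disjoint hdisj, card_image_of_injOn hinj] at hcard
  obtain ⟨k, rfl⟩ := Nat.exists_eq_add_one.2 hk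
  rw [Nat.choose_succ_succ'] at hlt
  simp only [Nat.add_sub_cancel] at hshadow
  omega

end Shadow


/-- Induction-on-`n` step for the rainbow Erdős Matching Conjecture: if every
`(s+1)`-tuple of cross-dependent families of `k`-subsets of `[n]` has a member of size
at most `C(n,k) − C(n−s,k)`, then every `(s+1)`-tuple of cross-dependent families of
`k`-subsets of `[n+1]` has a member of size at most `C(n+1,k) − C(n+1−s,k)`. -/
theorem rainbow_EMC_induction_step (n k s : ℕ) (hn : 0 < n) (hk : 0 < k) (hs : 0 < s)
    (hnk : (s + 1) * k ≤ n)
    (H : ∀ G : ℕ → Finset (Finset ℕ),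
      (∀ i ∈ Finset.Icc 1 (s + 1), G i ⊆ (Finset.Icc 1 n).powersetCard k) →
      (¬ ∃ g : ℕ → Finset ℕ, (∀ i ∈ Finset.Icc 1 (s + 1), g i ∈ G i) ∧
        ∀ i ∈ Finset.Icc 1 (s + 1), ∀ j ∈ Finset.Icc 1 (s + 1), i ≠ j →
          Disjoint (g i) (g j)) →
      ∃ i ∈ Finset.Icc 1 (s + 1), (G i).card ≤ n.choose k - (n - s).choose k)
    (F : ℕ → Finset (Finset ℕ))
    (hF : ∀ i ∈ Finset.Icc 1 (s + 1), F i ⊆ (Finset.Icc 1 (n + 1)).powersetCard k)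
    (hcross : ¬ ∃ g : ℕ → Finset ℕ, (∀ i ∈ Finset.Icc 1 (s + 1), g i ∈ F i) ∧
      ∀ i ∈ Finset.Icc 1 (s + 1), ∀ j ∈ Finset.Icc 1 (s + 1), i ≠ j →
        Disjoint (g i) (g j)) :
    ∃ i ∈ Finset.Icc 1 (s + 1), (F i).card ≤ (n + 1).choose k - (n + 1 - s).choose k := by
  by_contra! hbig
  obtain ⟨G, hG, hGc, hcard, hGs⟩ :=
    CrossDependent.exists_isCompressed (Icc_subset_Icc_right (Nat.le_add_right n 1)) (n + 1) F hF hcross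
  obtain ⟨i, hi, hle⟩ := H (fun i => (Icc 1 n).powersetCard k ∩ G i)
    (fun i _ => inter_subset_left)
    (fun ⟨g, hg, hd⟩ => hGc ⟨g, fun i hi => (mem_inter.1 (hg i hi)).2, hd⟩)
  have hks : k ≤ n - s := by
    have : s ≤ s * k := Nat.le_mul_of_pos_right s hk
    rw [add_one_mul] at hnk
    omega
  have hsucc : n + 1 - s = n - s + 1 := by
    have : 0 < n - s := hk.trans_le hks
    omega
  have hIcc : Icc 1 (n + 1) = insert (n + 1) (Icc 1 n) :=
    (insert_Icc_right_eq_Icc_add_one (by omega)).symm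
  have hlt : #((insert (n + 1) (Icc 1 n)).powersetCard k \ G i) < (n - s + 1).choose k := by
    have hb := hbig i hi
    have hle' := card_le_card (hG i hi)
    rw [← hIcc, card_sdiff_of_subset (hG i hi), hcard i hi]
    rw [hcard i hi] at hle'
    rw [hsucc] at hb
    have hpos : 0 < (n - s + 1).choose k := Nat.choose_pos (by omega)
    simp only [card_powersetCard, Nat.card_Icc, Nat.add_sub_cancel] at hle' ⊢
    omega
  have hlt' := card_sdiff_lt_choose_of_isCompressed (by simp) hk hks (by simp) (hGs i hi) hlt
  have hsum := card_sdiff_add_card_inter ((Icc 1 n).powersetCard k) (G i)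
  have hmono : (n - s).choose k ≤ n.choose k := Nat.choose_le_choose k (Nat.sub_le n s)
  simp only [card_powersetCard, Nat.card_Icc, Nat.add_sub_cancel] at hsum
  omega
end

section
/- Let k ≥ 1 and s ≥ 50 be integers and set n = ⌈3e(s+1)k⌉ (where e is Euler's number). Let F_1, …, F_{s+1} be shifted, cross-dependent families of k-element subsets of [n]. Suppose that |F_i({s+1})| < s^{−4}·C(n−s−1, k−1) for every i ∈ [s+1], and that F_j ≠ A for at least one j ∈ [s+1], where A = {F ⊆ [n] : |F| = k, F ∩ [s] ≠ ∅}. Then min_{i∈[s+1]} |F_i| < C(n,k) − C(n−s,k). -/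
open Finset

/-- A family of subsets of `[n]` is shifted if replacing a larger element by a smaller
missing one keeps sets in the family. -/
def Shifted (n : ℕ) (F : Finset (Finset ℕ)) : Prop :=
  ∀ i j : ℕ, 1 ≤ i → i < j → j ≤ n → ∀ A ∈ F, j ∈ A → i ∉ A → insert i (A.erase j) ∈ F

/-- The link `F({j}) = {A \ {j} : A ∈ F, A ∩ [s+1] = {j}}`. -/
def link (s : ℕ) (F : Finset (Finset ℕ)) (j : ℕ) : Finset (Finset ℕ) :=
  (F.filter fun A => A ∩ Finset.Icc 1 (s + 1) = {j}).image fun A => A.erase j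

/-- The extremal family `𝒜 = {F ⊆ [n] : |F| = k, F ∩ [s] ≠ ∅}`. -/
def extremalFamily (n k s : ℕ) : Finset (Finset ℕ) :=
  ((Finset.Icc 1 n).powersetCard k).filter fun A => (A ∩ Finset.Icc 1 s).Nonempty

section Slice

variable {α : Type*} [DecidableEq α]

theorem sum_powersetCard_succ_erase (V : Finset α) (r : ℕ) (φ : Finset α → Finset α → ℝ) :
    ∑ B ∈ V.powersetCard (r + 1), ∑ b ∈ B, φ B (B.erase b) =
      ∑ A ∈ V.powersetCard r, ∑ x ∈ V \ A, φ (insert x A) A := by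
  rw [Finset.sum_sigma', Finset.sum_sigma']
  refine Finset.sum_bij' (fun p _ => ⟨p.1.erase p.2, p.2⟩) (fun p _ => ⟨insert p.2 p.1, p.2⟩)
    ?_ ?_ ?_ ?_ ?_
  · rintro ⟨B, b⟩ h
    simp only [mem_sigma, mem_powersetCard, mem_sdiff, mem_erase] at h ⊢
    obtain ⟨⟨hB, hc⟩, hb⟩ := h
    refine ⟨⟨(erase_subset _ _).trans hB, ?_⟩, hB hb, by simp⟩
    rw [card_erase_of_mem hb, hc]; rfl
  · rintro ⟨A, x⟩ h
    simp only [mem_sigma, mem_powersetCard, mem_sdiff] at h ⊢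
    obtain ⟨⟨hA, hc⟩, hx, hxA⟩ := h
    refine ⟨⟨insert_subset hx hA, ?_⟩, mem_insert_self _ _⟩
    rw [card_insert_of_notMem hxA, hc]
  · rintro ⟨B, b⟩ h
    simp only [mem_sigma] at h
    simp [insert_erase h.2]
  · rintro ⟨A, x⟩ h
    simp only [mem_sigma, mem_sdiff] at h
    simp [erase_insert h.2.2]
  · rintro ⟨B, b⟩ h
    simp only [mem_sigma] at h
    simp [insert_erase h.2]

/-- On `r`-subsets of `V`, the commutator of the "sum over supersets" and "sum over subsets"
operators is multiplication by `#V - 2 * r`. -/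
theorem sum_insert_sum_erase (V : Finset α) (f : Finset α → ℝ) {A : Finset α} (hA : A ⊆ V) :
    ∑ x ∈ V \ A, ∑ b ∈ insert x A, f ((insert x A).erase b) =
      ∑ b ∈ A, ∑ x ∈ V \ A.erase b, f (insert x (A.erase b)) +
        ((#V : ℝ) - 2 * #A) * f A := by
  have h1 : ∀ x ∈ V \ A, ∑ b ∈ insert x A, f ((insert x A).erase b) =
      f A + ∑ b ∈ A, f (insert x (A.erase b)) := by
    intro x hx
    have hx' := (mem_sdiff.1 hx).2
    rw [sum_insert hx', erase_insert hx']
    congr 1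
    refine sum_congr rfl fun b hb => ?_
    rw [erase_insert_of_ne]
    rintro rfl
    exact hx' hb
  have h2 : ∀ b ∈ A, ∑ x ∈ V \ A.erase b, f (insert x (A.erase b)) =
      f A + ∑ x ∈ V \ A, f (insert x (A.erase b)) := by
    intro b hb
    have : V \ A.erase b = insert b (V \ A) := by
      rw [sdiff_erase (hA hb)]
    rw [this, sum_insert (by simp [hb]), insert_erase hb]
  rw [sum_congr rfl h1, sum_congr rfl h2, sum_add_distrib, sum_add_distrib, sum_comm (s := A)]
  simp only [sum_const, nsmul_eq_mul, card_sdiff_of_subset hA]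
  rw [Nat.cast_sub (card_le_card hA)]
  ring

theorem sum_sq_sum_erase_succ (V : Finset α) (r : ℕ) (f : Finset α → ℝ) :
    ∑ B ∈ V.powersetCard (r + 2), (∑ b ∈ B, f (B.erase b)) ^ 2 =
      ∑ C ∈ V.powersetCard r, (∑ x ∈ V \ C, f (insert x C)) ^ 2 +
        ((#V : ℝ) - 2 * (r + 1)) * ∑ A ∈ V.powersetCard (r + 1), f A ^ 2 := by
  have h1 : ∑ B ∈ V.powersetCard (r + 2), (∑ b ∈ B, f (B.erase b)) ^ 2 =
      ∑ A ∈ V.powersetCard (r + 1),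
        (∑ x ∈ V \ A, ∑ b ∈ insert x A, f ((insert x A).erase b)) * f A := by
    rw [sum_congr rfl fun A _ => sum_mul (V \ A)
      (fun x => ∑ b ∈ insert x A, f ((insert x A).erase b)) (f A),
      ← sum_powersetCard_succ_erase V (r + 1)
      (fun B A => (∑ b ∈ B, f (B.erase b)) * f A)]
    simp only [sq, mul_sum]
  have h2 : ∑ C ∈ V.powersetCard r, (∑ x ∈ V \ C, f (insert x C)) ^ 2 =
      ∑ A ∈ V.powersetCard (r + 1),
        (∑ b ∈ A, ∑ x ∈ V \ A.erase b, f (insert x (A.erase b))) * f A := by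
    rw [sum_congr rfl fun A _ => sum_mul A
      (fun b => ∑ x ∈ V \ A.erase b, f (insert x (A.erase b))) (f A),
      sum_powersetCard_succ_erase V r
      (fun A C => (∑ x ∈ V \ C, f (insert x C)) * f A)]
    simp only [sq, mul_sum]
  rw [h1, h2, mul_sum, ← sum_add_distrib]
  refine sum_congr rfl fun A hA => ?_
  obtain ⟨hA, hc⟩ := mem_powersetCard.1 hA
  rw [sum_insert_sum_erase V f hA, hc]
  push_cast
  ring

theorem sum_sq_sum_erase_le (V : Finset α) (r : ℕ) :
    ∀ f : Finset α → ℝ, ∑ A ∈ V.powersetCard r, f A = 0 →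
      ∑ B ∈ V.powersetCard (r + 1), (∑ b ∈ B, f (B.erase b)) ^ 2 ≤
        r * ((#V : ℝ) - r - 1) * ∑ A ∈ V.powersetCard r, f A ^ 2 := by
  induction r with
  | zero =>
    intro f hf
    simp only [powersetCard_zero, sum_singleton] at hf
    refine (sum_eq_zero fun B hB => ?_).le.trans (by simp)
    obtain ⟨-, hc⟩ := mem_powersetCard.1 hB
    obtain ⟨x, rfl⟩ := card_eq_one.1 hc
    simp [hf]
  | succ r ih =>
    intro f hf
    rw [sum_sq_sum_erase_succ]
    set g : Finset α → ℝ := fun C => ∑ x ∈ V \ C, f (insert x C) with hg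
    have hg0 : ∑ C ∈ V.powersetCard r, g C = 0 := by
      have := sum_powersetCard_succ_erase V r (fun A _ => f A)
      rw [hg, ← this]
      have : ∀ A ∈ V.powersetCard (r + 1), ∑ _b ∈ A, f A = (r + 1 : ℕ) * f A := fun A hA => by
        simp [(mem_powersetCard.1 hA).2]
      rw [sum_congr rfl this, ← mul_sum, hf, mul_zero]
    have key := ih g hg0
    have h2 : ∑ C ∈ V.powersetCard r, g C ^ 2 =
        ∑ A ∈ V.powersetCard (r + 1), (∑ b ∈ A, g (A.erase b)) * f A := by
      simp only [sum_mul]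
      rw [sum_powersetCard_succ_erase V r (fun A C => g C * f A)]
      simp only [sq, hg, mul_sum]
    have cs := sum_mul_sq_le_sq_mul_sq (V.powersetCard (r + 1))
      (fun A => ∑ b ∈ A, g (A.erase b)) f
    simp only [← h2] at cs
    set X := ∑ C ∈ V.powersetCard r, g C ^ 2 with hX
    set Y := ∑ A ∈ V.powersetCard (r + 1), f A ^ 2 with hY
    have hX0 : 0 ≤ X := sum_nonneg fun _ _ => sq_nonneg _
    have hY0 : 0 ≤ Y := sum_nonneg fun _ _ => sq_nonneg _
    have h3 : X * X ≤ X * (r * ((#V : ℝ) - r - 1) * Y) := by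
      nlinarith [mul_le_mul_of_nonneg_right key hY0]
    have h4 : 0 ≤ r * ((#V : ℝ) - r - 1) * Y := by
      rcases lt_or_ge #V (r + 1) with h | h
      · rw [hY, powersetCard_eq_empty.2 h]
        simp
      · have : (r : ℝ) + 1 ≤ #V := by exact_mod_cast h
        exact mul_nonneg (mul_nonneg r.cast_nonneg (by linarith)) hY0
    have h5 : X ≤ r * ((#V : ℝ) - r - 1) * Y := by
      rcases hX0.eq_or_lt with h | h
      · rwa [← h]
      · exact le_of_mul_le_mul_left h3 h
    push_cast
    linarith

theorem sum_powersetCard_sum_powersetCard (V : Finset α) (r j : ℕ) (f : Finset α → ℝ) :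
    ∑ S ∈ V.powersetCard (r + j), ∑ A ∈ S.powersetCard r, f A =
      (#V - r).choose j * ∑ A ∈ V.powersetCard r, f A := by
  rw [sum_comm' (t' := V.powersetCard r)
    (s' := fun A => (V.powersetCard (r + j)).filter (A ⊆ ·))]
  · rw [mul_sum]
    refine sum_congr rfl fun A hA => ?_
    obtain ⟨hA, hc⟩ := mem_powersetCard.1 hA
    rw [sum_const, card_filter_powersetCard_subset A V (r + j) hA (by omega), hc,
      nsmul_eq_mul, Nat.add_sub_cancel_left]
  · intro S A
    simp only [mem_powersetCard, mem_filter]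
    constructor
    · rintro ⟨⟨h1, h2⟩, h3, h4⟩
      exact ⟨⟨⟨h1, h2⟩, h3⟩, h3.trans h1, h4⟩
    · rintro ⟨⟨⟨h1, h2⟩, h3⟩, -, h4⟩
      exact ⟨⟨h1, h2⟩, h3, h4⟩

theorem sum_powersetCard_sum_powersetCard_sdiff (V : Finset α) (r : ℕ) (f : Finset α → ℝ) :
    ∑ T ∈ V.powersetCard r, ∑ A ∈ (V \ T).powersetCard r, f A =
      (#V - r).choose r * ∑ A ∈ V.powersetCard r, f A := by
  rw [sum_comm' (t' := V.powersetCard r) (s' := fun A => (V \ A).powersetCard r)]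
  · rw [mul_sum]
    refine sum_congr rfl fun A hA => ?_
    obtain ⟨hA, hc⟩ := mem_powersetCard.1 hA
    rw [sum_const, card_powersetCard, card_sdiff_of_subset hA, hc, nsmul_eq_mul]
  · intro T A
    simp only [mem_powersetCard, subset_sdiff]
    constructor
    · rintro ⟨⟨h1, h2⟩, ⟨h3, h4⟩, h5⟩
      exact ⟨⟨⟨h1, h4.symm⟩, h2⟩, h3, h5⟩
    · rintro ⟨⟨⟨h1, h2⟩, h3⟩, h4, h5⟩
      exact ⟨⟨h1, h3⟩, ⟨h4, h2.symm⟩, h5⟩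

/-- Averaging over the `(r + 1)`-subsets of `(r + 1 + j)`-sets contracts functions of mean
zero. -/
theorem sum_sq_sum_powersetCard_le (V : Finset α) (r : ℕ) (f : Finset α → ℝ)
    (hf : ∑ A ∈ V.powersetCard (r + 1), f A = 0) (j : ℕ) (hj : r + 1 + j < #V) :
    ∑ S ∈ V.powersetCard (r + 1 + j), (∑ A ∈ S.powersetCard (r + 1), f A) ^ 2 ≤
      (r + j).choose j * (#V - r - 2).choose j * ∑ A ∈ V.powersetCard (r + 1), f A ^ 2 := by
  induction j with
  | zero =>
    simp only [add_zero, Nat.choose_zero_right, Nat.cast_one, one_mul]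
    refine (sum_congr rfl fun S hS => ?_).le
    obtain ⟨-, hc⟩ := mem_powersetCard.1 hS
    rw [← hc, powersetCard_self, sum_singleton]
  | succ j ih =>
    have ih := ih (by omega)
    set g : Finset α → ℝ := fun S => ∑ A ∈ S.powersetCard (r + 1), f A with hg
    have hg0 : ∑ S ∈ V.powersetCard (r + 1 + j), g S = 0 := by
      rw [hg, sum_powersetCard_sum_powersetCard, hf, mul_zero]
    have h1 := sum_sq_sum_erase_le V (r + 1 + j) g hg0
    have h2 : ∀ S ∈ V.powersetCard (r + 1 + j + 1),
        (∑ b ∈ S, g (S.erase b)) ^ 2 = ((j : ℝ) + 1) ^ 2 * g S ^ 2 := by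
      intro S hS
      obtain ⟨-, hc⟩ := mem_powersetCard.1 hS
      have h3 : ∑ b ∈ S, g (S.erase b) = ∑ T ∈ S.powersetCard (r + 1 + j), g T := by
        have h4 := sum_powersetCard_succ_erase S (r + 1 + j) (fun _ A => g A)
        rw [← hc, powersetCard_self, sum_singleton] at h4
        rw [h4]
        refine sum_congr rfl fun T hT => ?_
        obtain ⟨hT, hTc⟩ := mem_powersetCard.1 hT
        rw [sum_const, card_sdiff_of_subset hT, hc, hTc, Nat.add_sub_cancel_left, one_smul]
      rw [h3, hg, sum_powersetCard_sum_powersetCard, hc,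
        show r + 1 + j + 1 - (r + 1) = j + 1 by omega, Nat.choose_succ_self_right]
      push_cast
      ring
    rw [sum_congr rfl h2, ← mul_sum] at h1
    rw [← add_assoc]
    have c1 : ((r + (j + 1)).choose (j + 1) : ℝ) * (j + 1) = (r + j + 1) * (r + j).choose j := by
      have := Nat.add_one_mul_choose_eq (r + j) j
      rw [← add_assoc]
      exact_mod_cast this.symm
    have c2 : ((#V - r - 2).choose (j + 1) : ℝ) * (j + 1) =
        (#V - r - 2).choose j * ((#V : ℝ) - (r + 1 + j) - 1) := by
      have := Nat.choose_succ_right_eq (#V - r - 2) j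
      have h5 : ((#V - r - 2 - j : ℕ) : ℝ) = (#V : ℝ) - (r + 1 + j) - 1 := by
        rw [Nat.sub_sub, Nat.sub_sub, Nat.cast_sub (by omega)]
        push_cast
        ring
      rw [← h5]
      exact_mod_cast this
    have h6 : (0 : ℝ) ≤ #V - (r + 1 + j) - 1 := by
      have : ((r + 1 + j + 1 : ℕ) : ℝ) ≤ #V := by exact_mod_cast by omega
      push_cast at this
      linarith
    refine le_of_mul_le_mul_left (a := ((j : ℝ) + 1) ^ 2) (h1.trans ?_) (by positivity)
    calc _ ≤ ((r + 1 + j : ℕ) : ℝ) * ((#V : ℝ) - (r + 1 + j : ℕ) - 1) *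
          ((r + j).choose j * (#V - r - 2).choose j * ∑ A ∈ V.powersetCard (r + 1), f A ^ 2) := by
          refine mul_le_mul_of_nonneg_left ih (mul_nonneg (Nat.cast_nonneg _) ?_)
          push_cast
          exact h6
      _ = ((r + j + 1) * (r + j).choose j) *
          ((#V - r - 2).choose j * ((#V : ℝ) - (r + 1 + j) - 1)) *
            ∑ A ∈ V.powersetCard (r + 1), f A ^ 2 := by
          push_cast
          ring
      _ = _ := by
          rw [← c1, ← c2]
          ring

/-- Some choice of pairwise disjoint `r`-subsets of `V` does at most as badly as the average. -/
theorem exists_pairwise_disjoint_sum_le_average {ι : Type*} [DecidableEq ι] (r : ℕ)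
    (w : ι → Finset α → ℝ) (hw : ∀ i S, 0 ≤ w i S) (I : Finset ι) :
    ∀ V : Finset α, #I * r ≤ #V → ∃ T : ι → Finset α, (∀ i ∈ I, T i ∈ V.powersetCard r) ∧
      (I : Set ι).PairwiseDisjoint T ∧
      ∑ i ∈ I, w i (T i) ≤ (∑ i ∈ I, ∑ S ∈ V.powersetCard r, w i S) / (#V).choose r := by
  induction I using Finset.induction_on with
  | empty => exact fun V _ => ⟨fun _ => ∅, by simp⟩
  | insert a I ha ih =>
    intro V hV
    rw [card_insert_of_notMem ha, add_mul, one_mul] at hV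
    have hr : r ≤ #V := by omega
    have hC : (0 : ℝ) < (#V).choose r := by exact_mod_cast Nat.choose_pos hr
    set W : Finset α → ℝ := fun S => ∑ i ∈ I, w i S with hW
    have hW0 : ∀ S, 0 ≤ W S := fun S => sum_nonneg fun i _ => hw i S
    obtain ⟨T₀, hT₀, hle⟩ : ∃ T₀ ∈ V.powersetCard r,
        w a T₀ + (∑ S ∈ (V \ T₀).powersetCard r, W S) / (#V - r).choose r ≤
          (∑ S ∈ V.powersetCard r, (w a S + W S)) / (#V).choose r := by
      refine exists_le_of_sum_le (powersetCard_nonempty.2 hr) ?_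
      rw [sum_add_distrib, ← sum_div, sum_powersetCard_sum_powersetCard_sdiff, sum_const,
        card_powersetCard, nsmul_eq_mul, mul_div_cancel₀ _ hC.ne', sum_add_distrib]
      gcongr
      rw [mul_comm, mul_div_assoc]
      exact mul_le_of_le_one_right (sum_nonneg fun S _ => hW0 S) (div_self_le_one _)
    obtain ⟨hT₀V, hT₀c⟩ := mem_powersetCard.1 hT₀
    have hcard : #(V \ T₀) = #V - r := by rw [card_sdiff_of_subset hT₀V, hT₀c]
    obtain ⟨T, hT, hdisj, hsum⟩ := ih (V \ T₀) (by omega)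
    have hne : ∀ i ∈ I, i ≠ a := fun i hi h => ha (h ▸ hi)
    refine ⟨Function.update T a T₀, ?_, ?_, ?_⟩
    · intro i hi
      rcases mem_insert.1 hi with rfl | hi
      · simpa using hT₀
      · rw [Function.update_of_ne (hne i hi)]
        exact powersetCard_mono sdiff_subset (hT i hi)
    · rw [coe_insert, Set.pairwiseDisjoint_insert_of_notMem (by simpa using ha)]
      constructor
      · intro i hi j hj hij
        rw [Function.onFun, Function.update_of_ne (hne i hi), Function.update_of_ne (hne j hj)]
        exact hdisj hi hj hij
      · intro j hj
        rw [Function.update_self, Function.update_of_ne (hne j hj)]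
        exact (subset_sdiff.1 (mem_powersetCard.1 (hT j hj)).1).2.symm
    · rw [sum_insert ha, sum_insert ha, Function.update_self]
      rw [sum_congr rfl fun i hi => by rw [Function.update_of_ne (hne i hi)]]
      rw [hcard, sum_comm] at hsum
      rw [sum_comm (s := I), ← sum_add_distrib]
      linarith

/-- If no transversal of the square matrix of families `G` has a rainbow matching inside `V`, then
a random `r`-subset of `V` is missing from at least `s` of the families on average. -/
theorem le_sum_card_sdiff_of_blocked (V : Finset α) (r s : ℕ) [NeZero s]
    (G : Fin s → Fin s → Finset (Finset α)) (hV : s * r ≤ #V) (hr : r ≤ #V)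
    (h : ∀ π : Fin s → Fin s, π.Injective → ∀ T : Fin s → Finset α,
      (∀ a, T a ∈ V.powersetCard r) → Pairwise (fun a b => Disjoint (T a) (T b)) →
        ∃ a, T a ∉ G a (π a)) :
    (s : ℝ) * (#V).choose r ≤
      ∑ S ∈ V.powersetCard r, ∑ a, ∑ b, if S ∈ G a b then (0 : ℝ) else 1 := by
  have hC : (0 : ℝ) < (#V).choose r := by exact_mod_cast Nat.choose_pos hr
  have h1 : ∀ c : Fin s, ((#V).choose r : ℝ) ≤
      ∑ a, ∑ S ∈ V.powersetCard r, if S ∈ G a (a + c) then (0 : ℝ) else 1 := by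
    intro c
    obtain ⟨T, hT, hdisj, hle⟩ := exists_pairwise_disjoint_sum_le_average r
      (fun a S => if S ∈ G a (a + c) then (0 : ℝ) else 1)
      (fun a S => by split_ifs <;> norm_num) univ V (by simpa using hV)
    obtain ⟨a, ha⟩ := h (· + c) (add_left_injective c) T (fun a => hT a (mem_univ a))
      fun a b hab => hdisj (mem_coe.2 (mem_univ a)) (mem_coe.2 (mem_univ b)) hab
    have h2 : (1 : ℝ) ≤ ∑ a, if T a ∈ G a (a + c) then (0 : ℝ) else 1 := by
      refine le_trans (by simp [ha]) (single_le_sum (s := univ)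
        (f := fun a => if T a ∈ G a (a + c) then (0 : ℝ) else 1)
        (fun a _ => by split_ifs <;> norm_num) (mem_univ a))
    have h3 := h2.trans hle
    rwa [le_div_iff₀ hC, one_mul] at h3
  calc (s : ℝ) * (#V).choose r = ∑ _c : Fin s, ((#V).choose r : ℝ) := by simp
    _ ≤ ∑ c : Fin s, ∑ a, ∑ S ∈ V.powersetCard r, if S ∈ G a (a + c) then (0 : ℝ) else 1 :=
        sum_le_sum fun c _ => h1 c
    _ = ∑ a, ∑ b, ∑ S ∈ V.powersetCard r, if S ∈ G a b then (0 : ℝ) else 1 := by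
        rw [sum_comm]
        exact sum_congr rfl fun a _ => Equiv.sum_comp (Equiv.addLeft a)
          (fun b => ∑ S ∈ V.powersetCard r, if S ∈ G a b then (0 : ℝ) else 1)
    _ = _ := by
        rw [sum_comm (s := V.powersetCard r)]
        exact sum_congr rfl fun a _ => sum_comm

/-- Stability for blocked matrices: if every member of `H` blocks all rainbow matchings of the
transversals of `G`, then many sets are missing from the families `G a b`. -/
theorem card_mul_sq_le_of_blocked (V : Finset α) (r s : ℕ) [NeZero s]
    (hV : (s + 1) * (r + 1) ≤ #V) (H : Finset (Finset α)) (hH : H ⊆ V.powersetCard (r + 1))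
    (G : Fin s → Fin s → Finset (Finset α))
    (h : ∀ B ∈ H, ∀ π : Fin s → Fin s, π.Injective → ∀ T : Fin s → Finset α,
      (∀ a, T a ∈ (V \ B).powersetCard (r + 1)) → Pairwise (fun a b => Disjoint (T a) (T b)) →
        ∃ a, T a ∉ G a (π a))
    (D : ℝ) (hD : D = ∑ a, ∑ b, (#(V.powersetCard (r + 1) \ G a b) : ℝ))
    (hDN : D ≤ s * (#V).choose (r + 1)) :
    #H * (s - D / (#V).choose (r + 1)) ^ 2 * ((#V : ℝ) - (r + 1)) ^ 2 ≤
      (r + 1) ^ 2 * s ^ 2 * D := by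
  have hs : 1 ≤ s := Nat.one_le_iff_ne_zero.2 (NeZero.ne s)
  have hV2 : 2 * (r + 1) ≤ #V := (Nat.mul_le_mul_right _ (by omega)).trans hV
  have hVs : s * (r + 1) ≤ #V - (r + 1) := by
    rw [add_mul, one_mul] at hV
    omega
  have hN : (0 : ℝ) < (#V).choose (r + 1) := by
    exact_mod_cast Nat.choose_pos (by omega)
  set N : ℝ := (((#V).choose (r + 1) : ℕ) : ℝ) with hNdef
  set μ : ℝ := D / N with hμ
  have hμs : μ ≤ s := by rwa [hμ, div_le_iff₀ hN]
  set f : Finset α → ℝ := fun S => ∑ a, ∑ b, if S ∈ G a b then (0 : ℝ) else 1 with hf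
  have hf0 : ∀ S, 0 ≤ f S := fun S =>
    sum_nonneg fun a _ => sum_nonneg fun b _ => by split_ifs <;> norm_num
  have hfs : ∀ S, f S ≤ s ^ 2 := fun S =>
    calc f S ≤ ∑ _a : Fin s, ∑ _b : Fin s, (1 : ℝ) :=
          sum_le_sum fun a _ => sum_le_sum fun b _ => by split_ifs <;> norm_num
      _ = _ := by simp [sq]
  have hfD : ∑ S ∈ V.powersetCard (r + 1), f S = D := by
    rw [hf, hD, sum_comm]
    refine sum_congr rfl fun a _ => ?_
    rw [sum_comm]
    refine sum_congr rfl fun b _ => ?_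
    rw [sdiff_eq_filter, card_filter]
    push_cast
    exact sum_congr rfl fun S _ => by split_ifs <;> simp_all
  have hcardP : (#(V.powersetCard (r + 1)) : ℝ) = N := by rw [card_powersetCard]
  have hmean : ∑ S ∈ V.powersetCard (r + 1), (f S - μ) = 0 := by
    rw [sum_sub_distrib, hfD, sum_const, nsmul_eq_mul, hcardP, hμ, mul_div_cancel₀ _ hN.ne',
      sub_self]
  have hvar : ∑ S ∈ V.powersetCard (r + 1), (f S - μ) ^ 2 ≤ s ^ 2 * D := by
    calc ∑ S ∈ V.powersetCard (r + 1), (f S - μ) ^ 2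
        = ∑ S ∈ V.powersetCard (r + 1), f S ^ 2 - μ * D := by
          have : ∀ S, (f S - μ) ^ 2 = f S ^ 2 - 2 * μ * f S + μ ^ 2 := fun S => by ring
          simp only [this, sum_add_distrib, sum_sub_distrib, ← mul_sum, hfD, sum_const,
            nsmul_eq_mul, hcardP]
          have : N * μ = D := by rw [hμ, mul_div_cancel₀ _ hN.ne']
          linear_combination μ * this
      _ ≤ ∑ S ∈ V.powersetCard (r + 1), f S ^ 2 := by
          have : 0 ≤ D := hfD ▸ sum_nonneg fun S _ => hf0 S
          have : 0 ≤ μ * D := by positivity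
          linarith
      _ ≤ ∑ S ∈ V.powersetCard (r + 1), s ^ 2 * f S :=
          sum_le_sum fun S _ => by nlinarith [hf0 S, hfs S]
      _ = _ := by rw [← mul_sum, hfD]
  have hspec := sum_sq_sum_powersetCard_le V r (fun S => f S - μ) hmean (#V - 2 * (r + 1))
    (by omega)
  have e1 : r + 1 + (#V - 2 * (r + 1)) = #V - (r + 1) := by omega
  have e2 : (r + (#V - 2 * (r + 1))).choose (#V - 2 * (r + 1)) = (#V - r - 2).choose r := by
    rw [show #V - r - 2 = r + (#V - 2 * (r + 1)) by omega, ← Nat.choose_symm_add]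
  have e3 : (#V - r - 2).choose (#V - 2 * (r + 1)) = (#V - r - 2).choose r := by
    rw [← e2, show #V - r - 2 = r + (#V - 2 * (r + 1)) by omega]
  rw [e1, e2, e3] at hspec
  set K : ℝ := (((#V - r - 2).choose r : ℕ) : ℝ) with hK
  have hK0 : 0 < K := by
    rw [hK]
    exact_mod_cast Nat.choose_pos (by omega)
  set L : ℝ := (((#V - (r + 1)).choose (r + 1) : ℕ) : ℝ) with hL
  have hLK : L * (r + 1) = ((#V : ℝ) - (r + 1)) * K := by
    have := Nat.add_one_mul_choose_eq (#V - r - 2) r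
    rw [show #V - r - 2 + 1 = #V - (r + 1) by omega] at this
    have h2 : ((#V - (r + 1) : ℕ) : ℝ) = (#V : ℝ) - (r + 1) := by
      rw [Nat.cast_sub (by omega)]
      push_cast
      ring
    rw [← h2, hL, hK]
    exact_mod_cast this.symm
  have hlow : #H * (L * (s - μ)) ^ 2 ≤ ∑ S ∈ V.powersetCard (#V - (r + 1)),
      (∑ A ∈ S.powersetCard (r + 1), (f A - μ)) ^ 2 := by
    have hinj : Set.InjOn (fun B => V \ B) (H : Set (Finset α)) := by
      intro B hB C hC hBC
      have hB' := (mem_powersetCard.1 (hH hB)).1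
      have hC' := (mem_powersetCard.1 (hH hC)).1
      rw [← Finset.sdiff_sdiff_eq_self hB', ← Finset.sdiff_sdiff_eq_self hC']
      exact congrArg (V \ ·) hBC
    calc (#H : ℝ) * (L * (s - μ)) ^ 2 = ∑ _B ∈ H, (L * (s - μ)) ^ 2 := by simp
      _ ≤ ∑ B ∈ H, (∑ A ∈ (V \ B).powersetCard (r + 1), (f A - μ)) ^ 2 := by
          refine sum_le_sum fun B hB => ?_
          obtain ⟨hBV, hBc⟩ := mem_powersetCard.1 (hH hB)
          have hc : #(V \ B) = #V - (r + 1) := by rw [card_sdiff_of_subset hBV, hBc]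
          have := le_sum_card_sdiff_of_blocked (V \ B) (r + 1) s G (by omega) (by omega) (h B hB)
          rw [sum_sub_distrib, sum_const, card_powersetCard, nsmul_eq_mul]
          rw [hc] at this ⊢
          refine pow_le_pow_left₀ (mul_nonneg (Nat.cast_nonneg _) (by linarith)) ?_ 2
          linarith
      _ = ∑ S ∈ H.image (fun B => V \ B), (∑ A ∈ S.powersetCard (r + 1), (f A - μ)) ^ 2 := by
          rw [sum_image hinj]
      _ ≤ _ := by
          refine sum_le_sum_of_subset_of_nonneg ?_ fun _ _ _ => sq_nonneg _
          intro S hS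
          obtain ⟨B, hB, rfl⟩ := mem_image.1 hS
          obtain ⟨hBV, hBc⟩ := mem_powersetCard.1 (hH hB)
          exact mem_powersetCard.2 ⟨sdiff_subset, by rw [card_sdiff_of_subset hBV, hBc]⟩
  have hfin : #H * (L * (s - μ)) ^ 2 ≤ K ^ 2 * (s ^ 2 * D) :=
    (hlow.trans hspec).trans (by
      rw [← sq]
      exact mul_le_mul_of_nonneg_left hvar (sq_nonneg K))
  refine le_of_mul_le_mul_left (a := K ^ 2) ?_ (by positivity)
  calc K ^ 2 * (#H * (s - μ) ^ 2 * ((#V : ℝ) - (r + 1)) ^ 2)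
      = (r + 1) ^ 2 * (#H * (L * (s - μ)) ^ 2) := by
        linear_combination (-(#H : ℝ) * (s - μ) ^ 2) * (L * (r + 1) + ((#V : ℝ) - (r + 1)) * K) * hLK
    _ ≤ (r + 1) ^ 2 * (K ^ 2 * (s ^ 2 * D)) := by gcongr
    _ = _ := by ring

end Slice

theorem mem_link_iff {s j : ℕ} {F : Finset (Finset ℕ)} {L : Finset ℕ} (hj : j ∈ Icc 1 (s + 1)) :
    L ∈ link s F j ↔ insert j L ∈ F ∧ Disjoint L (Icc 1 (s + 1)) := by
  simp only [link, mem_image, mem_filter]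
  constructor
  · rintro ⟨A, ⟨hA, hAj⟩, rfl⟩
    have hjA : j ∈ A := by
      have : j ∈ A ∩ Icc 1 (s + 1) := by rw [hAj]; exact mem_singleton_self j
      exact (mem_inter.1 this).1
    refine ⟨by rwa [insert_erase hjA], disjoint_left.2 fun x hx hx' => ?_⟩
    have : x ∈ A ∩ Icc 1 (s + 1) := mem_inter.2 ⟨mem_of_mem_erase hx, hx'⟩
    rw [hAj, mem_singleton] at this
    exact ne_of_mem_erase hx this
  · rintro ⟨h, hd⟩
    refine ⟨insert j L, ⟨h, ?_⟩, erase_insert fun hL => disjoint_left.1 hd hL hj⟩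
    rw [insert_inter_of_mem hj, disjoint_iff_inter_eq_empty.1 hd, insert_empty_eq]

theorem link_subset_powersetCard {n r s j : ℕ} {F : Finset (Finset ℕ)}
    (hF : F ⊆ (Icc 1 n).powersetCard (r + 1)) (hj : j ∈ Icc 1 (s + 1)) :
    link s F j ⊆ (Icc (s + 2) n).powersetCard r := by
  intro L hL
  obtain ⟨h, hd⟩ := (mem_link_iff hj).1 hL
  obtain ⟨hs, hc⟩ := mem_powersetCard.1 (hF h)
  have hjL : j ∉ L := fun hL => disjoint_left.1 hd hL hj
  rw [card_insert_of_notMem hjL] at hc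
  refine mem_powersetCard.2 ⟨fun x hx => ?_, by omega⟩
  have h1 := mem_Icc.1 (hs (mem_insert_of_mem hx))
  have h2 := disjoint_left.1 hd hx
  simp only [mem_Icc] at h2 ⊢
  omega

theorem card_extremalFamily {n s : ℕ} (k : ℕ) (hs : s ≤ n) :
    #(extremalFamily n k s) = n.choose k - (n - s).choose k := by
  have h : extremalFamily n k s =
      (Icc 1 n).powersetCard k \ (Icc (s + 1) n).powersetCard k := by
    ext A
    simp only [extremalFamily, mem_filter, mem_sdiff, mem_powersetCard, Finset.Nonempty, mem_inter]
    constructor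
    · rintro ⟨h1, x, hx, hx'⟩
      refine ⟨h1, fun h2 => ?_⟩
      have := h2.1 hx
      rw [mem_Icc] at this hx'
      omega
    · rintro ⟨h1, h2⟩
      refine ⟨h1, ?_⟩
      by_contra! h3
      refine h2 ⟨fun x hx => ?_, h1.2⟩
      have h4 := h3 x hx
      have h5 := h1.1 hx
      rw [mem_Icc] at h4 h5 ⊢
      omega
  rw [h, card_sdiff_of_subset (powersetCard_mono (Icc_subset_Icc_left (by omega))),
    card_powersetCard, card_powersetCard, Nat.card_Icc, Nat.card_Icc]
  congr 2
  omega

theorem card_filter_subset_powersetCard_succ_le {n s r : ℕ} {L : Finset ℕ}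
    (hL : L ∈ (Icc (s + 2) n).powersetCard r) {X : Finset (Finset ℕ)}
    (hX : X ⊆ (Icc (s + 2) n).powersetCard (r + 1)) :
    #(X.filter (L ⊆ ·)) ≤ n - s - 1 - r := by
  obtain ⟨hLs, hLc⟩ := mem_powersetCard.1 hL
  refine (card_le_card (filter_subset_filter _ hX)).trans ?_
  rw [card_filter_powersetCard_subset L _ _ hLs (by omega), hLc, Nat.add_sub_cancel_left,
    Nat.choose_one_right, Nat.card_Icc]
  omega

/-- The members of a shifted family which avoid `[s]` are few in terms of its `(s + 1)`-link. -/
theorem mul_card_sdiff_extremalFamily_le {n r s : ℕ} {F : Finset (Finset ℕ)}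
    (hF : F ⊆ (Icc 1 n).powersetCard (r + 1)) (hshift : Shifted n F) (hn : s + 1 + r ≤ n) :
    (r + 1) * #(F \ extremalFamily n (r + 1) s) ≤ (n - s) * #(link s F (s + 1)) := by
  have hs1 : s + 1 ∈ Icc 1 (s + 1) := by simp
  set X := F \ extremalFamily n (r + 1) s with hX
  have hXs : ∀ A ∈ X, A ∈ F ∧ A ⊆ Icc (s + 1) n ∧ #A = r + 1 := by
    intro A hA
    obtain ⟨hAF, hA⟩ := mem_sdiff.1 hA
    obtain ⟨h1, h2⟩ := mem_powersetCard.1 (hF hAF)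
    refine ⟨hAF, fun x hx => ?_, h2⟩
    by_contra h3
    refine hA (mem_filter.2 ⟨hF hAF, x, mem_inter.2 ⟨hx, ?_⟩⟩)
    have := h1 hx
    simp only [mem_Icc] at h3 this ⊢
    omega
  have hX1 : #(X.filter (s + 1 ∈ ·)) ≤ #(link s F (s + 1)) := by
    refine card_le_card_of_injOn (fun A => A.erase (s + 1)) ?_ ?_
    · intro A hA
      obtain ⟨hA, hA1⟩ := mem_filter.1 (mem_coe.1 hA)
      obtain ⟨hAF, hAs, -⟩ := hXs A hA
      refine (mem_link_iff hs1).2 ⟨by rwa [insert_erase hA1], disjoint_left.2 fun x hx hx' => ?_⟩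
      have h1 := hAs (mem_of_mem_erase hx)
      have h2 := ne_of_mem_erase hx
      rw [mem_Icc] at h1 hx'
      omega
    · intro A hA B hB hAB
      have hA1 := (mem_filter.1 (mem_coe.1 hA)).2
      have hB1 := (mem_filter.1 (mem_coe.1 hB)).2
      rw [← insert_erase hA1, ← insert_erase hB1]
      exact congrArg (insert (s + 1)) hAB
  have hX2 : #(X.filter (s + 1 ∉ ·)) * (r + 1) ≤ #(link s F (s + 1)) * (n - s - 1 - r) := by
    have hX2s : X.filter (s + 1 ∉ ·) ⊆ (Icc (s + 2) n).powersetCard (r + 1) := by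
      intro A hA
      obtain ⟨hA, hA1⟩ := mem_filter.1 hA
      obtain ⟨hAF, hAs, hc⟩ := hXs A hA
      refine mem_powersetCard.2 ⟨fun x hx => ?_, hc⟩
      have h1 := hAs hx
      have h2 : x ≠ s + 1 := fun h => hA1 (h ▸ hx)
      rw [mem_Icc] at h1 ⊢
      omega
    refine card_mul_le_card_mul (fun A L => L ⊆ A) ?_ ?_
    · intro A hA
      obtain ⟨hAs, hc⟩ := mem_powersetCard.1 (hX2s hA)
      obtain ⟨hA, hA1⟩ := mem_filter.1 hA
      obtain ⟨hAF, -, -⟩ := hXs A hA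
      rw [← hc]
      refine card_le_card_of_injOn (fun b => A.erase b) ?_ ?_
      · intro b hb
        have hb' := mem_Icc.1 (hAs hb)
        refine mem_coe.2 (mem_bipartiteAbove _ |>.2 ⟨(mem_link_iff hs1).2 ⟨?_, ?_⟩,
          erase_subset _ _⟩)
        · exact hshift (s + 1) b (by omega) (by omega) hb'.2 A hAF hb hA1
        · refine disjoint_left.2 fun x hx hx' => ?_
          have h1 := hAs (mem_of_mem_erase hx)
          rw [mem_Icc] at h1 hx'
          omega
      · intro b hb c hc hbc
        by_contra hne
        exact (notMem_erase b A) ((show A.erase b = A.erase c from hbc) ▸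
          mem_erase.2 ⟨hne, hb⟩)
    · intro L hL
      exact card_filter_subset_powersetCard_succ_le (link_subset_powersetCard hF hs1 hL) hX2s
  have hsplit := card_filter_add_card_filter_not (s := X) (s + 1 ∈ ·)
  have h3 : n - s = (r + 1) + (n - s - 1 - r) := by omega
  rw [← hsplit, h3]
  nlinarith

theorem sum_card_sdiff_link_le {n r s : ℕ} (F : Finset (Finset ℕ)) (hn : s + 1 ≤ n) :
    ∑ b : Fin s, #((Icc (s + 2) n).powersetCard r \ link s F (b + 1)) ≤
      #(extremalFamily n (r + 1) s \ F) := by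
  have hmem : ∀ b : Fin s, (b : ℕ) + 1 ∈ Icc 1 (s + 1) := fun b => mem_Icc.2 (by omega)
  rw [← card_sigma]
  have hprop : ∀ p ∈ (univ.sigma fun b : Fin s =>
      (Icc (s + 2) n).powersetCard r \ link s F (b + 1)),
      p.2 ⊆ Icc (s + 2) n ∧ #p.2 = r ∧ insert ((p.1 : ℕ) + 1) p.2 ∉ F ∧
        Disjoint p.2 (Icc 1 (s + 1)) := by
    rintro ⟨b, L⟩ h
    obtain ⟨hL, hl⟩ := mem_sdiff.1 (mem_sigma.1 h).2
    obtain ⟨hL, hc⟩ := mem_powersetCard.1 hL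
    have hd : Disjoint L (Icc 1 (s + 1)) := disjoint_left.2 fun x hx hx' => by
      have := hL hx
      rw [mem_Icc] at this hx'
      omega
    exact ⟨hL, hc, fun h => hl ((mem_link_iff (hmem b)).2 ⟨h, hd⟩), hd⟩
  refine card_le_card_of_injOn (fun p => insert ((p.1 : ℕ) + 1) p.2) ?_ ?_
  · intro p hp
    obtain ⟨hL, hc, hF, hd⟩ := hprop p hp
    have hb : (p.1 : ℕ) + 1 ∉ p.2 := fun h => disjoint_left.1 hd h (hmem p.1)
    refine mem_coe.2 (mem_sdiff.2 ⟨mem_filter.2 ⟨mem_powersetCard.2 ⟨?_, ?_⟩, (p.1 : ℕ) + 1,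
      mem_inter.2 ⟨mem_insert_self _ _, mem_Icc.2 (by omega)⟩⟩, hF⟩)
    · refine insert_subset (mem_Icc.2 (by omega)) (hL.trans (Icc_subset_Icc_left (by omega)))
    · rw [card_insert_of_notMem hb, hc]
  · rintro ⟨b, L⟩ hp ⟨c, M⟩ hq heq
    obtain ⟨-, -, -, hd⟩ := hprop _ hp
    obtain ⟨-, -, -, hd'⟩ := hprop _ hq
    simp only at hd hd' heq
    have hbL : (b : ℕ) + 1 ∉ L := fun h => disjoint_left.1 hd h (hmem b)
    have hcM : (c : ℕ) + 1 ∉ M := fun h => disjoint_left.1 hd' h (hmem c)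
    have h1 : (b : ℕ) + 1 ∈ insert ((c : ℕ) + 1) M := heq ▸ mem_insert_self _ _
    have hbc : b = c := by
      rcases mem_insert.1 h1 with h | h
      · exact Fin.ext (by omega)
      · exact absurd (hmem b) (disjoint_left.1 hd' h)
    subst hbc
    have : L = M := by rw [← erase_insert hbL, heq, erase_insert hcM]
    rw [this]

theorem mul_sum_card_sdiff_link_le {n r s : ℕ} {F : Finset (Finset ℕ)}
    (hF : F ⊆ (Icc 1 n).powersetCard (r + 1)) (hshift : Shifted n F) (hn : s + 1 + r ≤ n)
    (hcard : #(extremalFamily n (r + 1) s) ≤ #F) :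
    (r + 1) * ∑ b : Fin s, #((Icc (s + 2) n).powersetCard r \ link s F (b + 1)) ≤
      (n - s) * #(link s F (s + 1)) := by
  refine le_trans ?_ (mul_card_sdiff_extremalFamily_le hF hshift hn)
  refine Nat.mul_le_mul_left _ ((sum_card_sdiff_link_le F (by omega)).trans ?_)
  have h1 := card_sdiff_add_card_inter (extremalFamily n (r + 1) s) F
  have h2 := card_sdiff_add_card_inter F (extremalFamily n (r + 1) s)
  rw [inter_comm] at h2
  omega

theorem le_ceil_and_ceil_sub_le (k s n : ℕ) (hk : 1 ≤ k) (hs : 1 ≤ s)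
    (hn : n = ⌈(3 : ℝ) * Real.exp 1 * (s + 1) * k⌉₊) :
    8 * (s + 1) * k ≤ n ∧ (n : ℝ) - s ≤ 8.16 * (s + 1) * k := by
  have he1 := Real.exp_one_gt_d9
  have he2 := Real.exp_one_lt_d9
  have hs' : (1 : ℝ) ≤ s := by exact_mod_cast hs
  have hsk : (0 : ℝ) < ((s : ℝ) + 1) * k := by positivity
  constructor
  · have h1 := Nat.le_ceil ((3 : ℝ) * Real.exp 1 * (s + 1) * k)
    rw [← hn] at h1
    have h2 : ((8 * (s + 1) * k : ℕ) : ℝ) ≤ n := by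
      push_cast
      nlinarith
    exact_mod_cast h2
  · have h1 := Nat.ceil_lt_add_one (a := (3 : ℝ) * Real.exp 1 * (s + 1) * k) (by positivity)
    rw [← hn] at h1
    nlinarith

theorem mul_le_pow_four_and_mul_pow_three_lt {x : ℝ} (hx : 50 ≤ x) :
    8.16 * x * (x + 1) ≤ x ^ 4 ∧ 8.16 * x ^ 3 < 49 * ((x - 1) ^ 2 * (x + 1)) := by
  have h2 : 0 < x ^ 2 := by positivity
  constructor
  · have h3 : 2500 * x ^ 2 ≤ x ^ 2 * x ^ 2 := mul_le_mul_of_nonneg_right (by nlinarith) h2.le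
    nlinarith
  · have h3 : 0.5 * x ^ 2 ≤ (x - 1) ^ 2 := by nlinarith
    have h4 : 0.5 * x ^ 2 * (x + 1) ≤ (x - 1) ^ 2 * (x + 1) :=
      mul_le_mul_of_nonneg_right h3 (by linarith)
    nlinarith [mul_pos h2 (by linarith : 0 < x)]

theorem exists_notMem_link_of_cross_dependent {s r i₀ : ℕ} [NeZero s] {V : Finset ℕ}
    {F : ℕ → Finset (Finset ℕ)}
    (hcross : ¬ ∃ g : ℕ → Finset ℕ, (∀ i ∈ Finset.Icc 1 (s + 1), g i ∈ F i) ∧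
      ∀ i ∈ Finset.Icc 1 (s + 1), ∀ j ∈ Finset.Icc 1 (s + 1), i ≠ j →
        Disjoint (g i) (g j))
    (φ : Fin s → ℕ) (hφ : φ.Injective)
    (hφsurj : ∀ i ∈ (Icc 1 (s + 1)).erase i₀, ∃ a, φ a = i)
    {B : Finset ℕ} (hB : B ∈ link s (F i₀) (s + 1)) (π : Fin s → Fin s) (hπ : π.Injective)
    (T : Fin s → Finset ℕ) (hT : ∀ a, T a ∈ (V \ B).powersetCard r)
    (hTd : Pairwise (fun a b => Disjoint (T a) (T b))) :
    ∃ a, T a ∉ link s (F (φ a)) (π a + 1) := by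
  have hs1 : s + 1 ∈ Icc 1 (s + 1) := by simp
  by_contra! hTG
  obtain ⟨hB1, hB2⟩ := (mem_link_iff hs1).1 hB
  have hmem : ∀ b : Fin s, (b : ℕ) + 1 ∈ Icc 1 (s + 1) := fun b => mem_Icc.2 (by omega)
  have hTG' := fun a => (mem_link_iff (hmem (π a))).1 (hTG a)
  have hTB : ∀ a, Disjoint (T a) B := fun a =>
    (subset_sdiff.1 (mem_powersetCard.1 (hT a)).1).2
  have hdis : ∀ {p q : ℕ} {L M : Finset ℕ}, p ∈ Icc 1 (s + 1) → q ∈ Icc 1 (s + 1) → p ≠ q →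
      Disjoint L M → Disjoint L (Icc 1 (s + 1)) → Disjoint M (Icc 1 (s + 1)) →
        Disjoint (insert p L) (insert q M) := by
    intro p q L M hp hq hpq hLM hL hM
    rw [disjoint_insert_left, disjoint_insert_right, mem_insert, not_or]
    exact ⟨⟨hpq, fun h => disjoint_left.1 hM h hp⟩, fun h => disjoint_left.1 hL h hq, hLM⟩
  set ψ := Function.invFun φ with hψ
  have hψφ : ∀ a, ψ (φ a) = a := Function.leftInverse_invFun hφ
  refine hcross ⟨fun i => if i = i₀ then insert (s + 1) B else
    insert ((π (ψ i) : ℕ) + 1) (T (ψ i)), fun i hi => ?_, fun i hi j hj hij => ?_⟩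
  · by_cases h : i = i₀
    · simpa [h] using hB1
    · obtain ⟨a, rfl⟩ := hφsurj i (mem_erase.2 ⟨h, hi⟩)
      simpa [h, hψφ] using (hTG' a).1
  · have hlt : ∀ a, s + 1 ≠ (π a : ℕ) + 1 := fun a => by omega
    by_cases h : i = i₀
    · have h' : j ≠ i₀ := fun h' => hij (h.trans h'.symm)
      simp only [h, h', if_true, if_false]
      exact hdis hs1 (hmem _) (hlt _) (hTB _).symm hB2 (hTG' _).2
    · by_cases h' : j = i₀
      · simp only [h, h', if_true, if_false]
        exact hdis (hmem _) hs1 (hlt _).symm (hTB _) (hTG' _).2 hB2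
      · simp only [h, h', if_false]
        obtain ⟨a, rfl⟩ := hφsurj i (mem_erase.2 ⟨h, hi⟩)
        obtain ⟨b, rfl⟩ := hφsurj j (mem_erase.2 ⟨h', hj⟩)
        have hab : a ≠ b := fun hab => hij (by rw [hab])
        rw [hψφ, hψφ]
        refine hdis (hmem _) (hmem _) (fun h => hab (hπ (Fin.ext (by omega)))) (hTd hab)
          (hTG' _).2 (hTG' _).2

/-- Lemma (families all close to `𝒜`): for `n = ⌈3e(s+1)k⌉`, shifted cross-dependent
families with all links `F_i({s+1})` of size `< s⁻⁴ C(n−s−1,k−1)`, not all equal to `𝒜`,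
satisfy `min_i |F_i| < C(n,k) − C(n−s,k)`. -/
theorem close_to_extremal (k s n : ℕ) (hk : 1 ≤ k) (hs : 50 ≤ s)
    (hn : n = ⌈(3 : ℝ) * Real.exp 1 * (s + 1) * k⌉₊)
    (F : ℕ → Finset (Finset ℕ))
    (hF : ∀ i ∈ Finset.Icc 1 (s + 1), F i ⊆ (Finset.Icc 1 n).powersetCard k)
    (hshift : ∀ i ∈ Finset.Icc 1 (s + 1), Shifted n (F i))
    (hcross : ¬ ∃ g : ℕ → Finset ℕ, (∀ i ∈ Finset.Icc 1 (s + 1), g i ∈ F i) ∧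
      ∀ i ∈ Finset.Icc 1 (s + 1), ∀ j ∈ Finset.Icc 1 (s + 1), i ≠ j →
        Disjoint (g i) (g j))
    (hsmall : ∀ i ∈ Finset.Icc 1 (s + 1),
      ((link s (F i) (s + 1)).card : ℝ) < ((s : ℝ) ^ 4)⁻¹ * (n - s - 1).choose (k - 1))
    (hne : ∃ j ∈ Finset.Icc 1 (s + 1), F j ≠ extremalFamily n k s) :
    ∃ i ∈ Finset.Icc 1 (s + 1), (F i).card < n.choose k - (n - s).choose k := by
  by_contra! hcon
  obtain ⟨r, rfl⟩ : ∃ r, k = r + 1 := ⟨k - 1, by omega⟩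
  have : NeZero s := ⟨by omega⟩
  obtain ⟨hlo, hhi⟩ := le_ceil_and_ceil_sub_le (r + 1) s n hk (by omega) hn
  have hn1 : s + 1 + (r + 1) ≤ n := by nlinarith
  have hA := card_extremalFamily (r + 1) (show s ≤ n by omega)
  have hcard : ∀ i ∈ Icc 1 (s + 1), #(extremalFamily n (r + 1) s) ≤ #(F i) := fun i hi => by
    rw [hA]
    exact hcon i hi
  obtain ⟨i₀, hi₀, hmax⟩ := exists_max_image (Icc 1 (s + 1))
    (fun i => #(link s (F i) (s + 1))) ⟨1, by simp⟩
  set H := link s (F i₀) (s + 1) with hH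
  have hHpos : 0 < #H := by
    by_contra! h0
    obtain ⟨j, hj, hjne⟩ := hne
    have h1 := mul_card_sdiff_extremalFamily_le (r := r) (s := s) (hF j hj) (hshift j hj) (by omega)
    have h2 : #(link s (F j) (s + 1)) = 0 := by
      have := hmax j hj
      omega
    rw [h2, mul_zero, Nat.le_zero, mul_eq_zero, card_eq_zero, sdiff_eq_empty_iff_subset] at h1
    exact hjne (eq_of_subset_of_card_le (h1.resolve_left (by omega)) (hcard j hj))
  have hsm := hsmall i₀ hi₀
  rw [← hH, Nat.add_sub_cancel] at hsm
  have hHpos' : (1 : ℝ) ≤ #H := by exact_mod_cast hHpos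
  have hs' : (50 : ℝ) ≤ s := by exact_mod_cast hs
  rcases r with - | r
  · have : ((s : ℝ) ^ 4)⁻¹ ≤ 1 := inv_le_one_of_one_le₀ (one_le_pow₀ (by linarith))
    simp only [Nat.choose_zero_right, Nat.cast_one, mul_one] at hsm
    linarith
  set V := Icc (s + 2) n with hV
  have hVc : #V = n - s - 1 := by
    rw [hV, Nat.card_Icc]
    omega
  have hIc : #((Icc 1 (s + 1)).erase i₀) = s := by
    rw [card_erase_of_mem hi₀, Nat.card_Icc]
    omega
  set φ := ((Icc 1 (s + 1)).erase i₀).orderEmbOfFin hIc with hφ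
  have hφmem : ∀ a, φ a ∈ (Icc 1 (s + 1)).erase i₀ := fun a => orderEmbOfFin_mem _ hIc a
  have hφsurj : ∀ i ∈ (Icc 1 (s + 1)).erase i₀, ∃ a, φ a = i := fun i hi => by
    have : i ∈ Set.range φ := by
      rw [hφ, range_orderEmbOfFin]
      exact hi
    exact this
  set G : Fin s → Fin s → Finset (Finset ℕ) := fun a b => link s (F (φ a)) (b + 1) with hG
  have hs1 : s + 1 ∈ Icc 1 (s + 1) := by simp
  have hD : ((r : ℝ) + 2) * ∑ a, ∑ b, (#(V.powersetCard (r + 1) \ G a b) : ℝ) ≤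
      s * (((n : ℝ) - s) * #H) := by
    rw [mul_sum]
    calc _ ≤ ∑ _a : Fin s, ((n : ℝ) - s) * #H := by
          refine sum_le_sum fun a _ => ?_
          have hφa := (mem_erase.1 (hφmem a)).2
          have h1 := (mul_sum_card_sdiff_link_le (hF _ hφa) (hshift _ hφa) (by omega)
            (hcard _ hφa)).trans (Nat.mul_le_mul_left _ (hmax _ hφa))
          rw [← Nat.cast_sub (by omega : s ≤ n)]
          exact_mod_cast h1
      _ = _ := by simp
  set D : ℝ := ∑ a, ∑ b, (#(V.powersetCard (r + 1) \ G a b) : ℝ) with hDdef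
  have hr0 : (0 : ℝ) ≤ r := r.cast_nonneg
  push_cast at hhi
  have hD2 : D ≤ 8.16 * s * (s + 1) * #H := by
    have h1 : ((n : ℝ) - s) * #H ≤ 8.16 * (s + 1) * (r + 1 + 1) * #H :=
      mul_le_mul_of_nonneg_right hhi (by linarith)
    have h2 : s * (((n : ℝ) - s) * #H) ≤ s * (8.16 * (s + 1) * (r + 1 + 1) * #H) :=
      mul_le_mul_of_nonneg_left h1 (by linarith)
    refine le_of_mul_le_mul_left (a := (r : ℝ) + 2) ?_ (by linarith)
    linarith
  have hN : (0 : ℝ) < (#V).choose (r + 1) := by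
    exact_mod_cast Nat.choose_pos (by omega)
  rw [← hVc] at hsm
  have hD3 : D ≤ (#V).choose (r + 1) := by
    have h1 : (#H : ℝ) * s ^ 4 ≤ (#V).choose (r + 1) := by
      rw [inv_mul_eq_div, lt_div_iff₀ (by positivity)] at hsm
      exact hsm.le
    calc D ≤ 8.16 * s * (s + 1) * #H := hD2
      _ ≤ s ^ 4 * #H := mul_le_mul_of_nonneg_right (mul_le_pow_four_and_mul_pow_three_lt hs').1 (by linarith)
      _ ≤ _ := by rwa [mul_comm]
  have hVs : (s + 1) * (r + 1) ≤ #V := by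
    rw [hVc]
    have : (s + 1) * (r + 1) + (s + 1) ≤ n := by nlinarith
    omega
  have key := card_mul_sq_le_of_blocked V r s hVs H
    (link_subset_powersetCard (hF i₀ hi₀) hs1) G
    (fun B hB π hπ T hT hTd => exists_notMem_link_of_cross_dependent hcross φ φ.injective hφsurj
      hB π hπ T hT hTd) D hDdef
    (hD3.trans (le_mul_of_one_le_left hN.le (by linarith)))
  have hμ : D / (#V).choose (r + 1) ≤ 1 := (div_le_one hN).2 hD3
  have hVr : 7 * ((s : ℝ) + 1) * (r + 1) ≤ (#V : ℝ) - (r + 1) := by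
    have h1 : 7 * (s + 1) * (r + 1) + (r + 1) ≤ #V := by
      rw [hVc]
      have : 7 * (s + 1) * (r + 1) + (r + 1) + (s + 1) ≤ n := by nlinarith
      omega
    have h2 : ((7 * (s + 1) * (r + 1) + (r + 1) : ℕ) : ℝ) ≤ #V := by exact_mod_cast h1
    push_cast at h2
    linarith
  have h1 : (#H : ℝ) * (s - 1) ^ 2 * (7 * ((s : ℝ) + 1) * (r + 1)) ^ 2 ≤
      (r + 1) ^ 2 * s ^ 2 * (8.16 * s * (s + 1) * #H) := by
    refine le_trans ?_ (key.trans (mul_le_mul_of_nonneg_left hD2 (by positivity)))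
    have h3 : (0 : ℝ) ≤ s - 1 := by linarith
    gcongr
  have h2 : (#H * (r + 1) ^ 2 * (s + 1) : ℝ) * (49 * ((s - 1) ^ 2 * (s + 1))) ≤
      (#H * (r + 1) ^ 2 * (s + 1)) * (8.16 * s ^ 3) := by linarith
  have h3 := le_of_mul_le_mul_left h2 (by positivity)
  linarith [(mul_le_pow_four_and_mul_pow_three_lt hs').2]
end

section
/- Let k ≥ 1 and s ≥ 50 be integers and set n = ⌈3e(s+1)k⌉ (where e is Euler's number). Let F_1, …, F_{s+1} be shifted, cross-dependent families of k-element subsets of [n] with |F_i| ≥ C(n,k) − C(n−s,k) for every i ∈ [s+1]. Then there exists a set U ⊆ [s+1] of indices with |U| ≥ ⌈2(s+1)/3⌉ such that for each i ∈ U one has |F_i(∅)| ≤ (3s+2)·|F_i({s+1})|. -/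
open Finset

/-- `F(∅) = {A ∈ F : A ∩ [s+1] = ∅}`. -/
def emptyPart (s : ℕ) (F : Finset (Finset ℕ)) : Finset (Finset ℕ) :=
  F.filter fun A => A ∩ Finset.Icc 1 (s + 1) = ∅

open scoped FinsetFamily

/-- Double counting of the pairs `(A, A \ {x})`: a form of the local LYM inequality. -/
lemma card_mul_le_card_shadow_mul {n k : ℕ} {F : Finset (Finset ℕ)}
    (hF : F ⊆ (Icc 1 n).powersetCard k) : #F * k ≤ #(∂ F) * (n + 1 - k) := by
  refine card_mul_le_card_mul' (fun B A => B ⊆ A) (fun A hA => ?_) (fun B hB => ?_)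
  · rw [← (mem_powersetCard.1 (hF hA)).2, ← card_image_of_injOn (s := A) (f := A.erase)]
    · refine card_le_card fun B hB => ?_
      obtain ⟨x, hx, rfl⟩ := mem_image.1 hB
      exact (mem_bipartiteBelow _).2 ⟨erase_mem_shadow hA hx, erase_subset _ _⟩
    · exact A.erase_injOn
  · obtain ⟨A₀, hA₀, x, hx, rfl⟩ := mem_shadow_iff.1 hB
    obtain ⟨hs₀, hc₀⟩ := mem_powersetCard.1 (hF hA₀)
    have hc : #(A₀.erase x) + 1 = k := by rw [card_erase_add_one hx, hc₀]
    have hcard : #(Icc 1 n \ A₀.erase x) = n + 1 - k := by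
      rw [card_sdiff_of_subset ((erase_subset _ _).trans hs₀), Nat.card_Icc]
      omega
    rw [← hcard]
    refine le_trans (card_le_card fun A hA => ?_)
      (card_image_le (s := Icc 1 n \ A₀.erase x) (f := fun y => insert y (A₀.erase x)))
    obtain ⟨hA, hsub⟩ := (mem_bipartiteAbove _).1 hA
    obtain ⟨hs, hk⟩ := mem_powersetCard.1 (hF hA)
    obtain ⟨y, hy⟩ : ∃ y, A \ A₀.erase x = {y} := by
      rw [← card_eq_one, card_sdiff_of_subset hsub]
      omega
    have hyA : y ∈ A \ A₀.erase x := by simp [hy]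
    refine mem_image.2 ⟨y, ?_, ?_⟩
    · exact sdiff_subset_sdiff hs le_rfl hyA
    · rw [insert_eq, ← hy, sdiff_union_of_subset hsub]

/-- A family all of whose members `A` satisfy `|A ∩ [j(t+1) - 1]| ≥ j` for some `1 ≤ j ≤ k`
is at most `t` times as large as its shadow. -/
lemma card_le_mul_card_shadow (t : ℕ) : ∀ (n k : ℕ) (F : Finset (Finset ℕ)),
    F ⊆ (Icc 1 n).powersetCard k →
    (∀ A ∈ F, ∃ j, 1 ≤ j ∧ j ≤ k ∧ j ≤ #{a ∈ A | a < j * (t + 1)}) → #F ≤ t * #(∂ F) := by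
  intro n
  induction n with
  | zero =>
    intro k F hF h
    rcases F.eq_empty_or_nonempty with rfl | ⟨A, hA⟩
    · simp
    · obtain ⟨j, h1, -, h3⟩ := h A hA
      have hA' := (mem_powersetCard.1 (hF hA)).1
      have : A = ∅ := by simpa using hA'
      subst this
      simp at h3
      omega
  | succ n ih =>
    intro k F hF h
    rcases lt_or_ge (n + 1) (k * (t + 1)) with hlt | hge
    · have hk : 0 < k := by
        rcases Nat.eq_zero_or_pos k with rfl | hk
        · simp at hlt
        · exact hk
      have h1 := card_mul_le_card_shadow_mul hF
      have h2 : n + 1 + 1 - k ≤ k * t := by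
        rw [mul_add] at hlt
        omega
      refine Nat.le_of_mul_le_mul_right (h1.trans ((Nat.mul_le_mul_left _ h2).trans_eq ?_)) hk
      ring
    · rw [← card_memberSubfamily_add_card_nonMemberSubfamily (n + 1) F,
        ← card_memberSubfamily_add_card_nonMemberSubfamily (n + 1) (∂ F), mul_add]
      have hIcc : ∀ A ⊆ Icc 1 (n + 1), n + 1 ∉ A → A ⊆ Icc 1 n := by
        intro A hA hn x hx
        have h1 := mem_Icc.1 (hA hx)
        have h2 : x ≠ n + 1 := fun h => hn (h ▸ hx)
        exact mem_Icc.2 (by omega)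
      refine add_le_add ?_ ?_
      · refine (ih (k - 1) _ ?_ ?_).trans (Nat.mul_le_mul_left _ (card_le_card ?_))
        · intro A hA
          obtain ⟨hA, hn⟩ := mem_memberSubfamily.1 hA
          obtain ⟨hs, hc⟩ := mem_powersetCard.1 (hF hA)
          rw [card_insert_of_notMem hn] at hc
          exact mem_powersetCard.2
            ⟨hIcc A ((subset_insert _ _).trans hs) hn, by omega⟩
        · intro A hA
          obtain ⟨hA, hn⟩ := mem_memberSubfamily.1 hA
          obtain ⟨hs, hc⟩ := mem_powersetCard.1 (hF hA)
          rw [card_insert_of_notMem hn] at hc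
          obtain ⟨j, h1, h2, h3⟩ := h _ hA
          have hj : j * (t + 1) ≤ n + 1 := (Nat.mul_le_mul_right _ h2).trans hge
          rw [filter_insert, if_neg (by omega)] at h3
          have h4 := h3.trans (card_filter_le _ _)
          exact ⟨j, h1, by omega, h3⟩
        · intro B hB
          obtain ⟨A, hA, x, hx, rfl⟩ := mem_shadow_iff.1 hB
          obtain ⟨hA, hn⟩ := mem_memberSubfamily.1 hA
          refine mem_memberSubfamily.2 ⟨?_, fun h => hn (mem_of_mem_erase h)⟩
          have hne : x ≠ n + 1 := fun h => hn (h ▸ hx)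
          rw [← erase_insert_of_ne hne.symm]
          exact erase_mem_shadow hA (mem_insert_of_mem hx)
      · refine (ih k _ ?_ ?_).trans (Nat.mul_le_mul_left _ (card_le_card ?_))
        · intro A hA
          obtain ⟨hA, hn⟩ := mem_nonMemberSubfamily.1 hA
          obtain ⟨hs, hc⟩ := mem_powersetCard.1 (hF hA)
          exact mem_powersetCard.2 ⟨hIcc A hs hn, hc⟩
        · exact fun A hA => h A (mem_nonMemberSubfamily.1 hA).1
        · intro B hB
          obtain ⟨A, hA, x, hx, rfl⟩ := mem_shadow_iff.1 hB
          obtain ⟨hA, hn⟩ := mem_nonMemberSubfamily.1 hA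
          exact mem_nonMemberSubfamily.2
            ⟨erase_mem_shadow hA hx, fun h => hn (mem_of_mem_erase h)⟩

/-- A shifted family is closed under passing to a componentwise smaller set. -/
lemma Shifted.mem_of_dominated {n : ℕ} {F : Finset (Finset ℕ)} (hF : Shifted n F)
    {A B : Finset ℕ} (hA : A ∈ F) (hAn : A ⊆ Icc 1 n) (hBn : B ⊆ Icc 1 n) (hcard : #A = #B)
    (hdom : ∀ x, #{b ∈ B | x ≤ b} ≤ #{a ∈ A | x ≤ a}) : B ∈ F := by
  induction hm : #(B \ A) using Nat.strong_induction_on generalizing A with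
  | _ m ih =>
  rcases (B \ A).eq_empty_or_nonempty with he | hne
  · rwa [eq_of_subset_of_card_le (sdiff_eq_empty_iff_subset.1 he) hcard.le]
  · obtain ⟨hxB, hxA⟩ := mem_sdiff.1 ((B \ A).max'_mem hne)
    set x := (B \ A).max' hne
    have hmax : ∀ b ∈ B, x < b → b ∈ A := by
      intro b hb hlt
      by_contra hbA
      exact absurd ((B \ A).le_max' b (mem_sdiff.2 ⟨hb, hbA⟩)) (by omega)
    obtain ⟨y, hyA, hyB, hxy⟩ : ∃ y ∈ A, y ∉ B ∧ x < y := by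
      by_contra! hcon
      have hlt : #{a ∈ A | x ≤ a} < #{b ∈ B | x ≤ b} := by
        refine card_lt_card (ssubset_iff.2 ⟨x, by simp [hxA], fun a ha => ?_⟩)
        rcases mem_insert.1 ha with rfl | ha
        · exact mem_filter.2 ⟨hxB, le_rfl⟩
        · obtain ⟨haA, hle⟩ := mem_filter.1 ha
          refine mem_filter.2 ⟨?_, hle⟩
          by_contra haB
          have := hcon a haA haB
          have : a = x := by omega
          exact hxA (this ▸ haA)
      exact absurd (hdom x) (by omega)
    have hx1 := mem_Icc.1 (hBn hxB)
    have hyn := mem_Icc.1 (hAn hyA)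
    have hxe : x ∉ A.erase y := fun h => hxA (mem_of_mem_erase h)
    refine ih _ ?_ (hF x y hx1.1 hxy hyn.2 A hA hyA hxA) ?_ ?_ ?_ rfl
    · rw [← hm]
      refine card_lt_card (ssubset_iff.2 ⟨x, by simp, fun b hb => ?_⟩)
      rcases mem_insert.1 hb with rfl | hb
      · exact mem_sdiff.2 ⟨hxB, hxA⟩
      · obtain ⟨hbB, hbA⟩ := mem_sdiff.1 hb
        refine mem_sdiff.2 ⟨hbB, fun h => hbA (mem_insert_of_mem (mem_erase.2 ⟨?_, h⟩))⟩
        exact fun h => hyB (h ▸ hbB)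
    · exact insert_subset (hBn hxB) ((erase_subset _ _).trans hAn)
    · rw [card_insert_of_notMem hxe, card_erase_add_one hyA, hcard]
    · intro z
      rcases le_or_gt z x with hzx | hzx
      · rw [filter_insert, if_pos hzx, filter_erase,
          card_insert_of_notMem (by simp [hxA]), card_erase_add_one (by simp [hyA]; omega)]
        exact hdom z
      · rw [filter_insert, if_neg (by omega), filter_erase]
        refine card_le_card fun b hb => ?_
        obtain ⟨hbB, hzb⟩ := mem_filter.1 hb
        exact mem_erase.2 ⟨fun h => hyB (h ▸ hbB),
          mem_filter.2 ⟨hmax b hbB (by omega), hzb⟩⟩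

/-- If a shifted family has a member whose `j`-th element is at least `jt` for all `j`, it
contains every `k`-set whose `j`-th element is at most `jt`. -/
lemma Shifted.mem_image_of_le {n k t : ℕ} {F : Finset (Finset ℕ)} (hF : Shifted n F)
    {A : Finset ℕ} (hA : A ∈ F) (hAn : A ∈ (Icc 1 n).powersetCard k)
    (hAt : ∀ j, 1 ≤ j → j ≤ k → #{a ∈ A | a < j * t} < j)
    (b : Fin k → ℕ) (hb : Function.Injective b) (hbn : ∀ j, b j ∈ Icc 1 n)
    (hbt : ∀ j, b j ≤ (j + 1) * t) : univ.image b ∈ F := by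
  obtain ⟨hs, hc⟩ := mem_powersetCard.1 hAn
  have hcB : #(univ.image b) = k := by rw [card_image_of_injective _ hb, card_fin]
  refine hF.mem_of_dominated hA hs (fun x hx => ?_) (hc.trans hcB.symm) fun x => ?_
  · obtain ⟨j, -, rfl⟩ := mem_image.1 hx
    exact hbn j
  · have h1 := card_filter_add_card_filter_not (s := A) (fun a => a < x)
    have h2 := card_filter_add_card_filter_not (s := univ.image b) (fun a => a < x)
    simp only [not_lt] at h1 h2
    suffices #{a ∈ A | a < x} ≤ #{a ∈ univ.image b | a < x} by omega
    set q := #{a ∈ A | a < x}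
    rcases Nat.eq_zero_or_pos q with h0 | hpos
    · omega
    have hqk : q ≤ k := hc ▸ card_filter_le _ _
    have hqx : q * t < x := by
      by_contra! hle
      refine absurd (hAt q hpos hqk) (not_lt.2 (card_le_card fun a ha => ?_))
      obtain ⟨haA, hax⟩ := mem_filter.1 ha
      exact mem_filter.2 ⟨haA, by omega⟩
    calc q = #((univ : Finset (Fin q)).image fun j => b (Fin.castLE hqk j)) := by
          rw [card_image_of_injective univ
            (show Function.Injective fun j => b (Fin.castLE hqk j) from
              hb.comp (Fin.castLE_injective hqk)), card_fin]
      _ ≤ _ := by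
          refine card_le_card fun y hy => ?_
          obtain ⟨j, -, rfl⟩ := mem_image.1 hy
          refine mem_filter.2 ⟨mem_image_of_mem _ (mem_univ _), ?_⟩
          refine lt_of_le_of_lt (hbt _) (lt_of_le_of_lt (Nat.mul_le_mul_right _ ?_) hqx)
          simp

/-- Jobs with deadlines `t i, 2 (t i), …, k (t i)` can be scheduled at distinct times, if for
every `x` at most `x` of them are due by time `x`. -/
lemma exists_injective_le_mul {ι : Type*} [Fintype ι] (k : ℕ) (t : ι → ℕ) (ht : ∀ i, 0 < t i)
    (hsum : ∀ x, ∑ i, x / t i ≤ x) :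
    ∃ f : ι × Fin k → ℕ, Function.Injective f ∧ ∀ p, f p ∈ Icc 1 ((p.2 + 1) * t p.1) := by
  classical
  rw [← all_card_le_biUnion_card_iff_exists_injective]
  intro S
  rcases S.eq_empty_or_nonempty with rfl | hS
  · simp
  obtain ⟨p, hp, hmax⟩ := S.exists_max_image (fun p => ((p.2 : ℕ) + 1) * t p.1) hS
  set x := ((p.2 : ℕ) + 1) * t p.1
  calc #S ≤ #(univ.sigma fun i => range (x / t i)) := by
        refine card_le_card_of_injOn (fun q => (⟨q.1, (q.2 : ℕ)⟩ : Σ _ : ι, ℕ)) ?_ ?_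
        · intro q hq
          simp only [coe_sigma, Set.mem_sigma_iff, coe_univ, Set.mem_univ, true_and, coe_range,
            Set.mem_Iio]
          exact (Nat.le_div_iff_mul_le (ht _)).2 (hmax q hq)
        · rintro ⟨i, j⟩ - ⟨i', j'⟩ - h
          simp only [Sigma.mk.injEq, heq_eq_eq] at h
          exact Prod.ext h.1 (Fin.ext h.2)
    _ ≤ x := by simpa using hsum x
    _ = #(Icc 1 x) := by simp
    _ ≤ _ := card_le_card (subset_biUnion_of_mem (fun q : ι × Fin k =>
        Icc 1 (((q.2 : ℕ) + 1) * t q.1)) hp)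

lemma mul_choose_le (n m i : ℕ) (hi : i ≤ n) :
    n * n.choose m ≤ n * (n - i).choose m + i * m * n.choose m := by
  induction i with
  | zero => simp
  | succ i ih =>
    refine (ih (by omega)).trans ?_
    rcases m with _ | m
    · simp
    obtain ⟨a, ha⟩ : ∃ a, n - i = a + 1 := ⟨n - i - 1, by omega⟩
    have ha' : n - (i + 1) = a := by omega
    obtain ⟨b, rfl⟩ : ∃ b, n = b + 1 := ⟨n - 1, by omega⟩
    rw [ha, ha', Nat.choose_succ_succ a m]
    have h1 : a.choose m ≤ b.choose m := Nat.choose_le_choose m (by omega)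
    have h2 := Nat.add_one_mul_choose_eq b m
    nlinarith [Nat.mul_le_mul_left (b + 1) h1]

lemma mul_choose_add_choose_le (n m s : ℕ) (hs : s ≤ n) :
    s * (n - s).choose m + (n - s).choose (m + 1) ≤ n.choose (m + 1) := by
  induction s with
  | zero => simp
  | succ s ih =>
    obtain ⟨a, ha⟩ : ∃ a, n - s = a + 1 := ⟨n - s - 1, by omega⟩
    have ha' : n - (s + 1) = a := by omega
    have h := ih (by omega)
    rw [ha, Nat.choose_succ_succ a m] at h
    rw [ha']
    nlinarith [Nat.choose_le_choose m (Nat.le_succ a)]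

/-- The lower bound on the size of the families beats `t` times the number of `(k-1)`-sets. -/
lemma mul_choose_lt_choose_sub_choose {n k s t : ℕ} (hk : 1 ≤ k)
    (hn : 8 * (s + 1) * k ≤ n) (ht : 8 * t < 7 * s) :
    t * n.choose (k - 1) < n.choose k - (n - s).choose k := by
  obtain ⟨m, rfl⟩ : ∃ m, k = m + 1 := ⟨k - 1, by omega⟩
  have hsn : s ≤ n := by nlinarith
  have hmn : m ≤ n := by nlinarith
  have h1 := mul_choose_le n m s hsn
  have h2 := mul_choose_add_choose_le n m s hsn
  have hpos : 0 < n.choose m := Nat.choose_pos hmn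
  have hn0 : 0 < n := by nlinarith
  have h3 : 7 * n.choose m ≤ 8 * (n - s).choose m := by
    have h4 : 8 * (s * m) * n.choose m ≤ n * n.choose m :=
      Nat.mul_le_mul_right _ (by nlinarith)
    refine Nat.le_of_mul_le_mul_left ?_ hn0
    nlinarith
  rw [Nat.add_sub_cancel]
  have h5 : t * n.choose m < s * (n - s).choose m := by
    have := Nat.mul_le_mul_left s h3
    nlinarith [Nat.mul_lt_mul_of_pos_right ht hpos]
  omega

/-- In a shifted family, the shadow of `F(∅)` lies in the link `F({s+1})`. -/
lemma shadow_emptyPart_subset_link {n s : ℕ} {F : Finset (Finset ℕ)} (hF : Shifted n F)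
    (hFn : ∀ A ∈ F, A ⊆ Icc 1 n) : ∂ (emptyPart s F) ⊆ link s F (s + 1) := by
  intro B hB
  obtain ⟨A, hA, x, hx, rfl⟩ := mem_shadow_iff.1 hB
  obtain ⟨hA, hAe⟩ := mem_filter.1 hA
  have hgt : ∀ y ∈ A, s + 1 < y := by
    intro y hy
    by_contra hle
    have h1 := mem_Icc.1 (hFn A hA hy)
    have : y ∈ A ∩ Icc 1 (s + 1) := mem_inter.2 ⟨hy, mem_Icc.2 (by omega)⟩
    simp [hAe] at this
  have hs : s + 1 ∉ A := fun h => absurd (hgt _ h) (lt_irrefl _)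
  refine mem_image.2 ⟨insert (s + 1) (A.erase x), mem_filter.2 ⟨?_, ?_⟩, ?_⟩
  · exact hF _ _ (by omega) (hgt x hx) (mem_Icc.1 (hFn A hA hx)).2 A hA hx hs
  · rw [insert_inter_of_mem (by simp), erase_inter, hAe]
    simp
  · exact erase_insert fun h => hs (mem_of_mem_erase h)

lemma exists_forall_card_lt_of_lt_emptyPart {n k s : ℕ} {F : Finset (Finset ℕ)}
    (hF : Shifted n F) (hFn : F ⊆ (Icc 1 n).powersetCard k)
    (h : (3 * s + 2) * #(link s F (s + 1)) < #(emptyPart s F)) :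
    ∃ A ∈ F, ∀ j, 1 ≤ j → j ≤ k → #{a ∈ A | a < j * (3 * s + 3)} < j := by
  by_contra! hcon
  refine absurd h (not_lt.2 ?_)
  refine (card_le_mul_card_shadow (3 * s + 2) n k _ ((filter_subset _ _).trans hFn) ?_).trans
    (Nat.mul_le_mul_left _ (card_le_card (shadow_emptyPart_subset_link hF
      fun A hA => (mem_powersetCard.1 (hFn hA)).1)))
  exact fun A hA => hcon A (filter_subset _ _ hA)

lemma exists_forall_card_lt_of_choose_lt {n k t : ℕ} {F : Finset (Finset ℕ)}
    (hFn : F ⊆ (Icc 1 n).powersetCard k) (h : t * n.choose (k - 1) < #F) :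
    ∃ A ∈ F, ∀ j, 1 ≤ j → j ≤ k → #{a ∈ A | a < j * (t + 1)} < j := by
  by_contra! hcon
  refine absurd h (not_lt.2 ((card_le_mul_card_shadow t n k F hFn hcon).trans
    (Nat.mul_le_mul_left _ ?_)))
  calc #(∂ F) ≤ #((Icc 1 n).powersetCard (k - 1)) := by
        refine card_le_card fun B hB => ?_
        obtain ⟨A, hA, x, hx, rfl⟩ := mem_shadow_iff.1 hB
        obtain ⟨hs, hc⟩ := mem_powersetCard.1 (hFn hA)
        exact mem_powersetCard.2
          ⟨(erase_subset _ _).trans hs, by rw [card_erase_of_mem hx, hc]⟩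
    _ = n.choose (k - 1) := by simp

/-- Lemma 3: for shifted cross-dependent families of `k`-subsets of `[n]`,
`n = ⌈3e(s+1)k⌉`, each of size at least `C(n,k) − C(n−s,k)`, there is a set `U` of at
least `⌈2(s+1)/3⌉` indices with `|F_i(∅)| ≤ (3s+2)|F_i({s+1})|` for all `i ∈ U`. -/
theorem many_good_indices (k s n : ℕ) (hk : 1 ≤ k) (hs : 50 ≤ s)
    (hn : n = ⌈(3 : ℝ) * Real.exp 1 * (s + 1) * k⌉₊)
    (F : ℕ → Finset (Finset ℕ))
    (hF : ∀ i ∈ Finset.Icc 1 (s + 1), F i ⊆ (Finset.Icc 1 n).powersetCard k)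
    (hshift : ∀ i ∈ Finset.Icc 1 (s + 1), Shifted n (F i))
    (hcross : ¬ ∃ g : ℕ → Finset ℕ, (∀ i ∈ Finset.Icc 1 (s + 1), g i ∈ F i) ∧
      ∀ i ∈ Finset.Icc 1 (s + 1), ∀ j ∈ Finset.Icc 1 (s + 1), i ≠ j →
        Disjoint (g i) (g j))
    (hbig : ∀ i ∈ Finset.Icc 1 (s + 1), n.choose k - (n - s).choose k ≤ (F i).card) :
    ∃ U : Finset ℕ, U ⊆ Finset.Icc 1 (s + 1) ∧ ⌈(2 * ((s : ℚ) + 1)) / 3⌉₊ ≤ U.card ∧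
      ∀ i ∈ U, (emptyPart s (F i)).card ≤ (3 * s + 2) * (link s (F i) (s + 1)).card := by
  have hn8 : 8 * (s + 1) * k ≤ n := by
    have he : (8 : ℝ) ≤ 3 * Real.exp 1 := by linarith [Real.exp_one_gt_d9]
    have h1 : (3 : ℝ) * Real.exp 1 * (s + 1) * k ≤ n := hn ▸ Nat.le_ceil _
    have h2 : (8 : ℝ) * (s + 1) * k ≤ 3 * Real.exp 1 * (s + 1) * k := by gcongr
    exact_mod_cast h2.trans h1
  set I := Icc 1 (s + 1) with hI
  set U := {i ∈ I | #(emptyPart s (F i)) ≤ (3 * s + 2) * #(link s (F i) (s + 1))}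
  refine ⟨U, filter_subset _ _, ?_, fun i hi => (mem_filter.1 hi).2⟩
  by_contra hlt
  have hUc : 3 * #U < 2 * (s + 1) := by
    rw [Nat.ceil_le, not_le, lt_div_iff₀ (by norm_num)] at hlt
    have : (#U : ℚ) * 3 < 2 * (s + 1) := hlt
    have : #U * 3 < 2 * (s + 1) := by exact_mod_cast this
    omega
  obtain ⟨τ, hτ1, hτ2⟩ : ∃ τ, 3 * (s + 1) ≤ 4 * (τ + 1) ∧ 8 * τ < 7 * s :=
    ⟨(3 * s + 2) / 4, by omega, by omega⟩
  have hτs : τ + 1 ≤ 3 * s + 3 := by omega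
  set t : ℕ → ℕ := fun i => if i ∈ U then τ + 1 else 3 * s + 3 with ht
  have htpos : ∀ i, 0 < t i := by
    intro i
    simp only [ht]
    split_ifs <;> omega
  have htle : ∀ i, t i ≤ 3 * s + 3 := by
    intro i
    simp only [ht]
    split_ifs <;> omega
  have hwit : ∀ i ∈ I, ∃ A ∈ F i, ∀ j, 1 ≤ j → j ≤ k → #{a ∈ A | a < j * t i} < j := by
    intro i hi
    by_cases hiU : i ∈ U
    · simp only [ht, if_pos hiU]
      exact exists_forall_card_lt_of_choose_lt (hF i hi)
        ((mul_choose_lt_choose_sub_choose hk hn8 hτ2).trans_le (hbig i hi))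
    · simp only [ht, if_neg hiU]
      refine exists_forall_card_lt_of_lt_emptyPart (hshift i hi) (hF i hi) ?_
      by_contra hle
      exact hiU (mem_filter.2 ⟨hi, not_lt.1 hle⟩)
  have hsum : ∀ x, ∑ i : I, x / t i ≤ x := by
    intro x
    rw [sum_coe_sort I fun i => x / t i]
    have hsplit : ∑ i ∈ I, x / t i
        = #U * (x / (τ + 1)) + (s + 1 - #U) * (x / (3 * s + 3)) := by
      rw [← sum_filter_add_sum_filter_not I (· ∈ U)]
      have h1 : I.filter (· ∈ U) = U := by
        ext i
        simp only [mem_filter, and_iff_right_iff_imp]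
        exact fun h => (mem_filter.1 h).1
      have h2 : #(I.filter (· ∉ U)) = s + 1 - #U := by
        have := card_filter_add_card_filter_not (s := I) (· ∈ U)
        rw [h1] at this
        simp only [hI, Nat.card_Icc] at this ⊢
        omega
      congr 1
      · rw [h1, sum_congr rfl fun i hi => congrArg (x / ·) (if_pos hi), sum_const, smul_eq_mul]
      · rw [← h2, sum_congr rfl fun i hi => congrArg (x / ·) (if_neg (mem_filter.1 hi).2),
          sum_const, smul_eq_mul]
    rw [hsplit]
    obtain ⟨w, hw⟩ : ∃ w, s + 1 = #U + w := ⟨s + 1 - #U, by omega⟩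
    rw [show s + 1 - #U = w by omega]
    have h1 := Nat.mul_div_le x (τ + 1)
    have h2 := Nat.mul_div_le x (3 * s + 3)
    set p := x / (τ + 1)
    set q := x / (3 * s + 3)
    have h3 : 3 * (s + 1) * p ≤ 4 * x := by nlinarith
    have h4 : 3 * (s + 1) * q ≤ x := by nlinarith
    have hqp : q ≤ p := Nat.div_le_div_left hτs (by omega)
    nlinarith
  obtain ⟨f, hfinj, hf⟩ := exists_injective_le_mul k (fun i : I => t i) (fun i => htpos i) hsum
  refine hcross ⟨fun i => if hi : i ∈ I then univ.image fun j => f (⟨i, hi⟩, j) else ∅,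
    fun i hi => ?_, fun i hi j hj hij => ?_⟩
  · simp only [dif_pos hi]
    obtain ⟨A, hA, hAt⟩ := hwit i hi
    refine (hshift i hi).mem_image_of_le hA (hF i hi hA) hAt _
      (fun a b hab => by simpa using hfinj hab) (fun j => ?_) (fun j => (mem_Icc.1 (hf _)).2)
    have h1 := mem_Icc.1 (hf (⟨i, hi⟩, j))
    refine mem_Icc.2 ⟨h1.1, h1.2.trans ((Nat.mul_le_mul j.2 (htle i)).trans ?_)⟩
    nlinarith
  · simp only [dif_pos hi, dif_pos hj, disjoint_left]
    intro y hy hy'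
    obtain ⟨a, -, rfl⟩ := mem_image.1 hy
    obtain ⟨b, -, hb⟩ := mem_image.1 hy'
    have := hfinj hb
    simp only [Prod.mk.injEq, Subtype.mk.injEq] at this
    exact hij this.1.symm
end

section
/- Let k ≥ 1 and s ≥ 50 be integers such that 3(s+1)/4 is an integer, and let n be an integer with n ≥ 3e(s+1)k (where e is Euler's number). Let F be a shifted family of k-element subsets of [n], and suppose there exists a rational number β > 4/(3(s+1)) such that for every F ∈ F there is some ℓ ∈ [n] with |F ∩ [ℓ]| ≥ β·ℓ. Then |F| < C(n,k) − C(n−s,k). -/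
open Finset

/-- At most `C(n-j, k-j)` of the `k`-subsets of an `n`-set contain a given `j`-set. -/
lemma card_powersetCard_filter_superset_le (n k : ℕ) (S : Finset ℕ) :
    #{A ∈ (Icc 1 n).powersetCard k | S ⊆ A} ≤ (n - #S).choose (k - #S) := by
  by_cases hS : S ⊆ Icc 1 n
  · calc #{A ∈ (Icc 1 n).powersetCard k | S ⊆ A}
        ≤ #((Icc 1 n \ S).powersetCard (k - #S)) := by
          refine card_le_card_of_injOn (fun A => A \ S) ?_ ?_
          · intro A hA
            simp only [coe_filter, Set.mem_ofPred_eq, mem_powersetCard] at hA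
            obtain ⟨⟨hAn, hAk⟩, hSA⟩ := hA
            rw [mem_coe, mem_powersetCard, card_sdiff_of_subset hSA, hAk]
            exact ⟨sdiff_subset_sdiff hAn subset_rfl, rfl⟩
          · intro A hA B hB h
            simp only [coe_filter, Set.mem_ofPred_eq] at hA hB
            have h' : A \ S = B \ S := h
            rw [← sdiff_union_of_subset hA.2, h', sdiff_union_of_subset hB.2]
      _ = (n - #S).choose (k - #S) := by
          rw [card_powersetCard, card_sdiff_of_subset hS, Nat.card_Icc, Nat.add_sub_cancel]
  · rw [filter_false_of_mem, card_empty]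
    · exact Nat.zero_le _
    · exact fun A hA hSA => hS (hSA.trans (mem_powersetCard.1 hA).1)

lemma card_filter_le_card_inter_Icc_le (n k m j : ℕ) :
    #{A ∈ (Icc 1 n).powersetCard k | j ≤ #(A ∩ Icc 1 m)} ≤
      m.choose j * (n - j).choose (k - j) := by
  calc #{A ∈ (Icc 1 n).powersetCard k | j ≤ #(A ∩ Icc 1 m)}
      ≤ #(((Icc 1 m).powersetCard j).biUnion
          fun S => {A ∈ (Icc 1 n).powersetCard k | S ⊆ A}) := by
        refine card_le_card fun A hA => ?_
        rw [mem_filter] at hA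
        obtain ⟨S, hS, hSj⟩ := exists_subset_card_eq hA.2
        refine mem_biUnion.2 ⟨S, mem_powersetCard.2 ⟨hS.trans inter_subset_right, hSj⟩, ?_⟩
        exact mem_filter.2 ⟨hA.1, hS.trans inter_subset_left⟩
    _ ≤ #((Icc 1 m).powersetCard j) * (n - j).choose (k - j) := by
        refine card_biUnion_le_card_mul _ _ _ fun S hS => ?_
        have h := card_powersetCard_filter_superset_le n k S
        rwa [(mem_powersetCard.1 hS).2] at h
    _ = m.choose j * (n - j).choose (k - j) := by
        rw [card_powersetCard, Nat.card_Icc, Nat.add_sub_cancel]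

lemma card_filter_one_le_card_inter_Icc_add_le (n k m : ℕ) :
    #{A ∈ (Icc 1 n).powersetCard k | 1 ≤ #(A ∩ Icc 1 m)} + (n - m).choose k ≤
      n.choose k := by
  have hcard : #((Icc (m + 1) n).powersetCard k) = (n - m).choose k := by
    rw [card_powersetCard, Nat.card_Icc, Nat.add_sub_add_right]
  have hdisj : Disjoint {A ∈ (Icc 1 n).powersetCard k | 1 ≤ #(A ∩ Icc 1 m)}
      ((Icc (m + 1) n).powersetCard k) := by
    refine disjoint_left.2 fun A hA hA' => ?_
    obtain ⟨x, hx⟩ := card_pos.1 (mem_filter.1 hA).2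
    have h1 := mem_Icc.1 (mem_inter.1 hx).2
    have h2 := mem_Icc.1 ((mem_powersetCard.1 hA').1 (mem_inter.1 hx).1)
    omega
  rw [← hcard, ← card_union_of_disjoint hdisj]
  calc _ ≤ #((Icc 1 n).powersetCard k) := by
        refine card_le_card (union_subset (filter_subset _ _) ?_)
        exact powersetCard_mono (Icc_subset_Icc_left (by omega))
    _ = n.choose k := by rw [card_powersetCard, Nat.card_Icc, Nat.add_sub_cancel]

lemma choose_sub_sub_le (n k : ℕ) (hkn : k ≤ n) (i : ℕ) (hi : i + 1 ≤ k) :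
    ((n - (i + 1)).choose (k - (i + 1)) : ℝ) ≤
      (n - 1).choose (k - 1) * ((k : ℝ) / n) ^ i := by
  induction i with
  | zero => simp
  | succ i ih =>
    specialize ih (by omega)
    obtain ⟨r, rfl⟩ := Nat.exists_eq_add_of_le hi
    obtain ⟨q, rfl⟩ := Nat.exists_eq_add_of_le hkn
    have h := Nat.add_one_mul_choose_eq (r + q) r
    have e1 : i + 1 + 1 + r + q - (i + 1) = r + q + 1 := by omega
    have e2 : i + 1 + 1 + r - (i + 1) = r + 1 := by omega
    have e3 : i + 1 + 1 + r + q - (i + 1 + 1) = r + q := by omega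
    have e4 : i + 1 + 1 + r - (i + 1 + 1) = r := by omega
    rw [e1, e2] at ih
    rw [e3, e4, pow_succ, ← mul_assoc]
    have h' : ((r + q : ℕ) + 1 : ℝ) * (r + q).choose r = (r + q + 1).choose (r + 1) * (r + 1) := by
      exact_mod_cast h
    have hr : (r + 1 : ℝ) / ((r + q : ℕ) + 1) ≤
        (i + 1 + 1 + r : ℕ) / (i + 1 + 1 + r + q : ℕ) := by
      rw [div_le_div_iff₀ (by positivity) (by positivity)]
      push_cast
      nlinarith [mul_nonneg (Nat.cast_nonneg (α := ℝ) i) (Nat.cast_nonneg (α := ℝ) q),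
        Nat.cast_nonneg (α := ℝ) q]
    calc ((r + q).choose r : ℝ)
        = (r + q + 1).choose (r + 1) * ((r + 1 : ℝ) / ((r + q : ℕ) + 1)) := by
          field_simp
          linarith
      _ ≤ _ := mul_le_mul ih hr (by positivity) (by positivity)

lemma pow_self_le_factorial_mul_exp (i : ℕ) :
    ((i + 2 : ℕ) : ℝ) ^ (i + 2) ≤ 2 * (i + 2).factorial * Real.exp 1 ^ i := by
  induction i with
  | zero => norm_num [Nat.factorial]
  | succ i ih =>
    have hpow : ((i + 3 : ℕ) : ℝ) ^ (i + 2) ≤ Real.exp 1 * ((i + 2 : ℕ) : ℝ) ^ (i + 2) := by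
      have hbase : ((i + 3 : ℕ) : ℝ) ≤
          Real.exp (1 / ((i + 2 : ℕ) : ℝ)) * ((i + 2 : ℕ) : ℝ) := by
        have h := Real.add_one_le_exp (1 / ((i + 2 : ℕ) : ℝ))
        calc ((i + 3 : ℕ) : ℝ) = (1 / ((i + 2 : ℕ) : ℝ) + 1) * ((i + 2 : ℕ) : ℝ) := by
              push_cast; field_simp; ring
          _ ≤ _ := by gcongr
      calc ((i + 3 : ℕ) : ℝ) ^ (i + 2)
          ≤ (Real.exp (1 / ((i + 2 : ℕ) : ℝ)) * ((i + 2 : ℕ) : ℝ)) ^ (i + 2) := by gcongr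
        _ = _ := by
          rw [mul_pow, ← Real.exp_nat_mul, mul_one_div_cancel (by positivity)]
    have hfac : ((i + 3).factorial : ℝ) = (i + 3 : ℕ) * (i + 2).factorial := by
      exact_mod_cast Nat.factorial_succ (i + 2)
    calc ((i + 3 : ℕ) : ℝ) ^ (i + 3) = (i + 3 : ℕ) * ((i + 3 : ℕ) : ℝ) ^ (i + 2) := by ring
      _ ≤ (i + 3 : ℕ) * (Real.exp 1 * (2 * (i + 2).factorial * Real.exp 1 ^ i)) := by
        gcongr
        exact hpow.trans (by gcongr)
      _ = 2 * (i + 3).factorial * Real.exp 1 ^ (i + 1) := by rw [hfac]; ring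

lemma choose_add_mul_choose_le (a r u : ℕ) :
    a.choose (r + 1) + u * a.choose r ≤ (a + u).choose (r + 1) := by
  induction u with
  | zero => simp
  | succ u ih =>
    rw [← add_assoc, Nat.choose_succ_succ', add_one_mul]
    have := Nat.choose_le_choose r (Nat.le_add_right a u)
    omega

lemma choose_succ_le_add_mul_choose (a b r : ℕ) :
    (a + b).choose (r + 1) ≤ a.choose (r + 1) + b * (a + b - 1).choose r := by
  induction b with
  | zero => simp
  | succ b ih =>
    have h1 := Nat.choose_le_choose r (Nat.sub_le (a + b) 1)
    have h2 := Nat.mul_le_mul_left b h1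
    rw [← add_assoc, Nat.choose_succ_succ', add_one_mul, Nat.add_sub_cancel]
    omega

lemma sum_pow_quarter_le (k : ℕ) : ∑ i ∈ range k, (1 / 4 : ℝ) ^ (i + 1) ≤ 1 / 3 := by
  have h : ∑ i ∈ range k, (1 / 4 : ℝ) ^ (i + 1) = (1 - (1 / 4) ^ k) / 3 := by
    induction k with
    | zero => simp
    | succ k ih => rw [sum_range_succ, ih]; ring
  rw [h]
  have : (0 : ℝ) ≤ (1 / 4) ^ k := by positivity
  linarith

lemma choose_mul_choose_sub_le (n k t : ℕ) (hkn : k ≤ n) (ht : 1 ≤ t) (hk : 1 ≤ k)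
    (hn : 4 * Real.exp 1 * t * k ≤ n) (i : ℕ) (hi : i + 2 ≤ k) :
    (((i + 2) * t - 1).choose (i + 2) * (n - (i + 2)).choose (k - (i + 2)) : ℝ) ≤
      2 / Real.exp 1 * t * (n - 1).choose (k - 1) * (1 / 4) ^ (i + 1) := by
  have he := Real.exp_pos 1
  have hn0 : (0 : ℝ) < n := by exact_mod_cast (by omega : 0 < n)
  have ht0 : (0 : ℝ) < t := by exact_mod_cast ht
  have hratio : (k : ℝ) / n ≤ 1 / (4 * Real.exp 1 * t) := by
    rw [div_le_div_iff₀ hn0 (by positivity)]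
    linarith
  have h1 : (((i + 2) * t - 1).choose (i + 2) : ℝ) ≤ 2 * Real.exp 1 ^ i * t ^ (i + 2) := by
    calc (((i + 2) * t - 1).choose (i + 2) : ℝ) ≤ ((i + 2) * t).choose (i + 2) := by
          exact_mod_cast Nat.choose_le_choose _ (Nat.sub_le _ _)
      _ ≤ (((i + 2) * t : ℕ) : ℝ) ^ (i + 2) / (i + 2).factorial := Nat.choose_le_pow_div _ _
      _ ≤ 2 * Real.exp 1 ^ i * t ^ (i + 2) := by
          rw [div_le_iff₀ (by positivity), Nat.cast_mul, mul_pow]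
          calc _ ≤ (2 * (i + 2).factorial * Real.exp 1 ^ i) * (t : ℝ) ^ (i + 2) := by
                gcongr
                exact pow_self_le_factorial_mul_exp i
            _ = _ := by ring
  have h2 := choose_sub_sub_le n k hkn (i + 1) hi
  calc _ ≤ (2 * Real.exp 1 ^ i * t ^ (i + 2)) *
        ((n - 1).choose (k - 1) * (1 / (4 * Real.exp 1 * t)) ^ (i + 1)) := by
        gcongr
        exact h2.trans (by gcongr)
    _ = _ := by
        rw [div_pow, div_pow, one_pow, mul_pow, mul_pow]
        field_simp
        ring

/-- Below `n/(3e(s+1))`, passing from `n - 1` to `n - s` loses little of `C(n-1, k-1)`. -/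
lemma mul_choose_le_choose_sub (n k s : ℕ) (hkn : k ≤ n) (hk : 1 ≤ k) (hs : 1 ≤ s) (hsn : s ≤ n)
    (hn : (3 : ℝ) * Real.exp 1 * (s + 1) * k ≤ n) :
    (1 - 1 / (3 * Real.exp 1)) * ((n - 1).choose (k - 1) : ℝ) ≤ (n - s).choose (k - 1) := by
  have he := Real.exp_pos 1
  obtain rfl | hk2 := hk.eq_or_lt
  · have : (0 : ℝ) ≤ 1 / (3 * Real.exp 1) := by positivity
    simp only [Nat.sub_self, Nat.choose_zero_right, Nat.cast_one]
    linarith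
  have hn0 : (0 : ℝ) < n := by exact_mod_cast (by omega : 0 < n)
  have h1 := choose_sub_sub_le n k hkn 1 hk2
  have h2 := choose_succ_le_add_mul_choose (n - s) (s - 1) (k - 2)
  rw [show n - s + (s - 1) = n - 1 by omega, show k - 2 + 1 = k - 1 by omega,
    show n - 1 - 1 = n - 2 by omega] at h2
  have h3 : ((n - 1).choose (k - 1) : ℝ) ≤
      (n - s).choose (k - 1) + (s - 1 : ℕ) * (n - 2).choose (k - 2) := by exact_mod_cast h2
  have h4 : ((s - 1 : ℕ) : ℝ) * ((k : ℝ) / n) ≤ 1 / (3 * Real.exp 1) := by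
    rw [Nat.cast_sub hs, ← mul_div_assoc, div_le_div_iff₀ hn0 (by positivity)]
    have : 0 ≤ Real.exp 1 * k := by positivity
    push_cast
    nlinarith
  have h5 : ((s - 1 : ℕ) : ℝ) * (n - 2).choose (k - 2) ≤
      (n - 1).choose (k - 1) * (1 / (3 * Real.exp 1)) := by
    calc _ ≤ ((s - 1 : ℕ) : ℝ) * ((n - 1).choose (k - 1) * ((k : ℝ) / n) ^ 1) := by gcongr
      _ = (n - 1).choose (k - 1) * (((s - 1 : ℕ) : ℝ) * ((k : ℝ) / n)) := by ring
      _ ≤ _ := by gcongr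
  linarith

/-- A set that is `β`-dense in some `[ℓ]`, where `β > 1/t`, has at least `j` elements
in `[jt - 1]` for some `j ≥ 1`. -/
lemma exists_le_card_inter_Icc_of_dense {t ℓ : ℕ} {β : ℚ} {A : Finset ℕ} (ht : 1 ≤ t)
    (hℓ : 1 ≤ ℓ) (hβ : 1 / (t : ℚ) < β) (h : β * ℓ ≤ (#(A ∩ Icc 1 ℓ) : ℚ)) :
    ∃ j, 1 ≤ j ∧ j ≤ #A ∧ j ≤ #(A ∩ Icc 1 (j * t - 1)) := by
  have ht0 : (0 : ℚ) < t := by exact_mod_cast ht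
  have hℓ0 : (0 : ℚ) < ℓ := by exact_mod_cast hℓ
  have hlt : (ℓ : ℚ) < #(A ∩ Icc 1 ℓ) * t := by
    have : 1 / (t : ℚ) * ℓ < #(A ∩ Icc 1 ℓ) := (mul_lt_mul_of_pos_right hβ hℓ0).trans_le h
    rwa [one_div_mul_eq_div, div_lt_iff₀ ht0] at this
  have hlt' : ℓ < #(A ∩ Icc 1 ℓ) * t := by exact_mod_cast hlt
  refine ⟨#(A ∩ Icc 1 ℓ), ?_, card_le_card inter_subset_left, ?_⟩
  · by_contra! h0
    rw [Nat.lt_one_iff.1 h0, zero_mul] at hlt'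
    omega
  · exact card_le_card (inter_subset_inter_left (Icc_subset_Icc_right (by omega)))

/-- Lemma 4 (Lemma `lemrain3`): if a shifted family `F` of `k`-subsets of `[n]`,
`n ≥ 3e(s+1)k`, has the property that for some rational `β > 4/(3(s+1))` every `F ∈ F`
satisfies `|F ∩ [ℓ]| ≥ βℓ` for some `ℓ`, then `|F| < C(n,k) − C(n−s,k)`. -/
theorem large_beta_implies_small (k s n : ℕ) (hk : 1 ≤ k) (hs : 50 ≤ s)
    (hdvd : 4 ∣ 3 * (s + 1))
    (hn : (3 : ℝ) * Real.exp 1 * (s + 1) * k ≤ n)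
    (F : Finset (Finset ℕ)) (hF : F ⊆ (Finset.Icc 1 n).powersetCard k)
    (hshift : Shifted n F)
    (β : ℚ) (hβ : 4 / (3 * ((s : ℚ) + 1)) < β)
    (hcond : ∀ A ∈ F, ∃ ℓ ∈ Finset.Icc 1 n,
      β * ℓ ≤ ((A ∩ Finset.Icc 1 ℓ).card : ℚ)) :
    F.card < n.choose k - (n - s).choose k := by
  obtain ⟨u, rfl⟩ : ∃ u, s = 4 * u - 1 := ⟨(s + 1) / 4, by omega⟩
  have hu : 1 ≤ u := by omega
  have he := Real.exp_one_gt_d9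
  have hk1 : (1 : ℝ) ≤ k := by exact_mod_cast hk
  have hu1 : (1 : ℝ) ≤ u := by exact_mod_cast hu
  have hscast : ((4 * u - 1 : ℕ) : ℝ) + 1 = 4 * u := by
    rw [Nat.cast_sub (by omega)]; push_cast; ring
  have hnu : 4 * Real.exp 1 * (3 * u : ℕ) * k ≤ n := by
    rw [hscast] at hn
    push_cast
    linarith
  have hlarge : ((4 * u * k : ℕ) : ℝ) ≤ n := by
    push_cast at hnu ⊢
    have : (0 : ℝ) ≤ u * k := by positivity
    nlinarith
  have hlarge' : 4 * u * k ≤ n := by exact_mod_cast hlarge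
  have hkn : k ≤ n := by nlinarith
  have hun : 4 * u ≤ n := by nlinarith
  set t := 3 * u with ht
  have hD0 : (0 : ℝ) < ((n - 1).choose (k - 1) : ℕ) := by
    exact_mod_cast Nat.choose_pos (by omega)
  set D := (((n - 1).choose (k - 1) : ℕ) : ℝ)
  have hβt : 1 / (t : ℚ) < β := by
    refine lt_of_eq_of_lt ?_ hβ
    have hu0 : (u : ℚ) ≠ 0 := by exact_mod_cast (by omega : u ≠ 0)
    rw [ht, Nat.cast_sub (by omega)]
    push_cast
    field_simp
    ring
  let G : ℕ → Finset (Finset ℕ) := fun j =>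
    {A ∈ (Icc 1 n).powersetCard k | j ≤ #(A ∩ Icc 1 (j * t - 1))}
  have hcover : F ⊆ G 1 ∪ (range (k - 1)).biUnion fun i => G (i + 2) := by
    intro A hA
    obtain ⟨ℓ, hℓ, hA'⟩ := hcond A hA
    obtain ⟨j, hj1, hjA, hj⟩ :=
      exists_le_card_inter_Icc_of_dense (by omega) (mem_Icc.1 hℓ).1 hβt hA'
    have hjk : j ≤ k := hjA.trans_eq (mem_powersetCard.1 (hF hA)).2
    have hAG : A ∈ G j := mem_filter.2 ⟨hF hA, hj⟩
    obtain rfl | hj2 := hj1.eq_or_lt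
    · exact mem_union_left _ hAG
    · refine mem_union_right _ (mem_biUnion.2 ⟨j - 2, mem_range.2 (by omega), ?_⟩)
      rwa [Nat.sub_add_cancel hj2]
  have hcard : #F ≤ #(G 1) + ∑ i ∈ range (k - 1), #(G (i + 2)) :=
    (card_le_card hcover).trans ((card_union_le _ _).trans (by gcongr; exact card_biUnion_le))
  have hG1 : #(G 1) + (n - (t - 1)).choose k ≤ n.choose k := by
    simpa only [G, one_mul] using card_filter_one_le_card_inter_Icc_add_le n k (t - 1)
  have hsum : ((∑ i ∈ range (k - 1), #(G (i + 2)) : ℕ) : ℝ) ≤ 2 / Real.exp 1 * u * D := by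
    rw [Nat.cast_sum]
    calc ∑ i ∈ range (k - 1), (#(G (i + 2)) : ℝ)
        ≤ ∑ i ∈ range (k - 1), 2 / Real.exp 1 * t * D * (1 / 4) ^ (i + 1) := by
          refine sum_le_sum fun i hi => ?_
          have hi' : i + 2 ≤ k := by have := mem_range.1 hi; omega
          refine le_trans ?_ (choose_mul_choose_sub_le n k t hkn (by omega) hk hnu i hi')
          exact_mod_cast card_filter_le_card_inter_Icc_le n k ((i + 2) * t - 1) (i + 2)
      _ ≤ 2 / Real.exp 1 * t * D * (1 / 3) := by
          rw [← mul_sum]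
          gcongr
          exact sum_pow_quarter_le _
      _ = 2 / Real.exp 1 * u * D := by rw [ht]; push_cast; ring
  have hgap : (n - (4 * u - 1)).choose k + u * (n - (4 * u - 1)).choose (k - 1) ≤
      (n - (t - 1)).choose k := by
    have h := choose_add_mul_choose_le (n - (4 * u - 1)) (k - 1) u
    rwa [Nat.sub_add_cancel hk, show n - (4 * u - 1) + u = n - (t - 1) by omega] at h
  have hD' := mul_choose_le_choose_sub n k (4 * u - 1) hkn hk (by omega) (by omega) hn
  have hconst : 2 / Real.exp 1 < 1 - 1 / (3 * Real.exp 1) := by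
    have : 1 - 1 / (3 * Real.exp 1) - 2 / Real.exp 1 = (3 * Real.exp 1 - 7) / (3 * Real.exp 1) := by
      field_simp
      ring
    have : 0 < (3 * Real.exp 1 - 7) / (3 * Real.exp 1) := div_pos (by linarith) (by positivity)
    linarith
  have hlt : ((∑ i ∈ range (k - 1), #(G (i + 2)) : ℕ) : ℝ) <
      (u * (n - (4 * u - 1)).choose (k - 1) : ℕ) := by
    calc _ ≤ 2 / Real.exp 1 * u * D := hsum
      _ = u * (2 / Real.exp 1 * D) := by ring
      _ < u * ((1 - 1 / (3 * Real.exp 1)) * D) := by gcongr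
      _ ≤ u * (n - (4 * u - 1)).choose (k - 1) := by gcongr
      _ = _ := by push_cast; rfl
  have hlt' : ∑ i ∈ range (k - 1), #(G (i + 2)) < u * (n - (4 * u - 1)).choose (k - 1) := by
    exact_mod_cast hlt
  omega
end

section
/- Let s, k be positive integers and let n be an integer with n ≥ 3(s+1)k − 1. Let F be a family of k-element subsets of [n] such that for every A ∈ F there exists a positive integer ℓ with |A ∩ [3(s+1)ℓ − 1]| ≥ ℓ. Then (3s+2)·|∂F| ≥ |F|, where ∂F is the shadow of F, i.e., the family of all (k−1)-element subsets of [n] contained in at least one member of F. -/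
/-- The largest `ℓ ≤ k` such that `A` has at least `ℓ - c` elements in `[m ℓ - 1]`. -/
def lastLevel (m k c : ℕ) (A : Finset ℕ) : ℕ :=
  Nat.findGreatest (fun ℓ => ℓ ≤ (A ∩ Finset.Icc 1 (m * ℓ - 1)).card + c) k

theorem lastLevel_le_card (m k c : ℕ) (A : Finset ℕ) :
    lastLevel m k c A ≤
      (A ∩ Finset.Icc 1 (m * lastLevel m k c A - 1)).card + c :=
  Nat.findGreatest_spec (P := fun ℓ => ℓ ≤ (A ∩ Finset.Icc 1 (m * ℓ - 1)).card + c)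
    (Nat.zero_le k) (Nat.zero_le _)

/-- Removing an element of `A` below its last level does not change the level, once the
threshold is lowered by one. -/
theorem lastLevel_erase {m k x : ℕ} {A : Finset ℕ} (hxA : x ∈ A)
    (hx : x ∈ Finset.Icc 1 (m * lastLevel m k 0 A - 1)) :
    lastLevel m k 1 (A.erase x) = lastLevel m k 0 A := by
  have hcard : ∀ j, lastLevel m k 0 A ≤ j →
      ((A.erase x) ∩ Finset.Icc 1 (m * j - 1)).card + 1 =
        (A ∩ Finset.Icc 1 (m * j - 1)).card := by
    intro j hj
    rw [Finset.erase_inter]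
    apply Finset.card_erase_add_one
    have hmul := Nat.mul_le_mul_left m hj
    simp only [Finset.mem_inter, Finset.mem_Icc] at hx ⊢
    exact ⟨hxA, hx.1, by omega⟩
  refine Nat.findGreatest_eq_iff.mpr ⟨Nat.findGreatest_le k, fun _ => ?_, fun j hj hjk => ?_⟩
  · rw [hcard _ le_rfl]
    exact lastLevel_le_card m k 0 A
  · rw [hcard j hj.le]
    exact Nat.findGreatest_is_greatest
      (P := fun ℓ => ℓ ≤ (A ∩ Finset.Icc 1 (m * ℓ - 1)).card + 0) hj hjk

/-- If every member of `F` has last level `ℓ` and every member of `S` has lowered level `ℓ`, and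
`S` contains all sets obtained by removing from a member of `F` an element of `[m ℓ - 1]`, then
`|F| ≤ (m - 1) |S|`. -/
theorem card_le_of_lastLevel_eq {m k ℓ : ℕ} (hℓ : 0 < ℓ) {F S : Finset (Finset ℕ)}
    (hF : ∀ A ∈ F, lastLevel m k 0 A = ℓ) (hS : ∀ B ∈ S, lastLevel m k 1 B = ℓ)
    (hFS : ∀ A ∈ F, ∀ x ∈ A ∩ Finset.Icc 1 (m * ℓ - 1), A.erase x ∈ S) :
    F.card ≤ S.card * (m - 1) := by
  refine Nat.le_of_mul_le_mul_right (c := ℓ) ?_ hℓ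
  rw [mul_assoc]
  refine Finset.card_mul_le_card_mul
    (fun A B => B ∈ (A ∩ Finset.Icc 1 (m * ℓ - 1)).image A.erase) (fun A hA => ?_)
    fun B hB => ?_
  · have hcard := lastLevel_le_card m k 0 A
    rw [hF A hA, add_zero] at hcard
    refine hcard.trans ?_
    rw [← Finset.card_image_of_injOn
      (A.erase_injOn.mono (Finset.coe_subset.mpr Finset.inter_subset_left))]
    refine Finset.card_le_card fun B hB => ?_
    obtain ⟨x, hx, rfl⟩ := Finset.mem_image.mp hB
    exact (Finset.mem_bipartiteAbove _).mpr ⟨hFS A hA x hx, hB⟩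
  · have hcard := lastLevel_le_card m k 1 B
    rw [hS B hB] at hcard
    have hsub : F.bipartiteBelow
        (fun A B => B ∈ (A ∩ Finset.Icc 1 (m * ℓ - 1)).image A.erase) B ⊆
        (Finset.Icc 1 (m * ℓ - 1) \ B).image fun x => insert x B := by
      intro A hA
      obtain ⟨x, hx, rfl⟩ := Finset.mem_image.mp ((Finset.mem_bipartiteBelow _).mp hA).2
      rw [Finset.mem_inter] at hx
      exact Finset.mem_image.mpr ⟨x, Finset.mem_sdiff.mpr ⟨hx.2, Finset.notMem_erase x A⟩,
        Finset.insert_erase hx.1⟩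
    refine (Finset.card_le_card hsub).trans (Finset.card_image_le.trans ?_)
    rw [Finset.card_sdiff, Nat.card_Icc, Nat.sub_mul]
    omega

/-- Lemma (`lemrain4`): if every `A` in a family `F` of `k`-subsets of `[n]`,
`n ≥ 3(s+1)k − 1`, satisfies `|A ∩ [3(s+1)ℓ − 1]| ≥ ℓ` for some positive integer `ℓ`,
then `(3s+2)|∂F| ≥ |F|`, where `∂F` is the family of `(k−1)`-subsets of `[n]` contained
in some member of `F`. -/
theorem shadow_lemma (n k s : ℕ) (hs : 0 < s) (hk : 0 < k)
    (hn : 3 * (s + 1) * k - 1 ≤ n)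
    (F : Finset (Finset ℕ)) (hF : F ⊆ (Finset.Icc 1 n).powersetCard k)
    (hcond : ∀ A ∈ F, ∃ ℓ : ℕ, 0 < ℓ ∧
      ℓ ≤ (A ∩ Finset.Icc 1 (3 * (s + 1) * ℓ - 1)).card) :
    F.card ≤ (3 * s + 2) *
      (((Finset.Icc 1 n).powersetCard (k - 1)).filter fun B => ∃ A ∈ F, B ⊆ A).card := by
  set S := ((Finset.Icc 1 n).powersetCard (k - 1)).filter fun B => ∃ A ∈ F, B ⊆ A
  set m := 3 * (s + 1) with hm
  have hmaps : ∀ c (G : Finset (Finset ℕ)),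
      Set.MapsTo (lastLevel m k c) (G : Set (Finset ℕ)) (Finset.range (k + 1)) := by
    intro c G A _
    exact Finset.mem_coe.mpr (Finset.mem_range_succ_iff.mpr (Nat.findGreatest_le k))
  have hpos : ∀ A ∈ F, 0 < lastLevel m k 0 A := by
    intro A hA
    obtain ⟨ℓ, hℓ, hle⟩ := hcond A hA
    have hAk := (Finset.mem_powersetCard.mp (hF hA)).2
    exact hℓ.trans_le (Nat.le_findGreatest
      (hle.trans ((Finset.card_le_card Finset.inter_subset_left).trans hAk.le)) hle)
  rw [show 3 * s + 2 = m - 1 by omega, mul_comm,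
    Finset.card_eq_sum_card_fiberwise (hmaps 0 F),
    Finset.card_eq_sum_card_fiberwise (hmaps 1 S), Finset.sum_mul]
  refine Finset.sum_le_sum fun ℓ _ => ?_
  rcases Nat.eq_zero_or_pos ℓ with rfl | hℓ
  · rw [Finset.filter_false_of_mem fun A hA => (hpos A hA).ne', Finset.card_empty]
    exact Nat.zero_le _
  refine card_le_of_lastLevel_eq (k := k) hℓ (fun A hA => (Finset.mem_filter.mp hA).2)
    (fun B hB => (Finset.mem_filter.mp hB).2) fun A hA x hx => ?_
  obtain ⟨hAF, rfl⟩ := Finset.mem_filter.mp hA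
  obtain ⟨hxA, hx⟩ := Finset.mem_inter.mp hx
  obtain ⟨hAn, hAk⟩ := Finset.mem_powersetCard.mp (hF hAF)
  refine Finset.mem_filter.mpr ⟨Finset.mem_filter.mpr ⟨Finset.mem_powersetCard.mpr
    ⟨(Finset.erase_subset x A).trans hAn, ?_⟩, A, hAF, Finset.erase_subset x A⟩,
    lastLevel_erase hxA hx⟩
  rw [Finset.card_erase_of_mem hxA, hAk]
end

section
/- Let n', k, t be positive integers with k ≥ 2 and n' ≥ (k−1)t. Let G be a family of (k−1)-element subsets of [n'] and let α = |G| / C(n', k−1). Choose a t-matching M = {M_1, …, M_t} (a collection of t pairwise disjoint (k−1)-element subsets of [n']) uniformly at random among all such t-matchings, and let η be the random variable |{j ∈ [t] : M_j ∈ G}|. Then E[η] = α·t, and for every real β > 0, Pr[|η − α·t| ≥ 2β·√t] ≤ 2·e^{−β²/2}. -/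
open Finset

/-- The average of `f` over the `s`-element subsets of `V`. -/
noncomputable def sliceMean {ι : Type*} (f : Finset ι → ℝ) (s : ℕ) (V : Finset ι) : ℝ :=
  (∑ S ∈ V.powersetCard s, f S) / (V.card.choose s : ℝ)

/-- The ordered `t`-tuples of pairwise disjoint `s`-element subsets of `U`. -/
def matchings {ι : Type*} [DecidableEq ι] (s t : ℕ) (U : Finset ι) : Finset (Fin t → Finset ι) :=
  (Fintype.piFinset fun _ : Fin t => U.powersetCard s).filter
    fun M => ∀ i j : Fin t, i ≠ j → Disjoint (M i) (M j)

/-! ### Exponential sums of bounded quantities -/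

theorem sum_exp_le_card_mul_exp {κ : Type*} (T : Finset κ) (X : κ → ℝ) (m v y : ℝ)
    (hsum : ∑ i ∈ T, X i = T.card * m) (hvar : ∑ i ∈ T, (X i - m) ^ 2 ≤ T.card * v)
    (hbd : ∀ i ∈ T, |y * (X i - m)| ≤ 1) :
    ∑ i ∈ T, Real.exp (y * X i) ≤ T.card * Real.exp (y * m + y ^ 2 * v) := by
  have hterm : ∀ i ∈ T, Real.exp (y * X i) ≤
      Real.exp (y * m) * (1 + y * (X i - m) + y ^ 2 * (X i - m) ^ 2) := by
    intro i hi
    have h := (abs_le.1 (Real.abs_exp_sub_one_sub_id_le (hbd i hi))).2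
    rw [show y * X i = y * m + y * (X i - m) by ring, Real.exp_add]
    gcongr
    nlinarith [h]
  have hzero : ∑ i ∈ T, (X i - m) = 0 := by
    rw [sum_sub_distrib, hsum, sum_const, nsmul_eq_mul, sub_self]
  calc ∑ i ∈ T, Real.exp (y * X i)
      ≤ ∑ i ∈ T, Real.exp (y * m) * (1 + y * (X i - m) + y ^ 2 * (X i - m) ^ 2) :=
        sum_le_sum hterm
    _ = Real.exp (y * m) * (T.card + y ^ 2 * ∑ i ∈ T, (X i - m) ^ 2) := by
        rw [← mul_sum, sum_add_distrib, sum_add_distrib, ← mul_sum, ← mul_sum, hzero]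
        simp
    _ ≤ Real.exp (y * m) * (T.card * (y ^ 2 * v + 1)) := by
        gcongr
        nlinarith [mul_le_mul_of_nonneg_left hvar (sq_nonneg y)]
    _ ≤ Real.exp (y * m) * (T.card * Real.exp (y ^ 2 * v)) := by
        gcongr
        exact Real.add_one_le_exp _
    _ = T.card * Real.exp (y * m + y ^ 2 * v) := by
        rw [Real.exp_add]; ring

theorem sum_sub_mean_sq_le {κ : Type*} (T : Finset κ) (X : κ → ℝ) (m : ℝ)
    (hsum : ∑ i ∈ T, X i = T.card * m) (h0 : ∀ i, 0 ≤ X i) (h1 : ∀ i, X i ≤ 1) :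
    ∑ i ∈ T, (X i - m) ^ 2 ≤ T.card * (1 / 4) := by
  have hterm : ∀ i ∈ T, (X i - m) ^ 2 ≤ X i - 2 * m * X i + m ^ 2 := fun i _ => by
    nlinarith [mul_nonneg (h0 i) (sub_nonneg.2 (h1 i))]
  refine (sum_le_sum hterm).trans ?_
  rw [sum_add_distrib, sum_sub_distrib, ← mul_sum, hsum, sum_const, nsmul_eq_mul]
  nlinarith [mul_nonneg (Nat.cast_nonneg (α := ℝ) T.card) (sq_nonneg (m - 1 / 2))]

/-- Markov's inequality for exponential moments, in counting form. -/
theorem card_filter_le_of_sum_exp_le {κ : Type*} (T : Finset κ) (X : κ → ℝ) (l b : ℝ)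
    (h : ∑ i ∈ T, Real.exp (X i) ≤ T.card * Real.exp b) :
    ((T.filter fun i => l ≤ X i).card : ℝ) ≤ T.card * Real.exp (b - l) := by
  have h1 : ((T.filter fun i => l ≤ X i).card : ℝ) * Real.exp l ≤ ∑ i ∈ T, Real.exp (X i) := by
    rw [← nsmul_eq_mul, ← sum_const]
    refine (sum_le_sum fun i hi => Real.exp_le_exp.2 (mem_filter.1 hi).2).trans ?_
    exact sum_le_sum_of_subset_of_nonneg (filter_subset _ _) fun i _ _ => (Real.exp_pos _).le
  rw [Real.exp_sub, ← mul_div_assoc, le_div_iff₀ (Real.exp_pos _)]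
  exact h1.trans h

section Slice

variable {ι : Type*} {f : Finset ι → ℝ} {s : ℕ}

/-! ### Slice means -/

theorem sum_powersetCard_eq_choose_mul_sliceMean (f : Finset ι → ℝ) {V : Finset ι}
    (hV : s ≤ V.card) :
    ∑ S ∈ V.powersetCard s, f S = (V.card.choose s : ℝ) * sliceMean f s V := by
  have : (V.card.choose s : ℝ) ≠ 0 := by exact_mod_cast (Nat.choose_pos hV).ne'
  rw [sliceMean]
  field_simp

theorem sliceMean_nonneg (h0 : ∀ S, 0 ≤ f S) (V : Finset ι) : 0 ≤ sliceMean f s V :=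
  div_nonneg (sum_nonneg fun S _ => h0 S) (Nat.cast_nonneg _)

theorem sliceMean_le_one (h1 : ∀ S, f S ≤ 1) (V : Finset ι) : sliceMean f s V ≤ 1 := by
  refine div_le_one_of_le₀ ((sum_le_sum fun S _ => h1 S).trans ?_) (Nat.cast_nonneg _)
  simp

variable [DecidableEq ι]

/-! ### Double counting over slices -/

theorem sum_sum_powersetCard_erase (V : Finset ι) (s : ℕ) (F : ι → Finset ι → ℝ) :
    ∑ x ∈ V, ∑ S ∈ (V.erase x).powersetCard s, F x S =
      ∑ S ∈ V.powersetCard s, ∑ x ∈ V \ S, F x S := by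
  refine sum_comm' fun x S => ?_
  simp only [mem_powersetCard, mem_sdiff, subset_erase]
  tauto

theorem succ_mul_sum_powersetCard (V : Finset ι) (j : ℕ) (F : Finset ι → ℝ) :
    ((j : ℝ) + 1) * ∑ B ∈ V.powersetCard (j + 1), F B =
      ∑ x ∈ V, ∑ A ∈ (V.erase x).powersetCard j, F (insert x A) := by
  have hB : ((j : ℝ) + 1) * ∑ B ∈ V.powersetCard (j + 1), F B =
      ∑ B ∈ V.powersetCard (j + 1), ∑ _x ∈ B, F B := by
    rw [mul_sum]
    refine sum_congr rfl fun B hB => ?_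
    rw [sum_const, (mem_powersetCard.1 hB).2, nsmul_eq_mul]
    push_cast
    ring
  rw [hB, sum_sigma', sum_sigma']
  refine sum_bij' (fun p _ => ⟨p.2, p.1.erase p.2⟩) (fun q _ => ⟨insert q.1 q.2, q.1⟩) ?_ ?_ ?_ ?_ ?_
  · rintro ⟨B, x⟩ h
    simp only [mem_sigma, mem_powersetCard] at h ⊢
    exact ⟨h.1.1 h.2, erase_subset_erase _ h.1.1, by rw [card_erase_of_mem h.2, h.1.2]; rfl⟩
  · rintro ⟨x, A⟩ h
    simp only [mem_sigma, mem_powersetCard, subset_erase] at h ⊢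
    exact ⟨⟨insert_subset h.1 h.2.1.1, by rw [card_insert_of_notMem h.2.1.2, h.2.2]⟩,
      mem_insert_self _ _⟩
  · rintro ⟨B, x⟩ h
    simp only [mem_sigma] at h
    simp [insert_erase h.2]
  · rintro ⟨x, A⟩ h
    simp only [mem_sigma, mem_powersetCard, subset_erase] at h
    simp [erase_insert h.2.1.2]
  · rintro ⟨B, x⟩ h
    simp only [mem_sigma] at h
    simp [insert_erase h.2]

theorem sum_powersetCard_sdiff (U : Finset ι) (s : ℕ) (F : Finset ι → ℝ) :
    ∑ A ∈ U.powersetCard s, ∑ S ∈ (U \ A).powersetCard s, F S =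
      ((U.card - s).choose s : ℝ) * ∑ S ∈ U.powersetCard s, F S := by
  have hcomm : ∑ A ∈ U.powersetCard s, ∑ S ∈ (U \ A).powersetCard s, F S =
      ∑ S ∈ U.powersetCard s, ∑ _A ∈ (U \ S).powersetCard s, F S := by
    refine sum_comm' fun A S => ?_
    simp only [mem_powersetCard, subset_sdiff, disjoint_comm]
    tauto
  rw [hcomm, mul_sum]
  refine sum_congr rfl fun S hS => ?_
  have hS := mem_powersetCard.1 hS
  rw [sum_const, card_powersetCard, card_sdiff_of_subset hS.1, hS.2, nsmul_eq_mul]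

/-! ### Slice means after deleting elements -/

theorem sum_sliceMean_sdiff (f : Finset ι → ℝ) {U : Finset ι} (hU : 2 * s ≤ U.card) :
    ∑ A ∈ U.powersetCard s, sliceMean f s (U \ A) =
      (U.card.choose s : ℝ) * sliceMean f s U := by
  have hpos : ((U.card - s).choose s : ℝ) ≠ 0 := by
    exact_mod_cast (Nat.choose_pos (by omega)).ne'
  rw [← sum_powersetCard_eq_choose_mul_sliceMean f (by omega), ← mul_right_inj' hpos,
    ← sum_powersetCard_sdiff U s f, mul_sum]
  refine sum_congr rfl fun A hA => ?_
  have hA := mem_powersetCard.1 hA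
  have hcard : (U \ A).card = U.card - s := by rw [card_sdiff_of_subset hA.1, hA.2]
  rw [sum_powersetCard_eq_choose_mul_sliceMean f (by omega), hcard]

theorem choose_pred_mul (v s : ℕ) (hv : s < v) :
    (v : ℝ) * ((v - 1).choose s : ℝ) = ((v : ℝ) - s) * (v.choose s : ℝ) := by
  obtain ⟨w, rfl⟩ : ∃ w, v = w + 1 := ⟨v - 1, by omega⟩
  have h := Nat.add_one_mul_choose_eq w s
  have h2 := Nat.choose_succ_right_eq (w + 1) s
  have h3 : (w + 1) * w.choose s = (w + 1).choose s * (w + 1 - s) := h.trans h2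
  have h4 : (((w + 1 : ℕ) : ℝ)) * (w.choose s : ℝ) =
      ((w + 1).choose s : ℝ) * ((w + 1 - s : ℕ) : ℝ) := by exact_mod_cast h3
  rw [Nat.cast_sub hv.le] at h4
  rw [Nat.add_sub_cancel, h4]
  ring

theorem sum_sliceMean_erase (f : Finset ι → ℝ) {V : Finset ι} (hV : s < V.card) :
    ∑ x ∈ V, sliceMean f s (V.erase x) = V.card * sliceMean f s V := by
  have hpos : ((V.card - 1).choose s : ℝ) ≠ 0 := by
    exact_mod_cast (Nat.choose_pos (by omega)).ne'
  have h := sum_sum_powersetCard_erase V s fun _ S => f S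
  have hl : ∑ x ∈ V, ∑ S ∈ (V.erase x).powersetCard s, f S =
      ((V.card - 1).choose s : ℝ) * ∑ x ∈ V, sliceMean f s (V.erase x) := by
    rw [mul_sum]
    refine sum_congr rfl fun x hx => ?_
    have hc := card_erase_of_mem hx
    rw [sum_powersetCard_eq_choose_mul_sliceMean f (by omega), hc]
  have hr : ∑ S ∈ V.powersetCard s, ∑ _x ∈ V \ S, f S =
      ((V.card : ℝ) - s) * ∑ S ∈ V.powersetCard s, f S := by
    rw [mul_sum]
    refine sum_congr rfl fun S hS => ?_
    have hS := mem_powersetCard.1 hS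
    rw [sum_const, card_sdiff_of_subset hS.1, hS.2, nsmul_eq_mul, Nat.cast_sub hV.le]
  rw [hl, hr, sum_powersetCard_eq_choose_mul_sliceMean f hV.le, ← mul_assoc,
    ← choose_pred_mul _ _ hV] at h
  refine mul_left_cancel₀ hpos (h.trans ?_)
  ring

theorem abs_sliceMean_erase_sub_le (h0 : ∀ S, 0 ≤ f S) (h1 : ∀ S, f S ≤ 1) {V : Finset ι}
    (hV : s < V.card) {x : ι} (hx : x ∈ V) :
    |sliceMean f s (V.erase x) - sliceMean f s V| ≤ (s : ℝ) / V.card := by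
  have hc := card_erase_of_mem hx
  have hch := choose_pred_mul V.card s hV
  have hv : (0 : ℝ) < V.card := by exact_mod_cast (by omega : 0 < V.card)
  have hN : (0 : ℝ) < V.card.choose s := by exact_mod_cast Nat.choose_pos hV.le
  have hsub : (V.erase x).powersetCard s ⊆ V.powersetCard s :=
    powersetCard_mono (erase_subset _ _)
  have hsplit := sum_sdiff (f := f) hsub
  rw [sum_powersetCard_eq_choose_mul_sliceMean f hV.le,
    sum_powersetCard_eq_choose_mul_sliceMean f (V := V.erase x) (by omega), hc] at hsplit
  have hrest0 : 0 ≤ ∑ S ∈ V.powersetCard s \ (V.erase x).powersetCard s, f S :=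
    sum_nonneg fun S _ => h0 S
  have hrest1 : ∑ S ∈ V.powersetCard s \ (V.erase x).powersetCard s, f S ≤
      (V.card.choose s : ℝ) - ((V.card - 1).choose s : ℝ) := by
    refine (sum_le_sum fun S _ => h1 S).trans ?_
    have := card_sdiff_add_card_eq_card hsub
    rw [card_powersetCard, card_powersetCard, hc] at this
    rw [sum_const, nsmul_eq_mul, mul_one, ← this]
    push_cast
    linarith
  have hm0 : 0 ≤ sliceMean f s (V.erase x) := sliceMean_nonneg h0 _
  have hm1 : sliceMean f s (V.erase x) ≤ 1 := sliceMean_le_one h1 _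
  have hratio : ((V.card - 1).choose s : ℝ) = V.card.choose s * (1 - s / V.card) := by
    field_simp
    linarith
  rw [hratio] at hsplit hrest1
  have hs : 0 ≤ (s : ℝ) / V.card := by positivity
  rw [abs_le]
  constructor
  · refine le_of_mul_le_mul_left ?_ hN
    nlinarith [mul_nonneg hN.le (mul_nonneg hs hm0)]
  · refine le_of_mul_le_mul_left ?_ hN
    nlinarith [mul_nonneg hN.le (mul_nonneg hs (sub_nonneg.2 hm1))]

theorem sum_sq_sum_sdiff_eq {V : Finset ι} (hV : s < V.card) (hV2 : 2 ≤ V.card) (c : ι → ℝ)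
    (hc : ∑ x ∈ V, c x = 0) :
    ∑ S ∈ V.powersetCard s, (∑ x ∈ V \ S, c x) ^ 2 =
      ((V.card - 1).choose s : ℝ) * (s / ((V.card : ℝ) - 1)) * ∑ x ∈ V, c x ^ 2 := by
  have hexp : ∑ S ∈ V.powersetCard s, (∑ x ∈ V \ S, c x) ^ 2 =
      ∑ x ∈ V, ∑ S ∈ (V.erase x).powersetCard s, ∑ y ∈ V \ S, c x * c y := by
    rw [sum_sum_powersetCard_erase V s fun x S => ∑ y ∈ V \ S, c x * c y]
    refine sum_congr rfl fun S _ => ?_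
    rw [sq, sum_mul_sum]
  have hinner : ∀ x ∈ V, ∑ S ∈ (V.erase x).powersetCard s, ∑ y ∈ V \ S, c x * c y =
      (((V.card - 1).choose s : ℝ) - ((V.card - 2).choose s : ℝ)) * c x ^ 2 := by
    intro x hx
    have hcx := card_erase_of_mem hx
    have hS : ∀ S ∈ (V.erase x).powersetCard s, ∑ y ∈ V \ S, c x * c y =
        c x ^ 2 + ∑ y ∈ V.erase x \ S, c x * c y := by
      intro S hS
      have hxS : x ∉ S := (subset_erase.1 (mem_powersetCard.1 hS).1).2
      rw [erase_sdiff_comm, ← add_sum_erase (V \ S) _ (mem_sdiff.2 ⟨hx, hxS⟩), sq]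
    have hy : ∀ y ∈ V.erase x, ∑ S ∈ ((V.erase x).erase y).powersetCard s, c x * c y =
        ((V.card - 2).choose s : ℝ) * (c x * c y) := by
      intro y hy
      rw [sum_const, card_powersetCard, card_erase_of_mem hy, hcx, nsmul_eq_mul, Nat.sub_sub]
    rw [sum_congr rfl hS, sum_add_distrib,
      ← sum_sum_powersetCard_erase (V.erase x) s fun y _ => c x * c y, sum_congr rfl hy,
      ← mul_sum, ← mul_sum, sum_const, card_powersetCard, hcx, nsmul_eq_mul]
    have : ∑ y ∈ V.erase x, c y = - c x := by
      linarith [add_sum_erase V c hx]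
    rw [this]
    ring
  have hpred : ((V.card - 1).choose s : ℝ) - ((V.card - 2).choose s : ℝ) =
      ((V.card - 1).choose s : ℝ) * (s / ((V.card : ℝ) - 1)) := by
    have hv1 : (0 : ℝ) < (V.card : ℝ) - 1 := by
      have : (2 : ℝ) ≤ V.card := by exact_mod_cast hV2
      linarith
    rcases Nat.lt_or_ge s (V.card - 1) with h | h
    · have h2 := choose_pred_mul (V.card - 1) s h
      rw [Nat.sub_sub, Nat.cast_sub (by omega)] at h2
      push_cast at h2
      field_simp
      linarith
    · obtain rfl : s = V.card - 1 := by omega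
      rw [Nat.choose_eq_zero_of_lt (by omega : V.card - 2 < V.card - 1), Nat.choose_self,
        Nat.cast_sub (by omega)]
      push_cast
      field_simp
      simp
  rw [hexp, sum_congr rfl hinner, ← mul_sum, hpred]

theorem sum_sliceMean_erase_sub_sq_le (h0 : ∀ S, 0 ≤ f S) (h1 : ∀ S, f S ≤ 1) {V : Finset ι}
    (hV : s < V.card) (hV2 : 2 ≤ V.card) :
    ∑ x ∈ V, (sliceMean f s (V.erase x) - sliceMean f s V) ^ 2 ≤
      V.card * (s / (4 * ((V.card : ℝ) - 1) * ((V.card : ℝ) - s))) := by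
  set m := sliceMean f s V with hm
  set c : ι → ℝ := fun x => sliceMean f s (V.erase x) - m with hcdef
  set Q := ∑ x ∈ V, c x ^ 2 with hQ
  set N' : ℝ := ((V.card - 1).choose s : ℝ) with hN'
  have hN'pos : 0 < N' := by
    rw [hN']; exact_mod_cast Nat.choose_pos (by omega)
  have hv1 : (0 : ℝ) < (V.card : ℝ) - 1 := by
    have : (2 : ℝ) ≤ V.card := by exact_mod_cast hV2
    linarith
  have hvs : (0 : ℝ) < (V.card : ℝ) - s := by
    have : (s : ℝ) < V.card := by exact_mod_cast hV
    linarith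
  have hc : ∑ x ∈ V, c x = 0 := by
    simp only [hcdef]
    rw [sum_sub_distrib, sum_sliceMean_erase f hV, sum_const, nsmul_eq_mul, sub_self]
  have hL : ∑ S ∈ V.powersetCard s, ∑ x ∈ V \ S, c x = 0 := by
    rw [← sum_sum_powersetCard_erase V s fun x _ => c x]
    have : ∀ x ∈ V, ∑ _S ∈ (V.erase x).powersetCard s, c x = N' * c x := fun x hx => by
      rw [sum_const, card_powersetCard, card_erase_of_mem hx, nsmul_eq_mul]
    rw [sum_congr rfl this, ← mul_sum, hc, mul_zero]
  have hpair : ∑ S ∈ V.powersetCard s, (f S - m) * ∑ x ∈ V \ S, c x = N' * Q := by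
    have e1 : ∑ S ∈ V.powersetCard s, (f S - m) * ∑ x ∈ V \ S, c x =
        ∑ S ∈ V.powersetCard s, ∑ x ∈ V \ S, c x * f S := by
      simp_rw [sub_mul]
      rw [sum_sub_distrib, ← mul_sum, hL, mul_zero, sub_zero]
      refine sum_congr rfl fun S _ => ?_
      rw [mul_comm, sum_mul]
    have e2 : ∀ x ∈ V, ∑ S ∈ (V.erase x).powersetCard s, c x * f S =
        N' * (c x ^ 2 + m * c x) := fun x hx => by
      have hcx := card_erase_of_mem hx
      rw [← mul_sum, sum_powersetCard_eq_choose_mul_sliceMean f (by omega), hcx]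
      simp only [hcdef]
      ring
    rw [e1, ← sum_sum_powersetCard_erase V s fun x S => c x * f S, sum_congr rfl e2, ← mul_sum,
      sum_add_distrib, ← mul_sum, hc, mul_zero, add_zero]
  have hvar : ∑ S ∈ V.powersetCard s, (f S - m) ^ 2 ≤ (V.card.choose s : ℝ) * (1 / 4) := by
    have := sum_sub_mean_sq_le (V.powersetCard s) f m
      (by rw [card_powersetCard, sum_powersetCard_eq_choose_mul_sliceMean f hV.le]) h0 h1
    rwa [card_powersetCard] at this
  have hQ0 : 0 ≤ Q := sum_nonneg fun x _ => sq_nonneg _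
  have hcs := sum_mul_sq_le_sq_mul_sq (V.powersetCard s) (fun S => f S - m)
    fun S => ∑ x ∈ V \ S, c x
  rw [hpair, sum_sq_sum_sdiff_eq hV hV2 c hc] at hcs
  have hch : (V.card.choose s : ℝ) = V.card * N' / ((V.card : ℝ) - s) := by
    rw [eq_div_iff hvs.ne', hN', choose_pred_mul _ _ hV]
    ring
  have hfin : (N' * Q) ^ 2 ≤
      (V.card * N' / ((V.card : ℝ) - s) * (1 / 4)) * (N' * (s / ((V.card : ℝ) - 1)) * Q) := by
    rw [← hch]
    exact hcs.trans (mul_le_mul_of_nonneg_right hvar (by positivity))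
  have hfin2 : N' ^ 2 * (Q * Q) ≤
      N' ^ 2 * (V.card * (s / (4 * ((V.card : ℝ) - 1) * ((V.card : ℝ) - s))) * Q) := by
    convert hfin using 1
    · ring
    · field_simp
  have hfin3 := le_of_mul_le_mul_left hfin2 (by positivity)
  rcases hQ0.eq_or_lt with h | h
  · rw [← h]; positivity
  · exact le_of_mul_le_mul_right hfin3 h

/-! ### Exponential moments of slice means of random complements -/

theorem sum_exp_sliceMean_erase_le (h0 : ∀ S, 0 ≤ f S) (h1 : ∀ S, f S ≤ 1) (hs : 0 < s)
    {r : ℕ} (hr : 2 ≤ r) {y : ℝ} (hy : |y| ≤ 1) {V : Finset ι} (hV : r * s + 1 ≤ V.card) :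
    ∑ x ∈ V, Real.exp (y * (r * sliceMean f s (V.erase x))) ≤
      V.card * Real.exp (y * (r * sliceMean f s V) + y ^ 2 * (1 / (2 * s))) := by
  have hrs : 2 * s ≤ r * s := Nat.mul_le_mul_right s hr
  have hsV : s < V.card := by omega
  have hVr : (r : ℝ) * s + 1 ≤ V.card := by exact_mod_cast hV
  have hrR : (2 : ℝ) ≤ r := by exact_mod_cast hr
  have hsR : (0 : ℝ) < s := by exact_mod_cast hs
  have hvpos : (0 : ℝ) < V.card := by nlinarith
  refine sum_exp_le_card_mul_exp V (fun x => r * sliceMean f s (V.erase x)) _ _ y ?_ ?_ ?_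
  · rw [← mul_sum, sum_sliceMean_erase f hsV]
    ring
  · simp_rw [← mul_sub, mul_pow]
    rw [← mul_sum]
    refine (mul_le_mul_of_nonneg_left (sum_sliceMean_erase_sub_sq_le h0 h1 hsV (by omega))
      (by positivity)).trans ?_
    rw [mul_left_comm]
    refine mul_le_mul_of_nonneg_left ?_ hvpos.le
    have ha : (r : ℝ) * s ≤ (V.card : ℝ) - 1 := by linarith
    have hb : ((r : ℝ) - 1) * s ≤ (V.card : ℝ) - s := by linarith
    have hab := mul_le_mul ha hb (by nlinarith) (by nlinarith)
    have hpos : 0 < (V.card : ℝ) - 1 := by nlinarith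
    have hpos' : 0 < (V.card : ℝ) - s := by nlinarith
    rw [← mul_div_assoc, div_le_div_iff₀ (by positivity) (by positivity)]
    have : (r : ℝ) * (r * s ^ 2) ≤ r * ((2 * (r - 1)) * s ^ 2) := by
      gcongr
      linarith
    nlinarith
  · intro x hx
    have h := abs_sliceMean_erase_sub_le h0 h1 hsV hx
    rw [← mul_sub, abs_mul, abs_mul, Nat.abs_cast]
    have h2 : (r : ℝ) * |sliceMean f s (V.erase x) - sliceMean f s V| ≤ 1 := by
      refine (mul_le_mul_of_nonneg_left h (by positivity)).trans ?_
      rw [← mul_div_assoc, div_le_one hvpos]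
      linarith
    exact mul_le_one₀ hy (by positivity) h2

theorem sum_exp_sliceMean_sdiff_le (h0 : ∀ S, 0 ≤ f S) (h1 : ∀ S, f S ≤ 1) (hs : 0 < s)
    {r : ℕ} (hr : 2 ≤ r) {y : ℝ} (hy : |y| ≤ 1) (j : ℕ) :
    ∀ V : Finset ι, r * s + j ≤ V.card →
      ∑ A ∈ V.powersetCard j, Real.exp (y * (r * sliceMean f s (V \ A))) ≤
        (V.card.choose j : ℝ) *
          Real.exp (y * (r * sliceMean f s V) + j * (y ^ 2 * (1 / (2 * s)))) := by
  induction j with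
  | zero => intro V _; simp
  | succ j ih =>
    intro V hV
    set e := y ^ 2 * (1 / (2 * (s : ℝ))) with he
    have hj : (0 : ℝ) < (j : ℝ) + 1 := by positivity
    refine le_of_mul_le_mul_left ?_ hj
    rw [succ_mul_sum_powersetCard V j fun A => Real.exp (y * (r * sliceMean f s (V \ A)))]
    have hstep : ∀ x ∈ V, ∑ A ∈ (V.erase x).powersetCard j,
        Real.exp (y * (r * sliceMean f s (V \ insert x A))) ≤
          ((V.card - 1).choose j : ℝ) * Real.exp (j * e) *
            Real.exp (y * (r * sliceMean f s (V.erase x))) := by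
      intro x hx
      have hcx := card_erase_of_mem hx
      have h := ih (V.erase x) (by omega)
      rw [hcx, Real.exp_add] at h
      have hset : ∀ A, V \ insert x A = V.erase x \ A := fun A => by
        rw [sdiff_insert, erase_sdiff_comm]
      simp_rw [hset]
      linarith
    refine (sum_le_sum hstep).trans ?_
    rw [← mul_sum]
    refine (mul_le_mul_of_nonneg_left
      (sum_exp_sliceMean_erase_le h0 h1 hs hr hy (by omega)) (by positivity)).trans ?_
    have hch : (V.card : ℝ) * ((V.card - 1).choose j : ℝ) =
        ((j : ℝ) + 1) * (V.card.choose (j + 1) : ℝ) := by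
      obtain ⟨w, hw⟩ : ∃ w, V.card = w + 1 := ⟨V.card - 1, by omega⟩
      rw [hw, Nat.add_sub_cancel]
      have := Nat.add_one_mul_choose_eq w j
      rw [mul_comm ((j : ℝ) + 1)]
      exact_mod_cast this
    rw [← mul_assoc ((j : ℝ) + 1), ← hch, Real.exp_add, Real.exp_add, Nat.cast_succ, add_mul,
      one_mul, Real.exp_add]
    apply le_of_eq
    ring

theorem sum_exp_add_sliceMean_sdiff_le (h0 : ∀ S, 0 ≤ f S) (h1 : ∀ S, f S ≤ 1) (hs : 0 < s)
    {r : ℕ} {θ : ℝ} (hθ : |θ| ≤ 1 / 2) {U : Finset ι} (hU : s * (r + 1) ≤ U.card) :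
    ∑ A ∈ U.powersetCard s, Real.exp (θ * f A) * Real.exp (θ * (r * sliceMean f s (U \ A))) ≤
      (U.card.choose s : ℝ) * Real.exp (θ * ((r + 1) * sliceMean f s U) + 2 * θ ^ 2) := by
  have hsU : s ≤ U.card := by nlinarith
  have hy : |2 * θ| ≤ 1 := by rw [abs_mul, abs_two]; linarith
  have hbd : ∀ a b : ℝ, 0 ≤ a → a ≤ 1 → 0 ≤ b → b ≤ 1 → |2 * θ * (a - b)| ≤ 1 := by
    intro a b _ _ _ _
    rw [abs_mul]
    exact mul_le_one₀ hy (abs_nonneg _) (abs_le.2 ⟨by linarith, by linarith⟩)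
  have hm0 : ∀ V : Finset ι, 0 ≤ sliceMean f s V := sliceMean_nonneg h0
  have hm1 : ∀ V : Finset ι, sliceMean f s V ≤ 1 := sliceMean_le_one h1
  have hfirst : ∑ A ∈ U.powersetCard s, Real.exp (2 * θ * f A) ≤
      (U.card.choose s : ℝ) * Real.exp (2 * θ * sliceMean f s U + 2 * θ ^ 2) := by
    have hsum : ∑ A ∈ U.powersetCard s, f A = (U.powersetCard s).card * sliceMean f s U := by
      rw [card_powersetCard, sum_powersetCard_eq_choose_mul_sliceMean f hsU]
    have h := sum_exp_le_card_mul_exp (U.powersetCard s) f (sliceMean f s U) (1 / 4) (2 * θ) hsum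
      (sum_sub_mean_sq_le _ f _ hsum h0 h1) fun A _ => hbd _ _ (h0 A) (h1 A) (hm0 U) (hm1 U)
    rw [card_powersetCard] at h
    refine h.trans ?_
    refine mul_le_mul_of_nonneg_left (Real.exp_le_exp.2 ?_) (Nat.cast_nonneg _)
    nlinarith [sq_nonneg θ]
  have hsecond : ∑ A ∈ U.powersetCard s, Real.exp (2 * θ * (r * sliceMean f s (U \ A))) ≤
      (U.card.choose s : ℝ) * Real.exp (2 * θ * (r * sliceMean f s U) + 2 * θ ^ 2) := by
    rcases Nat.lt_or_ge r 2 with hr | hr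
    · interval_cases r
      · simp
        nlinarith [Real.one_le_exp (by positivity : 0 ≤ 2 * θ ^ 2),
          Nat.cast_nonneg (α := ℝ) (U.card.choose s)]
      · have hsum : ∑ A ∈ U.powersetCard s, sliceMean f s (U \ A) =
            (U.powersetCard s).card * sliceMean f s U := by
          rw [card_powersetCard, sum_sliceMean_sdiff f (by omega)]
        have h := sum_exp_le_card_mul_exp (U.powersetCard s) (fun A => sliceMean f s (U \ A))
          (sliceMean f s U) (1 / 4) (2 * θ) hsum
          (sum_sub_mean_sq_le _ _ _ hsum (fun A => hm0 _) fun A => hm1 _)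
          fun A _ => hbd _ _ (hm0 _) (hm1 _) (hm0 U) (hm1 U)
        rw [card_powersetCard] at h
        simp only [Nat.cast_one, one_mul]
        refine h.trans ?_
        refine mul_le_mul_of_nonneg_left (Real.exp_le_exp.2 ?_) (Nat.cast_nonneg _)
        nlinarith [sq_nonneg θ]
    · refine (sum_exp_sliceMean_sdiff_le h0 h1 hs hr hy s U (by nlinarith)).trans (le_of_eq ?_)
      have : (s : ℝ) ≠ 0 := by exact_mod_cast hs.ne'
      congr 3
      field_simp
  have hcs := sum_mul_sq_le_sq_mul_sq (U.powersetCard s) (fun A => Real.exp (θ * f A))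
    fun A => Real.exp (θ * (r * sliceMean f s (U \ A)))
  have hsq : ∀ z : ℝ, Real.exp (θ * z) ^ 2 = Real.exp (2 * θ * z) := fun z => by
    rw [← Real.exp_nat_mul]; congr 1; push_cast; ring
  simp_rw [hsq] at hcs
  refine le_of_sq_le_sq (hcs.trans ((mul_le_mul hfirst hsecond (by positivity)
    (by positivity)).trans (le_of_eq ?_))) (by positivity)
  rw [mul_pow, ← Real.exp_nat_mul, mul_mul_mul_comm, ← Real.exp_add, ← sq, Nat.cast_ofNat]
  ring_nf

/-! ### Random matchings -/

theorem sum_matchings_succ (s t : ℕ) (U : Finset ι) (F : (Fin (t + 1) → Finset ι) → ℝ) :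
    ∑ M ∈ matchings s (t + 1) U, F M =
      ∑ A ∈ U.powersetCard s, ∑ M ∈ matchings s t (U \ A), F (Fin.cons A M) := by
  rw [sum_sigma']
  refine sum_bij' (fun M _ => ⟨M 0, Fin.tail M⟩) (fun p _ => Fin.cons p.1 p.2) ?_ ?_ ?_ ?_ ?_
  · intro M hM
    simp only [matchings, mem_filter, Fintype.mem_piFinset, mem_powersetCard, mem_sigma,
      subset_sdiff] at hM ⊢
    exact ⟨hM.1 0, fun i => ⟨⟨(hM.1 i.succ).1, hM.2 _ _ (Fin.succ_ne_zero i)⟩, (hM.1 i.succ).2⟩,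
      fun i j hij => hM.2 _ _ fun h => hij (Fin.succ_injective _ h)⟩
  · rintro ⟨A, M⟩ h
    simp only [matchings, mem_filter, Fintype.mem_piFinset, mem_powersetCard, mem_sigma,
      subset_sdiff] at h ⊢
    refine ⟨fun i => ?_, fun i j => ?_⟩
    · cases i using Fin.cases with
      | zero => simpa using h.1
      | succ i => simpa using ⟨(h.2.1 i).1.1, (h.2.1 i).2⟩
    · cases i using Fin.cases with
      | zero =>
        cases j using Fin.cases with
        | zero => simp
        | succ j => intro _; simpa using (h.2.1 j).1.2.symm
      | succ i =>
        cases j using Fin.cases with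
        | zero => intro _; simpa using (h.2.1 i).1.2
        | succ j => intro hij; simpa using h.2.2 i j fun h' => hij (by rw [h'])
  · intro M _
    exact Fin.cons_self_tail M
  · rintro ⟨A, M⟩ _
    simp
  · intro M _
    simp

theorem card_matchings_succ {t : ℕ} {U : Finset ι} {c : ℕ}
    (hc : ∀ A ∈ U.powersetCard s, (matchings s t (U \ A)).card = c) :
    (matchings s (t + 1) U).card = U.card.choose s * c := by
  have h := sum_matchings_succ s t U fun _ => 1
  simp only [sum_const, nsmul_eq_mul, mul_one] at h
  rw [← Nat.cast_sum, sum_congr rfl hc, sum_const, card_powersetCard, smul_eq_mul] at h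
  exact_mod_cast h

theorem card_matchings (s t : ℕ) : ∀ u, ∃ c, ∀ U : Finset ι, U.card = u →
    (matchings s t U).card = c ∧ (s * t ≤ u → 0 < c) := by
  induction t with
  | zero =>
    refine fun u => ⟨1, fun U _ => ⟨?_, fun _ => one_pos⟩⟩
    simp [matchings]
  | succ t ih =>
    intro u
    obtain ⟨c, hc⟩ := ih (u - s)
    refine ⟨u.choose s * c, fun U hU => ?_⟩
    have hA : ∀ A ∈ U.powersetCard s, (U \ A).card = u - s := fun A hA => by
      rw [card_sdiff_of_subset (mem_powersetCard.1 hA).1, (mem_powersetCard.1 hA).2, hU]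
    refine ⟨by rw [card_matchings_succ fun A h => (hc _ (hA A h)).1, hU], fun hu => ?_⟩
    rw [Nat.mul_succ] at hu
    obtain ⟨A, hAU⟩ := powersetCard_nonempty.2 (by omega : s ≤ U.card)
    exact Nat.mul_pos (Nat.choose_pos (by omega)) ((hc _ (hA A hAU)).2 (by omega))

theorem card_matchings_pos {t : ℕ} {U : Finset ι} (hU : s * t ≤ U.card) :
    0 < (matchings s t U).card := by
  obtain ⟨c, hc⟩ := card_matchings (ι := ι) s t U.card
  rw [(hc U rfl).1]
  exact (hc U rfl).2 hU

theorem exists_card_matchings_sdiff (s t : ℕ) (U : Finset ι) :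
    ∃ c : ℕ, (∀ A ∈ U.powersetCard s, (matchings s t (U \ A)).card = c) ∧
      (matchings s (t + 1) U).card = U.card.choose s * c := by
  obtain ⟨c, hc⟩ := card_matchings (ι := ι) s t (U.card - s)
  have hA : ∀ A ∈ U.powersetCard s, (matchings s t (U \ A)).card = c := fun A hA =>
    (hc _ (by rw [card_sdiff_of_subset (mem_powersetCard.1 hA).1, (mem_powersetCard.1 hA).2])).1
  exact ⟨c, hA, card_matchings_succ hA⟩

theorem sum_matchings_sum_eq (f : Finset ι → ℝ) (s t : ℕ) :
    ∀ U : Finset ι, s * t ≤ U.card →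
      ∑ M ∈ matchings s t U, ∑ j, f (M j) =
        (matchings s t U).card * (t * sliceMean f s U) := by
  induction t with
  | zero => intro U _; simp
  | succ t ih =>
    intro U hU
    rw [Nat.mul_succ] at hU
    obtain ⟨c, hc, hcard⟩ := exists_card_matchings_sdiff s t U
    have hstep : ∀ A ∈ U.powersetCard s, ∑ M ∈ matchings s t (U \ A),
        ∑ j, f ((Fin.cons A M : Fin (t + 1) → Finset ι) j) =
          c * f A + c * (t * sliceMean f s (U \ A)) := by
      intro A hA
      have hdiff : (U \ A).card = U.card - s := by
        rw [card_sdiff_of_subset (mem_powersetCard.1 hA).1, (mem_powersetCard.1 hA).2]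
      simp only [Fin.sum_univ_succ, Fin.cons_zero, Fin.cons_succ]
      rw [sum_add_distrib, ih _ (by omega), hc A hA, sum_const, hc A hA, nsmul_eq_mul]
    rw [sum_matchings_succ, sum_congr rfl hstep, sum_add_distrib, ← mul_sum, ← mul_sum, ← mul_sum,
      hcard, sum_powersetCard_eq_choose_mul_sliceMean f (by omega)]
    have ht : (t : ℝ) * ∑ A ∈ U.powersetCard s, sliceMean f s (U \ A) =
        t * ((U.card.choose s : ℝ) * sliceMean f s U) := by
      rcases Nat.eq_zero_or_pos t with rfl | ht
      · simp
      · rw [sum_sliceMean_sdiff f (by nlinarith)]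
    rw [ht]
    push_cast
    ring

theorem sum_matchings_exp_le (h0 : ∀ S, 0 ≤ f S) (h1 : ∀ S, f S ≤ 1)
    (hs : 0 < s) {θ : ℝ} (hθ : |θ| ≤ 1 / 2) (t : ℕ) :
    ∀ U : Finset ι, s * t ≤ U.card →
      ∑ M ∈ matchings s t U, Real.exp (θ * ∑ j, f (M j)) ≤
        (matchings s t U).card * Real.exp (θ * (t * sliceMean f s U) + t * (2 * θ ^ 2)) := by
  induction t with
  | zero => intro U _; simp
  | succ t ih =>
    intro U hU
    obtain ⟨c, hc, hcard⟩ := exists_card_matchings_sdiff s t U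
    have hstep : ∀ A ∈ U.powersetCard s, ∑ M ∈ matchings s t (U \ A),
        Real.exp (θ * ∑ j, f ((Fin.cons A M : Fin (t + 1) → Finset ι) j)) ≤
          c * Real.exp (t * (2 * θ ^ 2)) *
            (Real.exp (θ * f A) * Real.exp (θ * (t * sliceMean f s (U \ A)))) := by
      intro A hA
      have hdiff : (U \ A).card = U.card - s := by
        rw [card_sdiff_of_subset (mem_powersetCard.1 hA).1, (mem_powersetCard.1 hA).2]
      simp only [Fin.sum_univ_succ, Fin.cons_zero, Fin.cons_succ, mul_add, Real.exp_add]
      rw [← mul_sum]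
      have h := ih (U \ A) (by rw [Nat.mul_succ] at hU; omega)
      rw [hc A hA, Real.exp_add] at h
      refine (mul_le_mul_of_nonneg_left h (Real.exp_pos _).le).trans (le_of_eq ?_)
      ring
    rw [sum_matchings_succ]
    refine (sum_le_sum hstep).trans ?_
    rw [← mul_sum]
    refine (mul_le_mul_of_nonneg_left (sum_exp_add_sliceMean_sdiff_le h0 h1 hs hθ hU)
      (by positivity)).trans (le_of_eq ?_)
    rw [hcard, Nat.cast_succ, add_mul _ _ (2 * θ ^ 2), one_mul, Real.exp_add, Real.exp_add,
      Real.exp_add]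
    push_cast
    ring

/-- The sum of a `[0, 1]`-valued function over a random matching is sub-Gaussian. -/
theorem card_filter_matchings_le {t : ℕ} {U : Finset ι} (h0 : ∀ S, 0 ≤ f S)
    (h1 : ∀ S, f S ≤ 1) (hs : 0 < s) (ht : 0 < t) (hst : s * t ≤ U.card) {β : ℝ} (hβ : 0 < β) :
    (((matchings s t U).filter fun M =>
        2 * β * Real.sqrt t ≤ |∑ j, f (M j) - sliceMean f s U * t|).card : ℝ) ≤
      2 * Real.exp (-β ^ 2 / 2) * (matchings s t U).card := by
  set Ω := matchings s t U
  set α := sliceMean f s U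
  set η : (Fin t → Finset ι) → ℝ := fun M => ∑ j, f (M j)
  have htR : (0 : ℝ) < t := by exact_mod_cast ht
  have hsqrt : 0 < Real.sqrt t := Real.sqrt_pos.2 htR
  have hsq : Real.sqrt t * Real.sqrt t = t := Real.mul_self_sqrt htR.le
  rcases lt_or_ge (t : ℝ) (2 * β * Real.sqrt t) with hlarge | hsmall
  · have hempty : (Ω.filter fun M => 2 * β * Real.sqrt t ≤ |η M - α * t|) = ∅ := by
      refine filter_eq_empty_iff.2 fun M _ => not_le.2 (lt_of_le_of_lt ?_ hlarge)
      have hηt : η M ≤ t := (sum_le_sum fun j _ => h1 (M j)).trans (by simp)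
      have hη0 : 0 ≤ η M := sum_nonneg fun j _ => h0 (M j)
      have hα0 : 0 ≤ α := sliceMean_nonneg h0 U
      have hα1 : α ≤ 1 := sliceMean_le_one h1 U
      rw [abs_le]
      constructor <;> nlinarith
    rw [hempty, card_empty, Nat.cast_zero]
    positivity
  set θ := β / (2 * Real.sqrt t) with hθ
  have hθ0 : 0 < θ := by positivity
  have hθle : θ ≤ 1 / 2 := by
    rw [hθ, div_le_iff₀ (by positivity)]
    nlinarith
  have hθβ : θ * (2 * β * Real.sqrt t) = β ^ 2 := by
    rw [hθ]; field_simp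
  have hθt : t * (2 * θ ^ 2) = β ^ 2 / 2 := by
    rw [hθ, div_pow, mul_pow, Real.sq_sqrt htR.le]; field_simp
  have htail : ∀ σ : ℝ, |σ| = 1 →
      ((Ω.filter fun M => β ^ 2 ≤ σ * θ * (η M - α * t)).card : ℝ) ≤
        Ω.card * Real.exp (-β ^ 2 / 2) := by
    intro σ hσ
    have hσ2 : (σ * θ) ^ 2 = θ ^ 2 := by rw [mul_pow, ← sq_abs σ, hσ]; ring
    have hmgf := sum_matchings_exp_le h0 h1 hs (θ := σ * θ)
      (by rw [abs_mul, hσ, one_mul, abs_of_pos hθ0]; exact hθle) t U hst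
    rw [hσ2, hθt, Real.exp_add] at hmgf
    rw [show -β ^ 2 / 2 = β ^ 2 / 2 - β ^ 2 by ring]
    refine card_filter_le_of_sum_exp_le Ω _ _ _ ?_
    simp_rw [mul_sub, sub_eq_add_neg, Real.exp_add]
    rw [← sum_mul]
    refine (mul_le_mul_of_nonneg_right hmgf (Real.exp_pos _).le).trans (le_of_eq ?_)
    rw [mul_assoc, mul_right_comm, ← Real.exp_add, mul_comm α, add_neg_cancel, Real.exp_zero,
      one_mul]
  have hsub : (Ω.filter fun M => 2 * β * Real.sqrt t ≤ |η M - α * t|) ⊆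
      (Ω.filter fun M => β ^ 2 ≤ 1 * θ * (η M - α * t)) ∪
        (Ω.filter fun M => β ^ 2 ≤ -1 * θ * (η M - α * t)) := by
    intro M hM
    rw [mem_filter] at hM
    rw [mem_union, mem_filter, mem_filter, ← hθβ]
    rcases le_abs.1 hM.2 with h | h
    · exact Or.inl ⟨hM.1, by nlinarith [mul_le_mul_of_nonneg_left h hθ0.le]⟩
    · exact Or.inr ⟨hM.1, by nlinarith [mul_le_mul_of_nonneg_left h hθ0.le]⟩
  have hcard : ((Ω.filter fun M => 2 * β * Real.sqrt t ≤ |η M - α * t|).card : ℝ) ≤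
      ((Ω.filter fun M => β ^ 2 ≤ 1 * θ * (η M - α * t)).card : ℝ) +
        ((Ω.filter fun M => β ^ 2 ≤ -1 * θ * (η M - α * t)).card : ℝ) := by
    exact_mod_cast (card_le_card hsub).trans (card_union_le _ _)
  linarith [htail 1 (by simp), htail (-1) (by simp)]

end Slice

/-- Concentration of intersections with a random matching (Frankl–Kupavskii).
A `t`-matching is modelled as an ordered tuple of `t` pairwise disjoint
`(k−1)`-subsets of `[n']`, chosen uniformly at random. If `G` is a family of
`(k−1)`-subsets of `[n']` of density `α` and `η(M)` is the number of sets of the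
matching `M` belonging to `G`, then `E[η] = αt` and
`Pr[|η − αt| ≥ 2β√t] ≤ 2 exp(−β²/2)` for every `β > 0`. -/
theorem matching_concentration (n' k t : ℕ) (hk : 2 ≤ k) (ht : 0 < t)
    (hn : (k - 1) * t ≤ n')
    (G : Finset (Finset ℕ)) (hG : G ⊆ (Finset.Icc 1 n').powersetCard (k - 1)) :
    letI Ω : Finset (Fin t → Finset ℕ) :=
      (Fintype.piFinset fun _ : Fin t => (Finset.Icc 1 n').powersetCard (k - 1)).filter
        fun M => ∀ i j : Fin t, i ≠ j → Disjoint (M i) (M j)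
    letI α : ℝ := (G.card : ℝ) / (n'.choose (k - 1) : ℝ)
    letI η : (Fin t → Finset ℕ) → ℕ := fun M => (Finset.univ.filter fun j => M j ∈ G).card
    ((∑ M ∈ Ω, (η M : ℝ)) / (Ω.card : ℝ) = α * t) ∧
    ∀ β : ℝ, 0 < β →
      ((Ω.filter fun M => 2 * β * Real.sqrt t ≤ |(η M : ℝ) - α * t|).card : ℝ) /
          (Ω.card : ℝ) ≤ 2 * Real.exp (-β ^ 2 / 2) := by
  set s := k - 1 with hs
  set U := Finset.Icc 1 n' with hU
  have hUcard : U.card = n' := by simp [hU]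
  have hst : s * t ≤ U.card := by rwa [hUcard]
  set f : Finset ℕ → ℝ := fun S => if S ∈ G then 1 else 0 with hf
  have h0 : ∀ S, 0 ≤ f S := fun S => by simp only [hf]; split_ifs <;> norm_num
  have h1 : ∀ S, f S ≤ 1 := fun S => by simp only [hf]; split_ifs <;> norm_num
  have hα : (G.card : ℝ) / (n'.choose s : ℝ) = sliceMean f s U := by
    have : ∑ S ∈ U.powersetCard s, f S = G.card := by
      simp only [hf]
      rw [sum_boole, filter_mem_eq_inter, inter_eq_right.2 hG]
    rw [sliceMean, this, hUcard]
  have hη : ∀ M : Fin t → Finset ℕ,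
      ((Finset.univ.filter fun j => M j ∈ G).card : ℝ) = ∑ j, f (M j) := fun M => by
    simp only [hf]
    rw [sum_boole]
  have hpos : (0 : ℝ) < (matchings s t U).card := by exact_mod_cast card_matchings_pos hst
  rw [hα]
  simp only [hη]
  refine ⟨(div_eq_iff hpos.ne').2 ?_, fun β hβ => (div_le_iff₀ hpos).2 ?_⟩
  · refine (sum_matchings_sum_eq f s t U hst).trans ?_
    ring
  · exact card_filter_matchings_le h0 h1 (by omega) ht hst hβ
end

section
/- Let k ≥ 1 and s ≥ 2·10^6 be integers, set n = ⌈3e(s+1)k⌉ (where e is Euler's number), t = ⌊(n−s−1)/k⌋, and γ = 10·√(t·ln s). Let α_1 ≥ α_2 ≥ … ≥ α_{s+1} be real numbers in [0,1] satisfying (t+1)·t·α_{s+1} + Σ_{j=1}^{s} t·α_j ≥ s·t. Then t·α_{⌈(s+1)/3⌉} ≥ s+1+γ or t·α_{s+1} ≥ (s+1)/3 + γ. -/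
open Finset

theorem seven_mul_le_div_and_div_le_nine_mul (k s n : ℕ) (hk : 1 ≤ k)
    (hn : n = ⌈(3 : ℝ) * Real.exp 1 * (s + 1) * k⌉₊) :
    7 * (s + 1) ≤ (n - s - 1) / k ∧ (n - s - 1) / k ≤ 9 * (s + 1) := by
  have he := Real.exp_one_gt_d9
  have he' := Real.exp_one_lt_d9
  have hp : (0 : ℝ) ≤ ((s : ℝ) + 1) * k := by positivity
  have hlow : 8 * ((s + 1) * k) ≤ n := by
    have h : (3 : ℝ) * Real.exp 1 * (s + 1) * k ≤ n := hn ▸ Nat.le_ceil _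
    have h' : (8 : ℝ) * ((s + 1) * k) ≤ n := by nlinarith
    exact_mod_cast h'
  have hupp : n ≤ 9 * ((s + 1) * k) := by
    rw [hn, Nat.ceil_le]
    push_cast
    nlinarith
  have hsk : s + 1 ≤ (s + 1) * k := Nat.le_mul_of_pos_right _ hk
  constructor
  · rw [Nat.le_div_iff_mul_le hk, mul_assoc]
    omega
  · apply Nat.div_le_of_le_mul
    rw [show k * (9 * (s + 1)) = 9 * ((s + 1) * k) by ring]
    omega

theorem log_le_mul_succ_of_two_million_le (s : ℝ) (hs : 2 * 10 ^ 6 ≤ s) :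
    Real.log s ≤ (s + 1) / 40000 := by
  have h1 : Real.log (s / 2 ^ 16) ≤ s / 2 ^ 16 - 1 :=
    Real.log_le_sub_one_of_pos (by positivity)
  rw [Real.log_div (by positivity) (by positivity), Real.log_pow] at h1
  have h2 := Real.log_two_lt_d9
  norm_num at h1 hs ⊢
  linarith

/-- A sum of values at most `T`, of which those with index at least `m` are at most `B`. -/
theorem sum_Icc_le_of_le_of_tail_le (f : ℕ → ℝ) (s m : ℕ) (hm : 1 ≤ m) (hms : m ≤ s)
    (T B : ℝ) (hT : ∀ j ∈ Icc 1 s, f j ≤ T) (hB : ∀ j ∈ Icc m s, f j ≤ B) :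
    ∑ j ∈ Icc 1 s, f j ≤ ((m : ℝ) - 1) * (T - B) + s * B := by
  calc ∑ j ∈ Icc 1 s, f j ≤ ∑ j ∈ Icc 1 s, ((if j < m then T - B else 0) + B) := by
        refine sum_le_sum fun j hj => ?_
        split_ifs with h
        · linarith [hT j hj]
        · linarith [hB j (mem_Icc.2 ⟨not_lt.1 h, (mem_Icc.1 hj).2⟩)]
    _ = ((m : ℝ) - 1) * (T - B) + s * B := by
        have hf : (Icc 1 s).filter (· < m) = Ico 1 m := by
          ext j
          simp only [mem_filter, mem_Icc, mem_Ico]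
          omega
        rw [sum_add_distrib, ← sum_filter, hf]
        simp [Nat.cast_sub hm, mul_sub]

/-- Lemma 5 (i): with `n = ⌈3e(s+1)k⌉`, `t = ⌊(n−s−1)/k⌋`, `γ = 10√(t ln s)`, a
nonincreasing sequence `α_1 ≥ … ≥ α_{s+1}` of reals in `[0,1]` satisfying
`(t+1)tα_{s+1} + Σ_{j=1}^s tα_j ≥ st` must satisfy `tα_{⌈(s+1)/3⌉} ≥ s+1+γ` or
`tα_{s+1} ≥ (s+1)/3 + γ`. -/
theorem density_dichotomy (k s n t : ℕ) (hk : 1 ≤ k) (hs : 2 * 10 ^ 6 ≤ s)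
    (hn : n = ⌈(3 : ℝ) * Real.exp 1 * (s + 1) * k⌉₊)
    (ht : t = (n - s - 1) / k)
    (γ : ℝ) (hγ : γ = 10 * Real.sqrt (t * Real.log s))
    (α : ℕ → ℝ)
    (hmono : ∀ i j : ℕ, 1 ≤ i → i ≤ j → j ≤ s + 1 → α j ≤ α i)
    (hrange : ∀ i ∈ Finset.Icc 1 (s + 1), α i ∈ Set.Icc (0 : ℝ) 1)
    (hineq : (s : ℝ) * t ≤ ((t : ℝ) + 1) * t * α (s + 1) +
      ∑ j ∈ Finset.Icc 1 s, (t : ℝ) * α j) :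
    (s + 1 + γ ≤ (t : ℝ) * α ⌈((s : ℝ) + 1) / 3⌉₊) ∨
    (((s : ℝ) + 1) / 3 + γ ≤ (t : ℝ) * α (s + 1)) := by
  obtain ⟨h7, h9⟩ := seven_mul_le_div_and_div_le_nine_mul k s n hk hn
  rw [← ht] at h7 h9
  have hsR : (2 * 10 ^ 6 : ℝ) ≤ s := by exact_mod_cast hs
  have ht7 : 7 * ((s : ℝ) + 1) ≤ t := by exact_mod_cast h7
  have ht9 : (t : ℝ) ≤ 9 * (s + 1) := by exact_mod_cast h9
  have hlog := log_le_mul_succ_of_two_million_le s hsR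
  have hγ0 : 0 ≤ γ := hγ ▸ by positivity
  have hγS : γ ≤ 0.15 * (s + 1) := by
    have hsq : Real.sqrt (t * Real.log s) ≤ 0.015 * (s + 1) := by
      refine Real.sqrt_le_iff.2 ⟨by positivity, ?_⟩
      calc (t : ℝ) * Real.log s ≤ 9 * (s + 1) * ((s + 1) / 40000) := by gcongr
        _ = (0.015 * ((s : ℝ) + 1)) ^ 2 := by ring
    linarith
  by_contra! hcon
  obtain ⟨hmid, hlast⟩ := hcon
  set m := ⌈((s : ℝ) + 1) / 3⌉₊
  have hm1 : 1 ≤ m := Nat.one_le_ceil_iff.2 (by positivity)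
  have hmlt : (m : ℝ) < ((s : ℝ) + 1) / 3 + 1 := Nat.ceil_lt_add_one (by positivity)
  have hms : m ≤ s := by
    have : (m : ℝ) ≤ s := by linarith
    exact_mod_cast this
  have hsum := sum_Icc_le_of_le_of_tail_le (fun j => (t : ℝ) * α j) s m hm1 hms t (s + 1 + γ)
    (fun j hj => by
      have hj' := mem_Icc.1 hj
      exact mul_le_of_le_one_right (by positivity)
        (hrange j (mem_Icc.2 ⟨hj'.1, by omega⟩)).2)
    (fun j hj => by
      have hj' := mem_Icc.1 hj
      exact (mul_le_mul_of_nonneg_left (hmono m j hm1 hj'.1 (by omega)) (by positivity)).trans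
        hmid.le)
  have hhead : ((m : ℝ) - 1) * (t - (s + 1 + γ)) ≤ ((s : ℝ) + 1) / 3 * (t - (s + 1 + γ)) :=
    mul_le_mul_of_nonneg_right (by linarith) (by linarith)
  have hend : ((t : ℝ) + 1) * t * α (s + 1) ≤ (t + 1) * (((s : ℝ) + 1) / 3 + γ) := by
    rw [mul_assoc]
    exact mul_le_mul_of_nonneg_left hlast.le (by positivity)
  have hγt : (t : ℝ) * γ ≤ t * (0.15 * (s + 1)) := by gcongr
  have hγs : (s : ℝ) * γ ≤ s * (0.15 * (s + 1)) := by gcongr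
  have hts : 7 * ((s : ℝ) + 1) * (s + 1) ≤ t * (s + 1) := by gcongr
  have hss : (2 * 10 ^ 6 : ℝ) * s ≤ s * s := by gcongr
  nlinarith [mul_nonneg hγ0 (by positivity : (0 : ℝ) ≤ s)]
end

section
/- Let k ≥ 1 and s ≥ 2·10^6 be integers, set n = ⌈3e(s+1)k⌉ (where e is Euler's number), t = ⌊(n−s−1)/k⌋, and γ = 10·√(t·ln s). Let α_1 ≥ α_2 ≥ … ≥ α_{s+1} be real numbers in [0,1] satisfying (3s+3)·t·α_{s+1} + Σ_{j=1}^{s} t·α_j ≥ s·t. Then for every integer j with (s+1)/6 ≤ j ≤ s, one has t·α_{s+1−j} ≥ j + 1 + γ. -/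
open Finset

lemma log_le_small_mul {x : ℝ} (hx : 2 * 10 ^ 6 ≤ x) :
    Real.log x ≤ 16 / 10 ^ 6 * x := by
  have hx0 : 0 < x := by linarith
  have h₁ : Real.log x = Real.log (x / 2 ^ 20) + 20 * Real.log 2 := by
    rw [Real.log_div hx0.ne' (by positivity), Real.log_pow]
    push_cast
    ring
  have h₂ : Real.log (x / 2 ^ 20) ≤ x / 2 ^ 20 - 1 := Real.log_le_sub_one_of_pos (by positivity)
  have h₃ := Real.log_two_lt_d9
  linarith

lemma ten_sqrt_mul_log_le {s t : ℝ} (hs : 2 * 10 ^ 6 ≤ s) (ht : t ≤ 9 * (s + 1)) :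
    10 * √(t * Real.log s) ≤ 12 / 100 * (s + 1) := by
  have hlog := log_le_small_mul hs
  have hlog0 : 0 ≤ Real.log s := Real.log_nonneg (by linarith)
  have h : √(t * Real.log s) ≤ 12 / 1000 * (s + 1) := by
    apply Real.sqrt_le_iff.mpr
    refine ⟨by linarith, ?_⟩
    calc t * Real.log s ≤ 9 * (s + 1) * (16 / 10 ^ 6 * (s + 1)) := by
          apply mul_le_mul ht (by linarith) hlog0 (by linarith)
      _ = (12 / 1000 * (s + 1)) ^ 2 := by ring
  linarith

lemma ceil_sub_div_bounds {k s : ℕ} (hk : 1 ≤ k) (hs : 2 * 10 ^ 6 ≤ s) :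
    7 * ((s : ℝ) + 1) ≤ ((⌈(3 : ℝ) * Real.exp 1 * (s + 1) * k⌉₊ - s - 1) / k : ℕ) ∧
      (((⌈(3 : ℝ) * Real.exp 1 * (s + 1) * k⌉₊ - s - 1) / k : ℕ) : ℝ) ≤ 9 * (s + 1) := by
  set n := ⌈(3 : ℝ) * Real.exp 1 * (s + 1) * k⌉₊ with hn
  set t := (n - s - 1) / k with ht
  have hkR : (1 : ℝ) ≤ k := by exact_mod_cast hk
  have hsR : (2 * 10 ^ 6 : ℝ) ≤ s := by exact_mod_cast hs
  have hmk : (s : ℝ) + 1 ≤ (s + 1) * k := le_mul_of_one_le_right (by linarith) hkR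
  have hkm : 100 * (k : ℝ) ≤ (s + 1) * k := by gcongr; linarith
  have he₁ := Real.exp_one_gt_d9
  have he₂ := Real.exp_one_lt_d9
  have hn₁ : 8.15 * (((s : ℝ) + 1) * k) ≤ n := by
    refine le_trans ?_ (Nat.le_ceil _)
    rw [mul_assoc (3 * Real.exp 1)]
    gcongr
    linarith
  have hn₂ : (n : ℝ) ≤ 8.16 * (((s : ℝ) + 1) * k) + 1 := by
    refine (Nat.ceil_lt_add_one (by positivity)).le.trans ?_
    rw [mul_assoc (3 * Real.exp 1)]
    gcongr
    linarith
  have hdiv₁ : (n : ℝ) ≤ t * k + k + s + 1 := by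
    have h := Nat.lt_div_mul_add (a := n - s - 1) (b := k) hk
    rw [← ht] at h
    have : n ≤ t * k + k + s + 1 := by omega
    exact_mod_cast this
  have hdiv₂ : (t : ℝ) * k ≤ n := by
    have h := Nat.div_mul_le_self (n - s - 1) k
    rw [← ht] at h
    have : t * k ≤ n := by omega
    exact_mod_cast this
  constructor
  · refine le_of_mul_le_mul_right ?_ (by linarith : (0 : ℝ) < k)
    linarith
  · refine le_of_mul_le_mul_right ?_ (by linarith : (0 : ℝ) < k)
    linarith

lemma sum_Icc_le_of_antitone {s j : ℕ} (hj : j ≤ s) {α : ℕ → ℝ}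
    (hmono : ∀ i j : ℕ, 1 ≤ i → i ≤ j → j ≤ s + 1 → α j ≤ α i)
    (hone : ∀ i ∈ Icc 1 (s + 1), α i ≤ 1) :
    ∑ i ∈ Icc 1 s, α i ≤ (s - j) + j * α (s + 1 - j) := by
  have hsplit : ∑ i ∈ Ico 1 (s + 1 - j), α i + ∑ i ∈ Ico (s + 1 - j) (s + 1), α i =
      ∑ i ∈ Icc 1 s, α i := by
    rw [sum_Ico_consecutive _ (by omega) (by omega)]
    congr 1
  have hhead : ∑ i ∈ Ico 1 (s + 1 - j), α i ≤ (s : ℝ) - j := by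
    calc ∑ i ∈ Ico 1 (s + 1 - j), α i ≤ #(Ico 1 (s + 1 - j)) • (1 : ℝ) := by
          refine sum_le_card_nsmul _ _ _ fun i hi ↦ hone i ?_
          simp only [mem_Ico, mem_Icc] at hi ⊢
          omega
      _ = (s : ℝ) - j := by
          rw [Nat.card_Ico, show s + 1 - j - 1 = s - j by omega, nsmul_one, Nat.cast_sub hj]
  have htail : ∑ i ∈ Ico (s + 1 - j) (s + 1), α i ≤ j * α (s + 1 - j) := by
    calc ∑ i ∈ Ico (s + 1 - j) (s + 1), α i
        ≤ #(Ico (s + 1 - j) (s + 1)) • α (s + 1 - j) := by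
          refine sum_le_card_nsmul _ _ _ fun i hi ↦ ?_
          simp only [mem_Ico] at hi
          exact hmono _ _ (by omega) hi.1 (by omega)
      _ = j * α (s + 1 - j) := by
          rw [Nat.card_Ico, show s + 1 - (s + 1 - j) = j by omega, nsmul_eq_mul]
  linarith

/-- Lemma 5 (ii): with `n = ⌈3e(s+1)k⌉`, `t = ⌊(n−s−1)/k⌋`, `γ = 10√(t ln s)`, a
nonincreasing sequence `α_1 ≥ … ≥ α_{s+1}` of reals in `[0,1]` satisfying
`(3s+3)tα_{s+1} + Σ_{j=1}^s tα_j ≥ st` must satisfy `tα_{s+1−j} ≥ j+1+γ` for every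
integer `j` with `(s+1)/6 ≤ j ≤ s`. -/
theorem density_lower_bound (k s n t : ℕ) (hk : 1 ≤ k) (hs : 2 * 10 ^ 6 ≤ s)
    (hn : n = ⌈(3 : ℝ) * Real.exp 1 * (s + 1) * k⌉₊)
    (ht : t = (n - s - 1) / k)
    (γ : ℝ) (hγ : γ = 10 * Real.sqrt (t * Real.log s))
    (α : ℕ → ℝ)
    (hmono : ∀ i j : ℕ, 1 ≤ i → i ≤ j → j ≤ s + 1 → α j ≤ α i)
    (hrange : ∀ i ∈ Finset.Icc 1 (s + 1), α i ∈ Set.Icc (0 : ℝ) 1)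
    (hineq : (s : ℝ) * t ≤ (3 * (s : ℝ) + 3) * t * α (s + 1) +
      ∑ j ∈ Finset.Icc 1 s, (t : ℝ) * α j) :
    ∀ j : ℕ, ((s : ℝ) + 1) / 6 ≤ j → j ≤ s →
      (j : ℝ) + 1 + γ ≤ (t : ℝ) * α (s + 1 - j) := by
  intro j hj₁ hj₂
  have hsR : (2 * 10 ^ 6 : ℝ) ≤ s := by exact_mod_cast hs
  have hjs : (j : ℝ) ≤ s := by exact_mod_cast hj₂
  obtain ⟨ht₁, ht₂⟩ := ceil_sub_div_bounds hk hs
  rw [← hn, ← ht] at ht₁ ht₂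
  have hγ' : γ ≤ 12 / 100 * ((s : ℝ) + 1) := hγ ▸ ten_sqrt_mul_log_le hsR ht₂
  have hsum := sum_Icc_le_of_antitone hj₂ hmono fun i hi ↦ (hrange i hi).2
  have hlast : α (s + 1) ≤ α (s + 1 - j) := hmono _ _ (by omega) (by omega) le_rfl
  have ht0 : (0 : ℝ) < t := by linarith
  rw [← mul_sum] at hineq
  set a := α (s + 1 - j)
  have ha : (j : ℝ) ≤ (3 * (s + 1) + j) * a := by
    have h : (s : ℝ) ≤ (3 * s + 3) * α (s + 1) + ∑ i ∈ Icc 1 s, α i := by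
      refine le_of_mul_le_mul_left ?_ ht0
      linarith
    have h' : (3 * (s : ℝ) + 3) * α (s + 1) ≤ (3 * s + 3) * a := by gcongr
    linarith
  have hta : 7 * ((s : ℝ) + 1) * j ≤ (3 * (s + 1) + j) * (t * a) := by
    calc 7 * ((s : ℝ) + 1) * j ≤ t * ((3 * (s + 1) + j) * a) := by gcongr
      _ = (3 * (s + 1) + j) * (t * a) := by ring
  refine le_of_mul_le_mul_left (le_trans ?_ hta) (by positivity : (0 : ℝ) < 3 * (s + 1) + j)
  calc (3 * ((s : ℝ) + 1) + j) * (j + 1 + γ)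
      ≤ (3 * ((s : ℝ) + 1) + j) * (j + 13 / 100 * (s + 1)) :=
        mul_le_mul_of_nonneg_left (by linarith) (by positivity)
    _ ≤ 7 * ((s : ℝ) + 1) * j := by
        nlinarith [mul_nonneg (sub_nonneg.2 hj₁) (by linarith : (0 : ℝ) ≤ s + 1 - j)]
end

section
/- Fix positive integers n, k, b with b ≤ k, and integers α_b < α_{b+1} < … < α_k with α_i ≥ i for each i ∈ {b,…,k} and α_k ≤ n. Let F be a family of k-element subsets of [n] such that for every F ∈ F there exists i ∈ {b,…,k} with |F ∩ [α_i]| ≥ i. Then |∂^b F| ≥ (min_{i∈{b,…,k}} C(α_i, i−b)/C(α_i, i)) · |F|, where ∂^b F is the b-shadow of F, i.e., the collection of all (k−b)-element subsets of [n] contained in at least one member of F. -/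
open Finset

/-- Local LYM inequality relative to a window `U`: if every member of `S` meets `U` in `i`
elements, and `G` contains all sets obtained by deleting `b` elements of the window from a member
of `S`, then `|S| C(i, b) ≤ |G| C(|U| - (i - b), b)`. -/
theorem card_mul_choose_le_of_window {β : Type*} [DecidableEq β] (U : Finset β) (i b : ℕ)
    (S G : Finset (Finset β)) (hS : ∀ A ∈ S, (A ∩ U).card = i)
    (hG : ∀ B ∈ G, (B ∩ U).card = i - b)
    (h : ∀ A ∈ S, ∀ C ∈ (A ∩ U).powersetCard b, A \ C ∈ G) :
    S.card * i.choose b ≤ G.card * (U.card - (i - b)).choose b := by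
  classical
  refine card_mul_le_card_mul (fun A B => ∃ C ∈ (A ∩ U).powersetCard b, A \ C = B) ?_ ?_
  · intro A hA
    rw [← hS A hA, ← card_powersetCard]
    refine card_le_card_of_injOn (fun C => A \ C) ?_ ?_
    · intro C hC
      exact mem_coe.2 (mem_filter.2 ⟨h A hA C hC, C, hC, rfl⟩)
    · intro C hC D hD hCD
      have hC' := (mem_powersetCard.1 (mem_coe.1 hC)).1.trans inter_subset_left
      have hD' := (mem_powersetCard.1 (mem_coe.1 hD)).1.trans inter_subset_left
      rw [← Finset.sdiff_sdiff_eq_self hC', ← Finset.sdiff_sdiff_eq_self hD']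
      exact congrArg (A \ ·) hCD
  · intro B hB
    have hcard : (U \ B).card = U.card - (i - b) := by
      rw [card_sdiff, hG B hB]
    rw [← hcard, ← card_powersetCard]
    refine (card_le_card ?_).trans (card_image_le (f := fun C => B ∪ C))
    intro A hA
    obtain ⟨-, C, hC, rfl⟩ := mem_filter.1 hA
    obtain ⟨hCs, hCb⟩ := mem_powersetCard.1 hC
    refine mem_image.2 ⟨C, mem_powersetCard.2 ⟨?_, hCb⟩, ?_⟩
    · intro x hx
      have := mem_inter.1 (hCs hx)
      simp [this.2, hx]
    · exact sdiff_union_of_subset (hCs.trans inter_subset_left)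

/-- The binomial ratio form of `card_mul_choose_le_of_window`. -/
theorem choose_div_choose_mul_card_le_of_window {β : Type*} [DecidableEq β] (U : Finset β)
    (i b : ℕ) (hbi : b ≤ i) (hiU : i ≤ U.card)
    (S G : Finset (Finset β)) (hS : ∀ A ∈ S, (A ∩ U).card = i)
    (hG : ∀ B ∈ G, (B ∩ U).card = i - b)
    (h : ∀ A ∈ S, ∀ C ∈ (A ∩ U).powersetCard b, A \ C ∈ G) :
    (U.card.choose (i - b) : ℝ) / (U.card.choose i : ℝ) * S.card ≤ G.card := by
  have hcount := card_mul_choose_le_of_window U i b S G hS hG h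
  have hmul := Nat.choose_mul (n := U.card) (Nat.sub_le i b)
  rw [Nat.choose_symm hbi, Nat.sub_sub_self hbi] at hmul
  have hpos : 0 < U.card.choose i := Nat.choose_pos hiU
  have hpos' : 0 < i.choose b := Nat.choose_pos hbi
  have key : U.card.choose (i - b) * S.card ≤ G.card * U.card.choose i := by
    refine Nat.le_of_mul_le_mul_right ?_ hpos'
    calc U.card.choose (i - b) * S.card * i.choose b
        = U.card.choose (i - b) * (S.card * i.choose b) := by ring
      _ ≤ U.card.choose (i - b) * (G.card * (U.card - (i - b)).choose b) := by gcongr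
      _ = G.card * (U.card.choose (i - b) * (U.card - (i - b)).choose b) := by ring
      _ = G.card * U.card.choose i * i.choose b := by rw [← hmul]; ring
  rw [div_mul_eq_mul_div, div_le_iff₀ (by exact_mod_cast hpos)]
  exact_mod_cast key

/-- If `A` has `k` elements and meets some window `[α i]` in at least `i` elements, then the largest
such `i` is attained with equality. -/
theorem exists_last_window {k b : ℕ} {α : ℕ → ℕ}
    (hmono : ∀ i j : ℕ, b ≤ i → i < j → j ≤ k → α i < α j) {A : Finset ℕ} (hA : A.card = k)
    (h : ∃ i ∈ Icc b k, i ≤ (A ∩ Icc 1 (α i)).card) :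
    ∃ i ∈ Icc b k, (A ∩ Icc 1 (α i)).card = i ∧
      ∀ j ∈ Ioc i k, (A ∩ Icc 1 (α j)).card < j := by
  obtain ⟨i₀, hi₀, hle₀⟩ := h
  obtain ⟨i, hi, hmax⟩ := exists_max_image
    ((Icc b k).filter fun i => i ≤ (A ∩ Icc 1 (α i)).card) id ⟨i₀, mem_filter.2 ⟨hi₀, hle₀⟩⟩
  obtain ⟨hik, hle⟩ := mem_filter.1 hi
  have hlast : ∀ j ∈ Ioc i k, (A ∩ Icc 1 (α j)).card < j := by
    intro j hj
    by_contra! hcon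
    rw [mem_Icc] at hik
    rw [mem_Ioc] at hj
    have := hmax j (mem_filter.2 ⟨mem_Icc.2 ⟨by omega, hj.2⟩, hcon⟩)
    simp only [id] at this
    omega
  refine ⟨i, hik, le_antisymm ?_ hle, hlast⟩
  rw [mem_Icc] at hik
  rcases hik.2.eq_or_lt with rfl | hlt
  · exact (card_le_card inter_subset_left).trans hA.le
  · have hnext := hlast (i + 1) (mem_Ioc.2 ⟨by omega, hlt⟩)
    have hα := hmono i (i + 1) hik.1 (by omega) hlt
    have hsub : (A ∩ Icc 1 (α i)).card ≤ (A ∩ Icc 1 (α (i + 1))).card :=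
      card_le_card (inter_subset_inter_left (Icc_subset_Icc_right hα.le))
    omega

/-- Frankl's shadow theorem: if `α_b < α_{b+1} < … < α_k` (with `α_i ≥ i`, `α_k ≤ n`)
and every `F` in a family `F` of `k`-subsets of `[n]` satisfies `|F ∩ [α_i]| ≥ i` for
some `i ∈ [b,k]`, then the `b`-shadow satisfies
`|∂ᵇF| ≥ (min_{i ∈ [b,k]} C(α_i, i−b)/C(α_i, i)) |F|`. -/
theorem frankl_shadow_theorem (n k b : ℕ) (hn : 0 < n) (hk : 0 < k) (hb : 0 < b)
    (hbk : b ≤ k)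
    (α : ℕ → ℕ)
    (hmono : ∀ i j : ℕ, b ≤ i → i < j → j ≤ k → α i < α j)
    (hαi : ∀ i ∈ Finset.Icc b k, i ≤ α i)
    (hαk : α k ≤ n)
    (F : Finset (Finset ℕ)) (hF : F ⊆ (Finset.Icc 1 n).powersetCard k)
    (hcond : ∀ A ∈ F, ∃ i ∈ Finset.Icc b k, i ≤ (A ∩ Finset.Icc 1 (α i)).card) :
    ((Finset.Icc b k).inf' (Finset.nonempty_Icc.mpr hbk)
        (fun i => ((α i).choose (i - b) : ℝ) / ((α i).choose i : ℝ))) * F.card ≤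
      ((((Finset.Icc 1 n).powersetCard (k - b)).filter fun B => ∃ A ∈ F, B ⊆ A).card : ℝ) := by
  classical
  set m := (Icc b k).inf' (nonempty_Icc.mpr hbk)
    (fun i => ((α i).choose (i - b) : ℝ) / ((α i).choose i : ℝ))
  set shadow := ((Icc 1 n).powersetCard (k - b)).filter fun B => ∃ A ∈ F, B ⊆ A
  let S : ℕ → Finset (Finset ℕ) := fun i => F.filter fun A =>
    (A ∩ Icc 1 (α i)).card = i ∧ ∀ j ∈ Ioc i k, (A ∩ Icc 1 (α j)).card < j
  let G : ℕ → Finset (Finset ℕ) := fun i => shadow.filter fun B =>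
    (B ∩ Icc 1 (α i)).card = i - b ∧ ∀ j ∈ Ioc i k, (B ∩ Icc 1 (α j)).card < j - b
  have hcover : F ⊆ (Icc b k).biUnion S := by
    intro A hA
    obtain ⟨i, hi, hlast⟩ :=
      exists_last_window hmono (mem_powersetCard.1 (hF hA)).2 (hcond A hA)
    exact mem_biUnion.2 ⟨i, hi, mem_filter.2 ⟨hA, hlast⟩⟩
  have hdisj : ((Icc b k : Finset ℕ) : Set ℕ).PairwiseDisjoint G := by
    have hlt : ∀ i j, i < j → j ≤ k → Disjoint (G i) (G j) := by
      intro i j hij hjk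
      refine disjoint_left.2 fun B hBi hBj => ?_
      have h₁ := (mem_filter.1 hBi).2.2 j (mem_Ioc.2 ⟨hij, hjk⟩)
      have h₂ := (mem_filter.1 hBj).2.1
      omega
    intro i hi j hj hij
    rcases lt_or_gt_of_ne hij with h | h
    · exact hlt i j h (mem_Icc.1 (mem_coe.1 hj)).2
    · exact (hlt j i h (mem_Icc.1 (mem_coe.1 hi)).2).symm
  have hwindow : ∀ i ∈ Icc b k, m * (S i).card ≤ (G i).card := by
    intro i hi
    have hbi := (mem_Icc.1 hi).1
    have hik := (mem_Icc.1 hi).2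
    have hcard : (Icc 1 (α i)).card = α i := by simp
    have hratio := choose_div_choose_mul_card_le_of_window (Icc 1 (α i)) i b hbi
      (by rw [hcard]; exact hαi i hi) (S i) (G i) (fun A hA => (mem_filter.1 hA).2.1)
      (fun B hB => (mem_filter.1 hB).2.1) ?_
    · rw [hcard] at hratio
      refine le_trans ?_ hratio
      gcongr
      exact inf'_le (fun i => ((α i).choose (i - b) : ℝ) / ((α i).choose i : ℝ)) hi
    · intro A hA C hC
      obtain ⟨hAF, hAi, hAlast⟩ := mem_filter.1 hA
      obtain ⟨hCs, hCb⟩ := mem_powersetCard.1 hC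
      obtain ⟨hAn, hAk⟩ := mem_powersetCard.1 (hF hAF)
      have hdel : ∀ j, i ≤ j → j ≤ k →
          ((A \ C) ∩ Icc 1 (α j)).card = (A ∩ Icc 1 (α j)).card - b ∧
            b ≤ (A ∩ Icc 1 (α j)).card := by
        intro j hij hjk
        have hα : α i ≤ α j := by
          rcases hij.eq_or_lt with rfl | h
          · exact le_rfl
          · exact (hmono i j hbi h hjk).le
        have hCj : C ⊆ A ∩ Icc 1 (α j) :=
          hCs.trans (inter_subset_inter_left (Icc_subset_Icc_right hα))
        refine ⟨?_, hCb ▸ card_le_card hCj⟩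
        rw [← hCb, ← card_sdiff_of_subset hCj, sdiff_inter_right_comm]
      refine mem_filter.2 ⟨mem_filter.2 ⟨mem_powersetCard.2 ⟨sdiff_subset.trans hAn, ?_⟩,
        A, hAF, sdiff_subset⟩, ?_, ?_⟩
      · rw [card_sdiff_of_subset (hCs.trans inter_subset_left), hAk, hCb]
      · rw [(hdel i le_rfl hik).1, hAi]
      · intro j hj
        have hlt := hAlast j hj
        rw [mem_Ioc] at hj
        have := hdel j hj.1.le hj.2
        omega
  have hm0 : 0 ≤ m := (le_inf'_iff _ _).2 fun i _ => by positivity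
  calc m * F.card ≤ m * ((Icc b k).biUnion S).card := by
        gcongr
    _ ≤ m * ∑ i ∈ Icc b k, ((S i).card : ℝ) := by
        gcongr
        exact_mod_cast card_biUnion_le
    _ = ∑ i ∈ Icc b k, m * ((S i).card : ℝ) := mul_sum _ _ _
    _ ≤ ∑ i ∈ Icc b k, ((G i).card : ℝ) := sum_le_sum hwindow
    _ = (((Icc b k).biUnion G).card : ℝ) := by
        rw [card_biUnion hdisj]
        push_cast
        rfl
    _ ≤ shadow.card := by
        exact_mod_cast card_le_card (biUnion_subset.2 fun i _ => filter_subset _ _)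
end

section
/- Let Y be a finite set and let s, ℓ, u be positive integers with s·ℓ + u ≤ |Y|. Let H_1, …, H_s be families of ℓ-element subsets of Y and let H_{s+1} be a family of u-element subsets of Y. Suppose there do not exist pairwise disjoint sets H_1 ∈ H_1, …, H_{s+1} ∈ H_{s+1}. Then Σ_{j=1}^{s} |H_j|/C(|Y|, ℓ) + |H_{s+1}|/C(|Y|, u) ≤ s. -/
open Finset

/-- The image in `β` of a subset of `α` under a bijection from `α` onto a finset of `β`. -/
def imageUnder {α β : Type*} {Y : Finset β} (σ : α ≃ Y) (A : Finset α) : Finset β :=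
  A.map (σ.toEmbedding.trans (Function.Embedding.subtype _))

lemma imageUnder_injective {α β : Type*} {Y : Finset β} (σ : α ≃ Y) :
    Function.Injective (imageUnder σ) :=
  Finset.map_injective _

lemma imageUnder_trans {α β : Type*} {Y : Finset β} (τ : Equiv.Perm α) (σ : α ≃ Y)
    (A : Finset α) : imageUnder (τ.trans σ) A = imageUnder σ (A.map τ.toEmbedding) := by
  simp only [imageUnder, Finset.map_map]
  rfl

lemma exists_perm_map_eq_of_card_eq {α : Type*} [Fintype α] [DecidableEq α] {A B : Finset α}
    (h : #A = #B) : ∃ τ : Equiv.Perm α, A.map τ.toEmbedding = B := by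
  have e : {x // x ∈ A} ≃ {x // x ∈ B} := Finset.equivOfCardEq h
  refine ⟨e.extendSubtype, Finset.eq_of_subset_of_card_le ?_ (by simp [h])⟩
  intro x hx
  obtain ⟨a, ha, rfl⟩ := Finset.mem_map.1 hx
  exact e.extendSubtype_mem a ha

lemma card_filter_imageUnder_mem {α β : Type*} [Fintype α] [DecidableEq β]
    {Y : Finset β} {k : ℕ} {F : Finset (Finset β)} (hF : F ⊆ Y.powersetCard k) (σ : α ≃ Y) :
    #{A ∈ (univ : Finset α).powersetCard k | imageUnder σ A ∈ F} = #F := by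
  refine Finset.card_bij (fun A _ ↦ imageUnder σ A) (fun A hA ↦ (Finset.mem_filter.1 hA).2)
    (fun A _ B _ h ↦ imageUnder_injective σ h) fun B hB ↦ ?_
  obtain ⟨hBY, hBk⟩ := Finset.mem_powersetCard.1 (hF hB)
  have himage : imageUnder σ ((B.subtype (· ∈ Y)).map σ.symm.toEmbedding) = B := by
    ext x
    simp only [imageUnder, Finset.mem_map, Finset.mem_subtype]
    constructor
    · rintro ⟨_, ⟨y, hy, rfl⟩, rfl⟩
      simpa using hy
    · intro hx
      exact ⟨_, ⟨⟨x, hBY hx⟩, hx, rfl⟩, by simp⟩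
  refine ⟨_, Finset.mem_filter.2 ⟨Finset.mem_powersetCard.2 ⟨Finset.subset_univ _, ?_⟩, ?_⟩, himage⟩
  · rw [← hBk, ← congrArg Finset.card himage]
    exact (Finset.card_map _).symm
  · rwa [himage]

/-- A uniformly random bijection sends a fixed `k`-set into a family of `k`-sets with probability
the density of that family. -/
lemma card_filter_equiv_mul_choose {α β : Type*} [Fintype α] [DecidableEq α] [DecidableEq β]
    {Y : Finset β} {k : ℕ} {F : Finset (Finset β)} (hF : F ⊆ Y.powersetCard k)
    {A : Finset α} (hA : #A = k) :
    #{σ : α ≃ Y | imageUnder σ A ∈ F} * (Fintype.card α).choose k =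
      #F * Fintype.card (α ≃ Y) := by
  have hconst : ∀ B ∈ (univ : Finset α).powersetCard k,
      #{σ : α ≃ Y | imageUnder σ B ∈ F} = #{σ : α ≃ Y | imageUnder σ A ∈ F} := by
    intro B hB
    obtain ⟨τ, hτ⟩ := exists_perm_map_eq_of_card_eq
      (hA.trans (Finset.mem_powersetCard.1 hB).2.symm)
    refine Finset.card_equiv (Equiv.equivCongr τ.symm (Equiv.refl _)) fun σ ↦ ?_
    have : Equiv.equivCongr τ.symm (Equiv.refl _) σ = τ.trans σ := by ext; simp
    simp [this, imageUnder_trans, hτ]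
  have hdouble := Finset.sum_card_bipartiteAbove_eq_sum_card_bipartiteBelow
    (s := (univ : Finset α).powersetCard k) (t := (univ : Finset (α ≃ Y)))
    (fun B σ ↦ imageUnder σ B ∈ F)
  simp only [Finset.bipartiteAbove, Finset.bipartiteBelow, card_filter_imageUnder_mem hF] at hdouble
  rw [Finset.sum_congr rfl hconst] at hdouble
  simpa [mul_comm] using hdouble

/-- Averaging over random matchings: if `H_1, …, H_s` are families of `ℓ`-subsets of a
finite set `Y` and `H_{s+1}` is a family of `u`-subsets of `Y`, with `sℓ + u ≤ |Y|`, and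
the families are cross-dependent, then the sum of their densities is at most `s`. -/
theorem density_sum_bound (Y : Finset ℕ) (s ℓ u : ℕ)
    (hs : 0 < s) (hℓ : 0 < ℓ) (hu : 0 < u)
    (hsize : s * ℓ + u ≤ Y.card)
    (H : ℕ → Finset (Finset ℕ))
    (hH : ∀ j ∈ Finset.Icc 1 s, H j ⊆ Y.powersetCard ℓ)
    (hlast : H (s + 1) ⊆ Y.powersetCard u)
    (hcross : ¬ ∃ g : ℕ → Finset ℕ, (∀ i ∈ Finset.Icc 1 (s + 1), g i ∈ H i) ∧
      ∀ i ∈ Finset.Icc 1 (s + 1), ∀ j ∈ Finset.Icc 1 (s + 1), i ≠ j →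
        Disjoint (g i) (g j)) :
    (∑ j ∈ Finset.Icc 1 s, ((H j).card : ℝ) / (Y.card.choose ℓ : ℝ)) +
      ((H (s + 1)).card : ℝ) / (Y.card.choose u : ℝ) ≤ (s : ℝ) := by
  classical
  let c : ℕ → ℕ := fun i ↦ if i ≤ s then ℓ else u
  have hc : ∀ i ∈ Icc 1 (s + 1), H i ⊆ Y.powersetCard (c i) := by
    intro i hi
    obtain ⟨hi1, hi2⟩ := Finset.mem_Icc.1 hi
    by_cases h : i ≤ s
    · simpa [c, h] using hH i (Finset.mem_Icc.2 ⟨hi1, h⟩)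
    · obtain rfl : i = s + 1 := by omega
      simpa [c] using hlast
  have hblock : ∀ i ∈ Icc 1 (s + 1), (i - 1) * ℓ + c i ≤ Y.card := by
    intro i hi
    obtain ⟨hi1, hi2⟩ := Finset.mem_Icc.1 hi
    obtain ⟨j, rfl⟩ := Nat.exists_eq_add_of_le' hi1
    by_cases h : j + 1 ≤ s
    · have := Nat.mul_le_mul_right ℓ h
      simp only [c, h, if_true, Nat.add_sub_cancel]
      rw [Nat.succ_mul] at this
      omega
    · obtain rfl : j = s := by omega
      simpa [c] using hsize
  let A : ℕ → Finset (Fin Y.card) := fun i ↦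
    {x | (i - 1) * ℓ ≤ x.val ∧ x.val < (i - 1) * ℓ + c i}
  have hAcard : ∀ i ∈ Icc 1 (s + 1), #(A i) = c i := by
    intro i hi
    have : A i = (Finset.Ico ((i - 1) * ℓ) ((i - 1) * ℓ + c i)).attachFin
        (fun m hm ↦ (Finset.mem_Ico.1 hm).2.trans_le (hblock i hi)) := by
      ext x
      simp [A]
    simp [this]
  have hlt : ∀ i ∈ Icc 1 (s + 1), ∀ j ∈ Icc 1 (s + 1), i < j → Disjoint (A i) (A j) := by
    intro i hi j hj hij
    obtain ⟨hi1, hi2⟩ := Finset.mem_Icc.1 hi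
    obtain ⟨hj1, hj2⟩ := Finset.mem_Icc.1 hj
    have h : i ≤ s := by omega
    obtain ⟨k, rfl⟩ := Nat.exists_eq_add_of_le' hi1
    have hmul := Nat.mul_le_mul_right ℓ (show k + 1 ≤ j - 1 by omega)
    rw [Nat.succ_mul] at hmul
    refine Finset.disjoint_left.2 fun x hx hy ↦ ?_
    simp only [A, c, h, if_true, Finset.mem_filter, Nat.add_sub_cancel] at hx hy
    omega
  have hdisj : ∀ i ∈ Icc 1 (s + 1), ∀ j ∈ Icc 1 (s + 1), i ≠ j → Disjoint (A i) (A j) := by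
    intro i hi j hj hij
    rcases lt_or_gt_of_ne hij with h | h
    · exact hlt i hi j hj h
    · exact (hlt j hj i hi h).symm
  have hhits : ∀ σ : Fin Y.card ≃ Y, #{i ∈ Icc 1 (s + 1) | imageUnder σ (A i) ∈ H i} ≤ s := by
    intro σ
    by_contra! hmany
    have hall : {i ∈ Icc 1 (s + 1) | imageUnder σ (A i) ∈ H i} = Icc 1 (s + 1) :=
      Finset.eq_of_subset_of_card_le (Finset.filter_subset _ _) (by simpa using hmany)
    exact hcross ⟨fun i ↦ imageUnder σ (A i), Finset.filter_eq_self.1 hall,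
      fun i hi j hj hij ↦ (Finset.disjoint_map _).2 (hdisj i hi j hj hij)⟩
  have hsum : ∑ i ∈ Icc 1 (s + 1), #{σ : Fin Y.card ≃ Y | imageUnder σ (A i) ∈ H i} ≤
      s * Fintype.card (Fin Y.card ≃ Y) := by
    have hdouble := Finset.sum_card_bipartiteAbove_eq_sum_card_bipartiteBelow
      (s := Icc 1 (s + 1)) (t := (univ : Finset (Fin Y.card ≃ Y)))
      (fun i σ ↦ imageUnder σ (A i) ∈ H i)
    simp only [Finset.bipartiteAbove, Finset.bipartiteBelow] at hdouble
    rw [hdouble]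
    refine (Finset.sum_le_card_nsmul _ _ s fun σ _ ↦ hhits σ).trans_eq ?_
    simp [mul_comm]
  have hpos : (0 : ℝ) < Fintype.card (Fin Y.card ≃ Y) := by
    exact_mod_cast Fintype.card_pos_iff.2 ⟨Y.equivFin.symm⟩
  have hdensity : ∀ i ∈ Icc 1 (s + 1), (#(H i) : ℝ) / (Y.card.choose (c i) : ℝ) =
      #{σ : Fin Y.card ≃ Y | imageUnder σ (A i) ∈ H i} / Fintype.card (Fin Y.card ≃ Y) := by
    intro i hi
    have hchoose : (0 : ℝ) < Y.card.choose (c i) := by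
      exact_mod_cast Nat.choose_pos ((Nat.le_add_left _ _).trans (hblock i hi))
    rw [div_eq_div_iff hchoose.ne' hpos.ne']
    have := card_filter_equiv_mul_choose (hc i hi) (hAcard i hi)
    rw [Fintype.card_fin] at this
    exact_mod_cast this.symm
  calc
    _ = ∑ i ∈ Icc 1 (s + 1), (#(H i) : ℝ) / (Y.card.choose (c i) : ℝ) := by
      rw [Finset.sum_Icc_succ_top (by omega)]
      congr 1
      · refine Finset.sum_congr rfl fun i hi ↦ ?_
        simp [c, (Finset.mem_Icc.1 hi).2]
      · simp [c]
    _ ≤ s := by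
      rw [Finset.sum_congr rfl hdensity, ← Finset.sum_div, div_le_iff₀ hpos]
      exact_mod_cast hsum
end
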